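/- Let G be a finite group with |G| = |L₃(11)| = 2⁴·3·5²·7·11³·19 and degree pattern D(G) = D(L₃(11)) = (3,2,3,1,2,1), i.e., deg_G(2)=3, deg_G(3)=2, deg_G(5)=3, deg_G(7)=1, deg_G(11)=2, deg_G(19)=1. Then G is isomorphic to L₃(11). -/

import Mathlib

open scoped MatrixGroups

/-- Two distinct primes `p` and `q` dividing `|G|` are adjacent in the prime graph `Γ(G)`
of a finite group `G` iff `G` has an element of order `p * q`. -/
def primeGraphAdj (G : Type*) [Group G] (p q : ℕ) : Prop :=
  p ≠ q ∧ p.Prime ∧ q.Prime ∧ p ∣ Nat.card G ∧ q ∣ Nat.card G ∧ ∃ g : G, orderOf g = p * q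

open scoped Classical in
/-- The degree of a vertex `p` in the prime graph of `G`: the number of primes dividing `|G|`
that are adjacent to `p`. -/
noncomputable def primeGraphDeg (G : Type*) [Group G] (p : ℕ) : ℕ :=
  ((Nat.card G).primeFactors.filter (fun r => primeGraphAdj G p r)).card

set_option linter.unusedSectionVars false

open MulAction

/-- If every orbit meeting the invariant set `s` has cardinality divisible by `d`, so has `s`. -/
lemma dvd_card_of_orbits {H X : Type*} [Group H] [MulAction H X] [Finite X] (d : ℕ) (s : Set X)
    (hs : ∀ x ∈ s, ∀ h : H, h • x ∈ s) (hd : ∀ x ∈ s, d ∣ Nat.card (orbit H x)) :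
    d ∣ Nat.card s := by
  classical
  have := Fintype.ofFinite X
  have hfin : Fintype (Quotient (orbitRel H X)) := Fintype.ofFinite _
  have h1 : Nat.card s = (Finset.univ.filter (fun x => x ∈ s)).card := by
    rw [Nat.card_eq_fintype_card, Fintype.card_subtype]
  rw [h1, Finset.card_eq_sum_card_fiberwise (f := fun x => (Quotient.mk (orbitRel H X) x))
    (t := Finset.univ) (by intro x _; simp)]
  refine Finset.dvd_sum fun ω _ => ?_
  by_cases hne : ∃ x ∈ s, (Quotient.mk (orbitRel H X) x) = ω
  · obtain ⟨x, hx, rfl⟩ := hne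
    have h2 : ((Finset.univ.filter (fun x => x ∈ s)).filter
        (fun a => (Quotient.mk (orbitRel H X) a) = Quotient.mk (orbitRel H X) x)).card
        = Nat.card (orbit H x) := by
      rw [Nat.card_eq_fintype_card, ← Set.toFinset_card]
      congr 1
      ext y
      simp only [Finset.mem_filter, Finset.mem_univ, true_and, Set.mem_toFinset]
      rw [Quotient.eq, orbitRel_apply]
      constructor
      · exact fun h => h.2
      · rintro ⟨h, rfl⟩
        exact ⟨hs x hx h, ⟨h, rfl⟩⟩
    rw [h2]; exact hd x hx
  · have : ((Finset.univ.filter (fun x => x ∈ s)).filter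
        (fun a => (Quotient.mk (orbitRel H X) a) = ω)) = ∅ := by
      ext y
      simp only [Finset.mem_filter, Finset.mem_univ, true_and]
      constructor
      · rintro ⟨h, h'⟩; exact absurd ⟨y, h, h'⟩ hne
      · intro h; simp at h
    rw [this]; simp

section syl
variable {G : Type*} [Group G] [Finite G] {p : ℕ} [Fact p.Prime]

lemma card_orbit_sylow (P P' : Sylow p G) :
    Nat.card (orbit (P : Subgroup G) P') * Nat.card ((P : Subgroup G) ⊓ P' : Subgroup G)
      = Nat.card P := by
  have h1 : Nat.card (orbit (P : Subgroup G) P') * Nat.card (stabilizer (P : Subgroup G) P')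
      = Nat.card P := by
    rw [show Nat.card (orbit (P : Subgroup G) P') = (stabilizer (P : Subgroup G) P').index from (index_stabilizer (P : Subgroup G) P').symm, mul_comm]
    exact Subgroup.card_mul_index _
  have h2 : Nat.card (stabilizer (P : Subgroup G) P')
      = Nat.card ((P : Subgroup G) ⊓ P' : Subgroup G) := by
    have hinf := IsPGroup.inf_normalizer_sylow P.2 P'
    refine Nat.card_congr
      { toFun := fun x => ⟨x.1.1, ?_⟩
        invFun := fun x => ⟨⟨x.1, x.2.1⟩, ?_⟩
        left_inv := fun x => by simp
        right_inv := fun x => by simp }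
    · have hx := x.2
      rw [mem_stabilizer_iff] at hx
      have hx' : (x.1.1 : G) • P' = P' := hx
      rw [Sylow.smul_eq_iff_mem_normalizer] at hx'
      have : (x.1.1 : G) ∈ (P : Subgroup G) ⊓ Subgroup.normalizer (P' : Set G) := ⟨x.1.2, hx'⟩
      rw [hinf] at this
      exact this
    · rw [mem_stabilizer_iff]
      change (x.1 : G) • P' = P'
      rw [Sylow.smul_eq_iff_mem_normalizer]
      exact Subgroup.le_normalizer x.2.2
  rw [← h2]
  exact h1

lemma inf_smul_card (P P' : Sylow p G) (g : G) (hg : g ∈ P) :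
    Nat.card ((P : Subgroup G) ⊓ (g • P' : Sylow p G) : Subgroup G)
      = Nat.card ((P : Subgroup G) ⊓ P' : Subgroup G) := by
  have h1 := card_orbit_sylow P (g • P')
  have h2 := card_orbit_sylow P P'
  have h3 : orbit (P : Subgroup G) (g • P') = orbit (P : Subgroup G) P' :=
    MulAction.orbit_eq_iff.2 ⟨⟨g, hg⟩, rfl⟩
  rw [h3] at h1
  have hpos : 0 < Nat.card (orbit (P : Subgroup G) P') := by
    rcases Nat.eq_zero_or_pos (Nat.card (orbit (P : Subgroup G) P')) with h | h
    · rw [h, zero_mul] at h2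
      exact absurd h2.symm Nat.card_pos.ne'
    · exact h
  exact Nat.eq_of_mul_eq_mul_left hpos (h1.trans h2.symm)

lemma sylow_inter_dvd (P : Sylow p G) (d : ℕ) :
    d ∣ Nat.card {P' : Sylow p G | P' ≠ P ∧
      d * Nat.card ((P : Subgroup G) ⊓ P' : Subgroup G) ∣ Nat.card P} := by
  apply dvd_card_of_orbits (H := (P : Subgroup G)) d
  · rintro P' ⟨h1, h2⟩ ⟨g, hg⟩
    refine ⟨?_, ?_⟩
    · intro h
      apply h1
      change g • P' = P at h
      have h4 : g • P = P := by
        rw [Sylow.smul_eq_iff_mem_normalizer]; exact Subgroup.le_normalizer hg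
      rw [← h4] at h
      exact smul_left_cancel g h
    · have := inf_smul_card P P' g hg
      change d * Nat.card ((P : Subgroup G) ⊓ (g • P' : Sylow p G) : Subgroup G) ∣ _
      rw [this]; exact h2
  · rintro P' ⟨h1, h2⟩
    rw [← card_orbit_sylow P P'] at h2
    exact Nat.dvd_of_mul_dvd_mul_right Nat.card_pos h2

/-- If all other Sylow subgroups meet `P` in index divisible by `d`, the count is `1` mod `d`. -/
lemma sylow_modEq_of_inter (P : Sylow p G) (d : ℕ)
    (h : ∀ P' : Sylow p G, P' ≠ P →
      d * Nat.card ((P : Subgroup G) ⊓ P' : Subgroup G) ∣ Nat.card P) :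
    Nat.card (Sylow p G) ≡ 1 [MOD d] := by
  have h1 := sylow_inter_dvd P d
  have h2 : {P' : Sylow p G | P' ≠ P ∧
      d * Nat.card ((P : Subgroup G) ⊓ P' : Subgroup G) ∣ Nat.card P} = ({P} : Set (Sylow p G))ᶜ := by
    ext Q; simp only [Set.mem_setOf_eq, Set.mem_compl_iff, Set.mem_singleton_iff]
    exact ⟨fun h => h.1, fun h' => ⟨h', h Q h'⟩⟩
  rw [h2] at h1
  have h3 : Nat.card (({P} : Set (Sylow p G))ᶜ : Set _) + 1 = Nat.card (Sylow p G) := by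
    have := Set.ncard_add_ncard_compl ({P} : Set (Sylow p G))
    rw [Set.ncard_singleton] at this
    rw [← this, add_comm]; rfl
  rw [← h3]
  have := (Nat.modEq_zero_iff_dvd.2 h1).add_right 1
  simpa using this

end syl

section count
variable {G : Type*} [Group G] [Finite G]

/-- Subgroups of order `d` of `A` pairwise meeting in `Z` : there are few of them. -/
lemma count_subgroups {ι : Type*} [Finite ι] (A Z : Subgroup G) (f : ι → Subgroup G) (d : ℕ)
    (hA : ∀ i, f i ≤ A) (hZ : ∀ i, Z ≤ f i) (hd : ∀ i, Nat.card (f i) = d) (hZA : Z ≤ A)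
    (hinter : ∀ i j, i ≠ j → f i ⊓ f j ≤ Z) :
    Nat.card ι * (d - Nat.card Z) + Nat.card Z ≤ Nat.card A ∧
    (Nat.card ι * (d - Nat.card Z) + Nat.card Z = Nat.card A →
      ∀ a ∈ A, a ∉ Z → ∃ i, a ∈ f i) := by
  classical
  have := Fintype.ofFinite ι
  have := Fintype.ofFinite G
  set S : ι → Finset G := fun i => Finset.univ.filter (fun x => x ∈ f i ∧ x ∉ Z) with hS
  set ZF : Finset G := Finset.univ.filter (fun x => x ∈ Z) with hZF
  have hcZ : ZF.card = Nat.card Z := by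
    rw [Nat.card_eq_fintype_card, Fintype.card_subtype]
  have hcA : (Finset.univ.filter (fun x => x ∈ A)).card = Nat.card A := by
    rw [Nat.card_eq_fintype_card, Fintype.card_subtype]
  have hcS : ∀ i, (S i).card = d - Nat.card Z := by
    intro i
    have : S i = (Finset.univ.filter (fun x => x ∈ f i)) \ ZF := by
      ext x; simp [hS, hZF]
    have hci : (Finset.univ.filter (fun x => x ∈ f i)).card = d := by
      rw [← hd i, Nat.card_eq_fintype_card, Fintype.card_subtype]
    rw [this, Finset.card_sdiff_of_subset, hcZ, hci]
    · intro x; simp only [hZF, Finset.mem_filter, Finset.mem_univ, true_and]; exact fun h => hZ i h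
  have hdisj : (↑(Finset.univ : Finset ι) : Set ι).PairwiseDisjoint S := by
    intro i _ j _ hij
    rw [Function.onFun, Finset.disjoint_left]
    intro x hx hx'
    simp only [hS, Finset.mem_filter, Finset.mem_univ, true_and] at hx hx'
    exact hx.2 (hinter i j hij ⟨hx.1, hx'.1⟩)
  have hU : (Finset.univ.biUnion S).card = Nat.card ι * (d - Nat.card Z) := by
    rw [Finset.card_biUnion hdisj, Finset.sum_congr rfl (fun i _ => hcS i)]
    simp
  have hdZ : Disjoint (Finset.univ.biUnion S) ZF := by
    rw [Finset.disjoint_left]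
    intro x hx hx'
    simp only [hS, hZF, Finset.mem_biUnion, Finset.mem_filter, Finset.mem_univ, true_and] at hx hx'
    obtain ⟨i, hi⟩ := hx
    exact hi.2 hx'
  have hsub : (Finset.univ.biUnion S) ∪ ZF ⊆ Finset.univ.filter (fun x => x ∈ A) := by
    intro x hx
    simp only [hS, hZF, Finset.mem_union, Finset.mem_biUnion, Finset.mem_filter, Finset.mem_univ,
      true_and] at hx ⊢
    rcases hx with ⟨i, hi⟩ | hx
    · exact hA i hi.1
    · exact hZA hx
  have hcard : ((Finset.univ.biUnion S) ∪ ZF).card = Nat.card ι * (d - Nat.card Z) + Nat.card Z := by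
    rw [Finset.card_union_of_disjoint hdZ, hU, hcZ]
  constructor
  · rw [← hcard, ← hcA]; exact Finset.card_le_card hsub
  · intro h a ha haZ
    have := Finset.eq_of_subset_of_card_le hsub (by rw [hcard, hcA, h])
    have ha' : a ∈ Finset.univ.filter (fun x => x ∈ A) := by simpa using ha
    rw [← this] at ha'
    simp only [hS, hZF, Finset.mem_union, Finset.mem_biUnion, Finset.mem_filter, Finset.mem_univ,
      true_and] at ha'
    rcases ha' with ⟨i, hi⟩ | hx
    · exact ⟨i, hi.1⟩
    · exact absurd hx haZ

end count

section fixed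
variable {G : Type*} [Group G] [Finite G]

/-- Conjugation action of `Q` on a subgroup `E` it normalizes. -/
@[reducible] def conjActOn (Q E : Subgroup G) (h : Q ≤ Subgroup.normalizer (E : Set G)) : MulAction Q E where
  smul q e := ⟨q * e * (q : G)⁻¹, (Subgroup.mem_normalizer_iff.1 (h q.2) e).1 e.2⟩
  one_smul e := by
    apply Subtype.ext
    change ((1 : Q) : G) * e * ((1 : Q) : G)⁻¹ = e
    simp
  mul_smul a b e := by
    apply Subtype.ext
    change ((a * b : Q) : G) * e * ((a * b : Q) : G)⁻¹ = a * (b * e * (b : G)⁻¹) * (a : G)⁻¹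
    push_cast; group

lemma card_fixed_modEq {q : ℕ} [Fact q.Prime] (Q E : Subgroup G) (hQ : IsPGroup q Q)
    (h : Q ≤ Subgroup.normalizer (E : Set G)) :
    Nat.card E ≡ Nat.card (E ⊓ Subgroup.centralizer (Q : Set G) : Subgroup G) [MOD q] := by
  letI := conjActOn Q E h
  have h1 := hQ.card_modEq_card_fixedPoints E
  have h2 : Nat.card (fixedPoints Q E)
      = Nat.card (E ⊓ Subgroup.centralizer (Q : Set G) : Subgroup G) := by
    refine Nat.card_congr
      { toFun := fun x => ⟨x.1.1, x.1.2, ?_⟩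
        invFun := fun x => ⟨⟨x.1, x.2.1⟩, ?_⟩
        left_inv := fun x => by simp
        right_inv := fun x => by simp }
    · change (x.1.1 : G) ∈ Subgroup.centralizer (Q : Set G)
      rw [Subgroup.mem_centralizer_iff]
      intro g hg
      have := congrArg Subtype.val (x.2 ⟨g, hg⟩)
      change g * x.1.1 * g⁻¹ = x.1.1 at this
      exact mul_inv_eq_iff_eq_mul.1 this
    · intro g
      apply Subtype.ext
      change (g : G) * x.1 * (g : G)⁻¹ = x.1
      rw [mul_inv_eq_iff_eq_mul]
      exact Subgroup.mem_centralizer_iff.1 x.2.2 g g.2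
  rw [h2] at h1
  exact h1

end fixed

set_option linter.unusedSectionVars false
open MulAction

section tools
variable {G : Type*} [Group G] [Finite G] {p : ℕ} [hp : Fact p.Prime]

lemma fact_of_card {k n : ℕ} (hG : Nat.card G = p ^ k * n) (hn : ¬ p ∣ n) :
    (Nat.card G).factorization p = k := by
  have hn0 : n ≠ 0 := by rintro rfl; simp at hn
  rw [hG, Nat.factorization_mul (pow_ne_zero _ hp.1.ne_zero) hn0]
  simp [hp.1.factorization_self, Nat.factorization_eq_zero_of_not_dvd hn]

lemma sylow_card {k n : ℕ} (hG : Nat.card G = p ^ k * n) (hn : ¬ p ∣ n) (S : Sylow p G) :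
    Nat.card S = p ^ k := by
  rw [S.card_eq_multiplicity, fact_of_card hG hn]

lemma sylow_of_card {k n : ℕ} (hG : Nat.card G = p ^ k * n) (hn : ¬ p ∣ n) (Q : Subgroup G)
    (hQ : Nat.card Q = p ^ k) : ∃ S : Sylow p G, (S : Subgroup G) = Q :=
  ⟨Sylow.ofCard Q (by rw [hQ, fact_of_card hG hn]), rfl⟩

lemma sylow_count (S : Sylow p G) :
    Nat.card (Sylow p G) * Nat.card (Subgroup.normalizer (S : Set G)) = Nat.card G := by
  rw [S.card_eq_index_normalizer, mul_comm]
  exact Subgroup.card_mul_index _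

lemma sylow_num_dvd {k n : ℕ} (hG : Nat.card G = p ^ k * n) (hn : ¬ p ∣ n) :
    Nat.card (Sylow p G) ∣ n := by
  obtain ⟨S⟩ := (inferInstance : Nonempty (Sylow p G))
  have h := S.card_dvd_index
  have h2 := (S : Subgroup G).card_mul_index
  have h3 := sylow_card hG hn S
  rw [h3, hG] at h2
  rwa [Nat.eq_of_mul_eq_mul_left (pow_pos hp.1.pos _) h2] at h

lemma sylow_num_mod : Nat.card (Sylow p G) % p = 1 := by
  have := card_sylow_modEq_one p G
  unfold Nat.ModEq at this
  rwa [Nat.one_mod_eq_one.2 hp.1.ne_one] at this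

lemma card_subgroupOf {H Q : Subgroup G} (h : Q ≤ H) : Nat.card (Q.subgroupOf H) = Nat.card Q :=
  Nat.card_congr (Subgroup.subgroupOfEquivOfLe h).toEquiv

/-- Sylow uniqueness inside a subgroup, by an arithmetic criterion. -/
lemma subgroup_sylow_unique {k n : ℕ} (H Q Q' : Subgroup G) (hQ : Q ≤ H) (hQ' : Q' ≤ H)
    (hH : Nat.card H = p ^ k * n) (hn : ¬ p ∣ n) (cQ : Nat.card Q = p ^ k)
    (cQ' : Nat.card Q' = p ^ k) (harith : Nat.card (Sylow p H) = 1) : Q = Q' := by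
  obtain ⟨S, hS⟩ := sylow_of_card hH hn (Q.subgroupOf H) (by rw [card_subgroupOf hQ, cQ])
  obtain ⟨S', hS'⟩ := sylow_of_card hH hn (Q'.subgroupOf H) (by rw [card_subgroupOf hQ', cQ'])
  have : S = S' := by
    have := (Nat.card_eq_one_iff_unique.1 harith).1
    exact Subsingleton.elim _ _
  have h2 : Q.subgroupOf H = Q'.subgroupOf H := by rw [← hS, ← hS', this]
  have := Subgroup.subgroupOf_inj.1 h2
  rwa [inf_eq_left.2 hQ, inf_eq_left.2 hQ'] at this

lemma exists_orderOf {H : Subgroup G} (h : p ∣ Nat.card H) : ∃ x ∈ H, orderOf x = p := by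
  obtain ⟨x, hx⟩ := exists_prime_orderOf_dvd_card' (G := H) p h
  exact ⟨x.1, x.2, by rw [← hx]; exact Subgroup.orderOf_coe x⟩

lemma eq_of_card_ge {H K : Subgroup G} (h : H ≤ K) (hc : Nat.card K ≤ Nat.card H) : H = K := by
  exact Subgroup.eq_of_le_of_card_ge h hc

lemma isPGroup_of_card (Q : Subgroup G) {k : ℕ} (hQ : Nat.card Q = p ^ k) : IsPGroup p Q :=
  IsPGroup.of_card hQ

/-- prime order subgroups meeting nontrivially coincide. -/
lemma prime_inter (A B : Subgroup G) (hA : Nat.card A = p) (hB : Nat.card B = p) (h : A ≠ B) :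
    A ⊓ B = ⊥ := by
  have h1 : Nat.card (A ⊓ B : Subgroup G) ∣ p := hA ▸ Subgroup.card_dvd_of_le inf_le_left
  rcases (Nat.dvd_prime hp.1).1 h1 with h1 | h1
  · exact Subgroup.card_eq_one.1 h1
  · exfalso; apply h
    have e1 := eq_of_card_ge (inf_le_left : A ⊓ B ≤ A) (by rw [h1, hA])
    have e2 := eq_of_card_ge (inf_le_right : A ⊓ B ≤ B) (by rw [h1, hB])
    rw [← e1]; exact e2

end tools

section X

lemma div400 {n : ℕ} (h : n ∣ 400) : n = 1 ∨ n = 2 ∨ n = 4 ∨ n = 8 ∨ n = 16 ∨ n = 5 ∨ n = 10 ∨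
    n = 20 ∨ n = 40 ∨ n = 80 ∨ n = 25 ∨ n = 50 ∨ n = 100 ∨ n = 200 ∨ n = 400 := by
  have h1 : n ∈ Nat.divisors 400 := Nat.mem_divisors.2 ⟨h, by norm_num⟩
  have h2 : Nat.divisors 400 = {1,2,4,8,16,5,10,20,40,80,25,50,100,200,400} := by decide +kernel
  rw [h2] at h1
  simpa using h1

instance fact5 : Fact (Nat.Prime 5) := ⟨by norm_num⟩
instance fact7 : Fact (Nat.Prime 7) := ⟨by norm_num⟩
instance fact11 : Fact (Nat.Prime 11) := ⟨by norm_num⟩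
instance fact19 : Fact (Nat.Prime 19) := ⟨by norm_num⟩

lemma num11_400 {n s : ℕ} (h : n ∣ 400) (hs : s ∣ n) (hm : s % 11 = 1) : s = 1 ∨ s = 100 := by
  rcases div400 (hs.trans h) with h | h | h | h | h | h | h | h | h | h | h | h | h | h | h <;>
    subst h <;> simp at hm ⊢

lemma lemX {X : Type*} [Group X] [Finite X] (hX : Nat.card X ∣ 11 * 400) (A B : Subgroup X)
    (hA : Nat.card A = 11) (hB : Nat.card B = 11) : A = B := by
  by_contra hAB
  have h11 : 11 ∣ Nat.card X := hA ▸ Subgroup.card_subgroup_dvd_card A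
  obtain ⟨n, hn⟩ := h11
  have hn4 : n ∣ 400 := by
    rw [hn] at hX; exact Nat.dvd_of_mul_dvd_mul_left (by norm_num) hX
  have hn11 : ¬ 11 ∣ n := fun h => absurd (h.trans hn4) (by norm_num)
  have hX1 : Nat.card X = 11 ^ 1 * n := by rw [hn, pow_one]
  have hs := sylow_num_dvd hX1 hn11
  have hs100 : Nat.card (Sylow 11 X) = 100 := by
    rcases num11_400 hn4 hs sylow_num_mod with h | h
    · exfalso; apply hAB
      obtain ⟨S, hS⟩ := sylow_of_card hX1 hn11 A (by simpa using hA)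
      obtain ⟨T, hT⟩ := sylow_of_card hX1 hn11 B (by simpa using hB)
      have := (Nat.card_eq_one_iff_unique.1 h).1
      rw [← hS, ← hT, Subsingleton.elim S T]
    · exact h
  rw [hs100] at hs
  have hn3 : n = 100 ∨ n = 200 ∨ n = 400 := by
    rcases div400 hn4 with h | h | h | h | h | h | h | h | h | h | h | h | h | h | h <;>
      subst h <;> simp at hs ⊢
  -- no commuting elements
  have star : ∀ C : Subgroup X, Nat.card C = 11 → ¬ 5 ∣ Nat.card (Subgroup.normalizer (C : Set X)) := by
    intro C hC h5
    obtain ⟨S, hS⟩ := sylow_of_card hX1 hn11 C (by simpa using hC)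
    have := sylow_count S
    have e : (S : Set X) = (C : Set X) := by rw [← hS]; rfl
    rw [hs100, hn, e] at this
    omega
  have star2 : ∀ E : Subgroup X, (Nat.card E = 5 ∨ Nat.card E = 25) →
      ¬ 11 ∣ Nat.card (Subgroup.normalizer (E : Set X)) := by
    intro E hE h
    obtain ⟨x, hx, ox⟩ := exists_orderOf h
    have hc : Nat.card (Subgroup.zpowers x) = 11 := by rw [Nat.card_zpowers, ox]
    have hm := card_fixed_modEq (Subgroup.zpowers x) E (isPGroup_of_card (p := 11) _ (k := 1) hc)
      (by rw [Subgroup.zpowers_le]; exact hx)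
    have hdv : Nat.card (E ⊓ Subgroup.centralizer (Subgroup.zpowers x : Set X) : Subgroup X) ∣ 5 ^ 2 := by
      refine (Subgroup.card_dvd_of_le inf_le_left).trans ?_
      rcases hE with h | h <;> rw [h] <;> norm_num
    have h5 : 5 ∣ Nat.card (E ⊓ Subgroup.centralizer (Subgroup.zpowers x : Set X) : Subgroup X) := by
      obtain ⟨i, hi, hi'⟩ := (Nat.dvd_prime_pow (by norm_num)).1 hdv
      rw [hi'] at hm ⊢
      rcases Nat.eq_zero_or_pos i with h0 | h0
      · subst h0; unfold Nat.ModEq at hm; rcases hE with h | h <;> rw [h] at hm <;> simp at hm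
      · exact dvd_pow_self 5 h0.ne'
    refine star _ hc (h5.trans (Subgroup.card_dvd_of_le (inf_le_right.trans ?_)))
    exact Subgroup.centralizer_le_normalizer _
  obtain ⟨j, hj, hj5⟩ : ∃ j, n = 25 * j ∧ (j = 4 ∨ j = 8 ∨ j = 16) := by
    rcases hn3 with h | h | h
    · exact ⟨4, by omega⟩
    · exact ⟨8, by omega⟩
    · exact ⟨16, by omega⟩
  have hX5 : Nat.card X = 5 ^ 2 * (11 * j) := by rw [hn, hj]; ring
  have hj5' : ¬ 5 ∣ 11 * j := by omega
  obtain ⟨Q⟩ := (inferInstance : Nonempty (Sylow 5 X))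
  have cQ : ∀ Q : Sylow 5 X, Nat.card Q = 25 := fun Q => sylow_card hX5 hj5' Q
  have hd := sylow_num_dvd hX5 hj5'
  have hm : Nat.card (Sylow 5 X) % 5 = 1 := sylow_num_mod
  have hc := sylow_count Q
  have hN := star2 Q (Or.inr (cQ Q))
  have comm : ∀ (S : Sylow 5 X), ∀ x ∈ S, ∀ y ∈ S, x * y = y * x := by
    intro S x hx y hy
    have := IsPGroup.commutative_of_card_eq_prime_sq (p := 5) (G := S) (by rw [cQ]; norm_num)
    exact congrArg Subtype.val (this ⟨x, hx⟩ ⟨y, hy⟩)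
  have h11n : 11 ∣ Nat.card (Sylow 5 X) := by
    have : 11 ∣ Nat.card (Sylow 5 X) * Nat.card (Subgroup.normalizer (Q : Set X)) := by
      rw [hc, hn]; exact dvd_mul_right _ _
    exact ((Nat.Prime.dvd_mul (by norm_num)).1 this).resolve_right hN
  obtain ⟨k, hk⟩ := h11n
  have hk16 : k ∣ 16 := by
    rw [hk] at hd
    refine (Nat.dvd_of_mul_dvd_mul_left (by norm_num) hd).trans ?_
    rcases hj5 with h | h | h <;> rw [h] <;> norm_num
  have hkk : k = 1 ∨ k = 16 := by
    have : k ≤ 16 := Nat.le_of_dvd (by norm_num) hk16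
    rw [hk] at hm
    interval_cases k <;> omega
  rcases hkk with h | h
  · -- eleven Sylow 5-subgroups
    subst h
    have hex : ∃ Q' : Sylow 5 X, Q' ≠ Q ∧ Nat.card ((Q : Subgroup X) ⊓ Q' : Subgroup X) ≠ 1 := by
      by_contra hcon
      push Not at hcon
      have := sylow_modEq_of_inter Q 25 (fun P' hP' => by rw [hcon P' hP', cQ])
      rw [hk] at this
      exact absurd this (by decide)
    obtain ⟨Q', hne, h1⟩ := hex
    set E : Subgroup X := (Q : Subgroup X) ⊓ Q' with hE
    have hEd : Nat.card E ∣ 5 ^ 2 := by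
      have := Subgroup.card_dvd_of_le (inf_le_left : E ≤ (Q : Subgroup X))
      rwa [show Nat.card (Q : Subgroup X) = 25 from cQ Q] at this
    have hE5 : Nat.card E = 5 := by
      obtain ⟨i, hi, hi'⟩ := (Nat.dvd_prime_pow (by norm_num)).1 hEd
      interval_cases i
      · exact absurd hi' (by simpa using h1)
      · simpa using hi'
      · exfalso; apply hne
        have e1 := eq_of_card_ge (inf_le_left : E ≤ (Q : Subgroup X)) (by rw [hi']; exact (cQ Q).le)
        have e2 := eq_of_card_ge (inf_le_right : E ≤ (Q' : Subgroup X)) (by rw [hi']; exact (cQ Q').le)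
        exact Sylow.ext (e2.symm.trans e1)
    have hle : ∀ S : Sylow 5 X, E ≤ (S : Subgroup X) → (S : Subgroup X) ≤ Subgroup.normalizer (E : Set X) := by
      intro S hS x hx
      rw [Subgroup.mem_normalizer_iff]
      have key : ∀ y ∈ E, x * y * x⁻¹ = y := by
        intro y hy
        rw [comm S x hx y (hS hy)]; group
      intro y
      constructor
      · intro hy; rw [key y hy]; exact hy
      · intro hy
        have h3 := key _ hy
        have : x * y * x⁻¹ = y := by
          have h4 : x * (x * y * x⁻¹) * x⁻¹ = x * y * x⁻¹ := h3
          exact mul_left_cancel (mul_right_cancel h4)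
        rw [this] at hy; exact hy
    have hQN := hle Q inf_le_left
    have hQN' := hle Q' inf_le_right
    set N := Subgroup.normalizer (E : Set X)
    have hN11 : ¬ 11 ∣ Nat.card N := star2 E (Or.inl hE5)
    have hNd : Nat.card N ∣ 400 := by
      have h1 : Nat.card N ∣ 11 * n := hn ▸ Subgroup.card_subgroup_dvd_card N
      exact ((Nat.Coprime.dvd_of_dvd_mul_left
        ((Nat.Prime.coprime_iff_not_dvd (by norm_num)).2 hN11).symm) h1).trans hn4
    have hN25 : 25 ∣ Nat.card N := cQ Q ▸ Subgroup.card_dvd_of_le hQN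
    obtain ⟨r, hr⟩ := hN25
    have hr16 : r ∣ 16 := by
      rw [hr] at hNd
      exact Nat.dvd_of_mul_dvd_mul_left (by norm_num : 0 < 25) hNd
    have hr5 : ¬ 5 ∣ r := fun h => absurd (h.trans hr16) (by norm_num)
    have hs1 := sylow_num_dvd (p := 5) (k := 2) (G := N) hr hr5
    have hs2 : Nat.card (Sylow 5 N) % 5 = 1 := sylow_num_mod
    have hs3 : Nat.card (Sylow 5 N) ≤ 11 := by
      have : Nat.card (Sylow 5 N) ≤ Nat.card (Sylow 5 X) := by
        have inj : Function.Injective (fun S : Sylow 5 N =>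
            (Classical.choose (Sylow.exists_comap_subtype_eq S))) := by
          intro S T hST
          have h1 := Classical.choose_spec (Sylow.exists_comap_subtype_eq S)
          have h2 := Classical.choose_spec (Sylow.exists_comap_subtype_eq T)
          simp only at hST
          rw [hST] at h1
          exact Sylow.ext (h1.symm.trans h2)
        exact Nat.card_le_card_of_injective _ inj
      omega
    have hs4 : Nat.card (Sylow 5 N) = 1 := by
      have : Nat.card (Sylow 5 N) ∣ 16 := hs1.trans hr16
      generalize Nat.card (Sylow 5 N) = z at *
      interval_cases z <;> omega
    apply hne
    exact Sylow.ext (subgroup_sylow_unique (p := 5) N Q' Q hQN' hQN (k := 2) hr hr5 (cQ Q') (cQ Q) hs4)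
  · -- 176 Sylow 5-subgroups
    subst h
    have hj16 : j = 16 := by
      rw [hk] at hd
      have := Nat.le_of_dvd (by omega) hd
      omega
    have hNQ : Nat.card (Subgroup.normalizer (Q : Set X)) = 25 := by
      rw [hk, hn, hj, hj16] at hc; omega
    have hQe : (Q : Subgroup X) = Subgroup.normalizer (Q : Set X) :=
      eq_of_card_ge (Subgroup.le_normalizer) (by rw [hNQ]; exact (cQ Q).ge)
    have hP : Subgroup.normalizer (Q : Set X) ≤ Subgroup.centralizer (Q : Set X) := by
      intro x hx
      rw [← hQe] at hx
      rw [Subgroup.mem_centralizer_iff]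
      intro y hy
      exact comm Q y hy x hx
    have hcomp := MonoidHom.ker_transferSylow_isComplement' Q hP
    set W := (MonoidHom.transferSylow Q hP).ker
    have hWc : Nat.card W * 25 = Nat.card X := by
      rw [← hcomp.card_mul_card]; congr 1; exact (cQ Q).symm
    have hW : Nat.card W = 176 := by rw [hn, hj, hj16] at hWc; omega
    have c11 : ∀ S : Sylow 11 X, Nat.card (S : Subgroup X) = 11 := fun S => by
      have := sylow_card hX1 hn11 S
      simpa using this
    have hle : ∀ S : Sylow 11 X, (S : Subgroup X) ≤ W := by
      intro S x hx
      rw [MonoidHom.mem_ker]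
      have h1 : orderOf (MonoidHom.transferSylow Q hP x) ∣ 11 := by
        refine (orderOf_map_dvd _ x).trans ?_
        have := Subgroup.orderOf_dvd_natCard (S : Subgroup X) hx
        rwa [c11] at this
      have h2 : orderOf (MonoidHom.transferSylow Q hP x) ∣ 25 := by
        have := orderOf_dvd_natCard (MonoidHom.transferSylow Q hP x)
        rwa [cQ Q] at this
      have := Nat.dvd_gcd h1 h2
      norm_num at this
      exact this
    have := (count_subgroups W ⊥ (fun S : Sylow 11 X => (S : Subgroup X)) 11 hle (fun _ => bot_le) c11
      bot_le (fun S T hST => (prime_inter (p := 11) _ _ (c11 S) (c11 T)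
        (fun h => hST (Sylow.ext h))).le)).1
    rw [hs100, hW, Subgroup.card_bot] at this
    omega

lemma lemX' {G : Type*} [Group G] [Finite G] (Γ N Q Q' : Subgroup G) (hN : N ≤ Q) (hN' : N ≤ Q')
    (hQ : Q ≤ Γ) (hQ' : Q' ≤ Γ) (hΓ : Γ ≤ Subgroup.normalizer (N : Set G))
    (cQ : Nat.card Q = 11 * Nat.card N) (cQ' : Nat.card Q' = 11 * Nat.card N)
    (cΓ : Nat.card Γ ∣ 11 * 400 * Nat.card N) : Q = Q' := by
  have hnorm : (N.subgroupOf Γ).Normal := Subgroup.normal_subgroupOf_of_le_normalizer hΓ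
  have hNΓ : N ≤ Γ := hN.trans hQ
  have hNpos : 0 < Nat.card N := Nat.card_pos
  have e1 := Subgroup.card_eq_card_quotient_mul_card_subgroup (N.subgroupOf Γ)
  rw [card_subgroupOf hNΓ] at e1
  rw [e1] at cΓ
  have cX := Nat.dvd_of_mul_dvd_mul_right hNpos cΓ
  have key : ∀ R : Subgroup G, N ≤ R → R ≤ Γ → Nat.card R = 11 * Nat.card N →
      Nat.card ((R.subgroupOf Γ).map (QuotientGroup.mk' (N.subgroupOf Γ))) = 11 ∧
      ((R.subgroupOf Γ).map (QuotientGroup.mk' (N.subgroupOf Γ))).comap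
        (QuotientGroup.mk' (N.subgroupOf Γ)) = R.subgroupOf Γ := by
    intro R h1 h2 h3
    have h4 : N.subgroupOf Γ ≤ R.subgroupOf Γ := Subgroup.comap_mono h1
    have h5 : ((R.subgroupOf Γ).map (QuotientGroup.mk' (N.subgroupOf Γ))).comap
        (QuotientGroup.mk' (N.subgroupOf Γ)) = R.subgroupOf Γ := by
      rw [Subgroup.comap_map_eq, QuotientGroup.ker_mk', sup_eq_left.2 h4]
    refine ⟨?_, h5⟩
    have h6 := Subgroup.index_comap_of_surjective
      ((R.subgroupOf Γ).map (QuotientGroup.mk' (N.subgroupOf Γ)))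
      (QuotientGroup.mk'_surjective (N.subgroupOf Γ))
    rw [h5] at h6
    have h7 := (R.subgroupOf Γ).card_mul_index
    have h8 := ((R.subgroupOf Γ).map (QuotientGroup.mk' (N.subgroupOf Γ))).card_mul_index
    rw [← h6] at h8
    rw [card_subgroupOf h2, h3, e1, ← h8] at h7
    have hi : 0 < (R.subgroupOf Γ).index := Nat.pos_of_ne_zero Subgroup.index_ne_zero_of_finite
    have : (11 : ℕ) * (Nat.card N * (R.subgroupOf Γ).index) =
      Nat.card ((R.subgroupOf Γ).map (QuotientGroup.mk' (N.subgroupOf Γ))) *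
        (Nat.card N * (R.subgroupOf Γ).index) := by
      rw [← mul_assoc, h7]; ring
    exact (Nat.eq_of_mul_eq_mul_right (Nat.mul_pos hNpos hi) this).symm
  have k1 := key Q hN hQ cQ
  have k2 := key Q' hN' hQ' cQ'
  have := lemX cX _ _ k1.1 k2.1
  have h2 : Q.subgroupOf Γ = Q'.subgroupOf Γ := by rw [← k1.2, ← k2.2, this]
  have := Subgroup.subgroupOf_inj.1 h2
  rwa [inf_eq_left.2 hQ, inf_eq_left.2 hQ'] at this

end X

set_option linter.unusedSectionVars false
open MulAction

section stage1
variable {G : Type*} [Group G] [Finite G]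

lemma primes_G (hcard : Nat.card G = 2 ^ 4 * 3 * 5 ^ 2 * 7 * 11 ^ 3 * 19) :
    (Nat.card G).primeFactors = {2, 3, 5, 7, 11, 19} := by
  rw [hcard]
  rw [Nat.primeFactors_mul (by norm_num) (by norm_num), Nat.primeFactors_mul (by norm_num) (by norm_num),
    Nat.primeFactors_mul (by norm_num) (by norm_num), Nat.primeFactors_mul (by norm_num) (by norm_num),
    Nat.primeFactors_mul (by norm_num) (by norm_num),
    Nat.primeFactors_prime_pow (by norm_num) (by norm_num),
    Nat.primeFactors_prime_pow (by norm_num) (by norm_num),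
    Nat.primeFactors_prime_pow (by norm_num) (by norm_num),
    Nat.Prime.primeFactors (by norm_num), Nat.Prime.primeFactors (by norm_num),
    Nat.Prime.primeFactors (by norm_num)]
  decide

lemma adj_symm' {p q : ℕ} : primeGraphAdj G p q ↔ primeGraphAdj G q p := by
  unfold primeGraphAdj
  constructor <;> rintro ⟨h1, h2, h3, h4, h5, g, h6⟩ <;>
    exact ⟨h1.symm, h3, h2, h5, h4, g, by rw [h6, mul_comm]⟩

lemma adj_of_commute {p q : ℕ} (hp : p.Prime) (hq : q.Prime) (hpq : p ≠ q) (x y : G)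
    (hx : orderOf x = p) (hy : orderOf y = q) (h : Commute x y) : primeGraphAdj G p q := by
  refine ⟨hpq, hp, hq, hx ▸ orderOf_dvd_natCard x, hy ▸ orderOf_dvd_natCard y, x * y, ?_⟩
  rw [h.orderOf_mul_eq_mul_orderOf_of_coprime, hx, hy]
  rw [hx, hy]; exact (Nat.coprime_primes hp hq).2 hpq

open scoped Classical in
lemma deg_eq (hcard : Nat.card G = 2 ^ 4 * 3 * 5 ^ 2 * 7 * 11 ^ 3 * 19) (p : ℕ) :
    primeGraphDeg G p = (if primeGraphAdj G p 2 then 1 else 0) + (if primeGraphAdj G p 3 then 1 else 0)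
      + (if primeGraphAdj G p 5 then 1 else 0) + (if primeGraphAdj G p 7 then 1 else 0)
      + (if primeGraphAdj G p 11 then 1 else 0) + (if primeGraphAdj G p 19 then 1 else 0) := by
  unfold primeGraphDeg
  rw [primes_G hcard, Finset.card_filter]
  rw [Finset.sum_insert (by decide), Finset.sum_insert (by decide), Finset.sum_insert (by decide),
    Finset.sum_insert (by decide), Finset.sum_insert (by decide), Finset.sum_singleton]
  simp only [add_assoc]

open scoped Classical in
lemma ind (P : Prop) : ∃ e : ℕ, (if P then 1 else 0) = e ∧ e ≤ 1 ∧ (P ↔ e = 1) := by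
  by_cases h : P
  · exact ⟨1, by simp [h]⟩
  · exact ⟨0, by simp [h]⟩

lemma adj_irrefl {p : ℕ} : ¬ primeGraphAdj G p p := fun h => h.1 rfl

lemma graph_arith (e3_2 e5_2 e5_3 e7_2 e7_3 e7_5 e11_2 e11_3 e11_5 e11_7 e19_2 e19_3 e19_5 e19_7 e19_11 : ℕ)
   (l3_2 : e3_2 ≤ 1) (l5_2 : e5_2 ≤ 1) (l5_3 : e5_3 ≤ 1) (l7_2 : e7_2 ≤ 1) (l7_3 : e7_3 ≤ 1) (l7_5 : e7_5 ≤ 1) (l11_2 : e11_2 ≤ 1) (l11_3 : e11_3 ≤ 1) (l11_5 : e11_5 ≤ 1) (l11_7 : e11_7 ≤ 1) (l19_2 : e19_2 ≤ 1) (l19_3 : e19_3 ≤ 1) (l19_5 : e19_5 ≤ 1) (l19_7 : e19_7 ≤ 1) (l19_11 : e19_11 ≤ 1)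
    (d2 : e3_2 + e5_2 + e7_2 + e11_2 + e19_2 = 3)
    (d3 : e3_2 + e5_3 + e7_3 + e11_3 + e19_3 = 2)
    (d5 : e5_2 + e5_3 + e7_5 + e11_5 + e19_5 = 3)
    (d7 : e7_2 + e7_3 + e7_5 + e11_7 + e19_7 = 1)
    (d11 : e11_2 + e11_3 + e11_5 + e11_7 + e19_11 = 2)
    (d19 : e19_2 + e19_3 + e19_5 + e19_7 + e19_11 = 1)
    : (e19_7 = 1 → e11_3 = 0 ∧ e11_7 = 0 ∧ e19_11 = 0) ∧
    (e19_11 = 1 → e11_3 = 0 ∧ e11_7 = 0 ∧ (e11_2 = 0 ∨ e11_5 = 0)) ∧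
    (e19_2 = 1 ∨ e19_3 = 1 ∨ e19_5 = 1 ∨ e19_7 = 1 ∨ e19_11 = 1) := by
  refine ⟨fun h => ?_, fun h => ?_, by clear * - d19; omega⟩
  · obtain ⟨a1, a2, a3, a4⟩ : e19_2 = 0 ∧ e19_3 = 0 ∧ e19_5 = 0 ∧ e19_11 = 0 := by
      clear * - d19 h; omega
    obtain ⟨b1, b2, b3, b4⟩ : e7_2 = 0 ∧ e7_3 = 0 ∧ e7_5 = 0 ∧ e11_7 = 0 := by
      clear * - d7 h; omega
    have c1 : e11_2 = 1 := by clear * - d2 a1 b1 l3_2 l5_2 l11_2; omega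
    have c2 : e11_5 = 1 := by clear * - d5 a3 b3 l5_3 l5_2 l11_5; omega
    refine ⟨?_, b4, a4⟩
    clear * - d11 c1 c2; omega
  · obtain ⟨a1, a2, a3, a4⟩ : e19_2 = 0 ∧ e19_3 = 0 ∧ e19_5 = 0 ∧ e19_7 = 0 := by
      clear * - d19 h; omega
    have c7 : e11_7 = 0 := by
      clear * - d11 d7 d2 h a1 a4 l11_7 l3_2 l5_2 l7_2
      rcases Nat.eq_zero_or_pos e11_7 with h0 | h0
      · exact h0
      · have b1 : e7_2 = 0 := by omega
        have b2 : e11_2 = 0 := by omega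
        omega
    have c3 : e11_3 = 0 := by
      clear * - d11 d7 d2 d5 h a1 a3 l11_3 l3_2 l5_2 l7_2 l5_3 l7_5
      rcases Nat.eq_zero_or_pos e11_3 with h0 | h0
      · exact h0
      · have b2 : e11_2 = 0 := by omega
        have b3 : e11_5 = 0 := by omega
        have b4 : e7_2 = 1 := by omega
        have b5 : e7_5 = 1 := by omega
        omega
    refine ⟨c3, c7, ?_⟩
    clear * - d11 h; omega

/-- arithmetic consequences of the degree pattern -/
lemma graph_cases (hcard : Nat.card G = 2 ^ 4 * 3 * 5 ^ 2 * 7 * 11 ^ 3 * 19)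
    (hdeg2 : primeGraphDeg G 2 = 3) (hdeg3 : primeGraphDeg G 3 = 2)
    (hdeg5 : primeGraphDeg G 5 = 3) (hdeg7 : primeGraphDeg G 7 = 1)
    (hdeg11 : primeGraphDeg G 11 = 2) (hdeg19 : primeGraphDeg G 19 = 1) :
    ∃ r, (r = 2 ∨ r = 3 ∨ r = 5 ∨ r = 7 ∨ r = 11) ∧ primeGraphAdj G 19 r ∧
      (∀ q, primeGraphAdj G 19 q → q = r) ∧
      (r = 7 → ¬ primeGraphAdj G 11 3 ∧ ¬ primeGraphAdj G 11 7 ∧ ¬ primeGraphAdj G 11 19) ∧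
      (r = 11 → ¬ primeGraphAdj G 11 3 ∧ ¬ primeGraphAdj G 11 7 ∧
        (¬ primeGraphAdj G 11 2 ∨ ¬ primeGraphAdj G 11 5)) := by
  classical
  rw [deg_eq hcard] at hdeg2 hdeg3 hdeg5 hdeg7 hdeg11 hdeg19
  have s32 := adj_symm' (G := G) (p := 3) (q := 2)
  have s52 := adj_symm' (G := G) (p := 5) (q := 2)
  have s53 := adj_symm' (G := G) (p := 5) (q := 3)
  have s72 := adj_symm' (G := G) (p := 7) (q := 2)
  have s73 := adj_symm' (G := G) (p := 7) (q := 3)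
  have s75 := adj_symm' (G := G) (p := 7) (q := 5)
  have s2 := adj_symm' (G := G) (p := 2) (q := 11)
  have s3 := adj_symm' (G := G) (p := 3) (q := 11)
  have s5 := adj_symm' (G := G) (p := 5) (q := 11)
  have s7 := adj_symm' (G := G) (p := 7) (q := 11)
  have t2 := adj_symm' (G := G) (p := 2) (q := 19)
  have t3 := adj_symm' (G := G) (p := 3) (q := 19)
  have t5 := adj_symm' (G := G) (p := 5) (q := 19)
  have t7 := adj_symm' (G := G) (p := 7) (q := 19)
  have t11 := adj_symm' (G := G) (p := 11) (q := 19)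
  have hq : ∀ q, primeGraphAdj G 19 q → q = 2 ∨ q = 3 ∨ q = 5 ∨ q = 7 ∨ q = 11 := by
    intro q h
    have : q ∈ (Nat.card G).primeFactors := Nat.mem_primeFactors.2 ⟨h.2.2.1, h.2.2.2.2.1, Nat.card_pos.ne'⟩
    rw [primes_G hcard] at this
    simp only [Finset.mem_insert, Finset.mem_singleton] at this
    have := h.1
    omega
  simp only [s32, s52, s53, s72, s73, s75, s2, s3, s5, s7, t2, t3, t5, t7, t11, if_neg adj_irrefl] at hdeg2 hdeg3 hdeg5 hdeg7 hdeg11 hdeg19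
  obtain ⟨e3_2, h3_2, l3_2, i3_2⟩ := ind (primeGraphAdj G 2 3)
  obtain ⟨e5_2, h5_2, l5_2, i5_2⟩ := ind (primeGraphAdj G 2 5)
  obtain ⟨e5_3, h5_3, l5_3, i5_3⟩ := ind (primeGraphAdj G 3 5)
  obtain ⟨e7_2, h7_2, l7_2, i7_2⟩ := ind (primeGraphAdj G 2 7)
  obtain ⟨e7_3, h7_3, l7_3, i7_3⟩ := ind (primeGraphAdj G 3 7)
  obtain ⟨e7_5, h7_5, l7_5, i7_5⟩ := ind (primeGraphAdj G 5 7)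
  obtain ⟨e11_2, h11_2, l11_2, i11_2⟩ := ind (primeGraphAdj G 11 2)
  obtain ⟨e11_3, h11_3, l11_3, i11_3⟩ := ind (primeGraphAdj G 11 3)
  obtain ⟨e11_5, h11_5, l11_5, i11_5⟩ := ind (primeGraphAdj G 11 5)
  obtain ⟨e11_7, h11_7, l11_7, i11_7⟩ := ind (primeGraphAdj G 11 7)
  obtain ⟨e19_2, h19_2, l19_2, i19_2⟩ := ind (primeGraphAdj G 19 2)
  obtain ⟨e19_3, h19_3, l19_3, i19_3⟩ := ind (primeGraphAdj G 19 3)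
  obtain ⟨e19_5, h19_5, l19_5, i19_5⟩ := ind (primeGraphAdj G 19 5)
  obtain ⟨e19_7, h19_7, l19_7, i19_7⟩ := ind (primeGraphAdj G 19 7)
  obtain ⟨e19_11, h19_11, l19_11, i19_11⟩ := ind (primeGraphAdj G 19 11)
  simp only [h3_2, h5_2, h5_3, h7_2, h7_3, h7_5, h11_2, h11_3, h11_5, h11_7, h19_2, h19_3, h19_5, h19_7, h19_11] at hdeg2 hdeg3 hdeg5 hdeg7 hdeg11 hdeg19
  rw [t11]
  simp only [i11_2, i11_3, i11_5, i11_7, i19_2, i19_3, i19_5, i19_7, i19_11]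
  have hq' : ∀ r, (r = 2 ∨ r = 3 ∨ r = 5 ∨ r = 7 ∨ r = 11) → primeGraphAdj G 19 r →
      (∀ q, primeGraphAdj G 19 q → q = r) := by
    intro r hr h q h'
    rcases hr with rfl | rfl | rfl | rfl | rfl <;>
    rcases hq q h' with rfl | rfl | rfl | rfl | rfl <;>
    first | rfl | (exfalso; simp only [i19_2, i19_3, i19_5, i19_7, i19_11] at h h'; clear * - hdeg19 h h'; omega)
  obtain ⟨k7, k11, hex⟩ := graph_arith e3_2 e5_2 e5_3 e7_2 e7_3 e7_5 e11_2 e11_3 e11_5 e11_7 e19_2 e19_3 e19_5 e19_7 e19_11 l3_2 l5_2 l5_3 l7_2 l7_3 l7_5 l11_2 l11_3 l11_5 l11_7 l19_2 l19_3 l19_5 l19_7 l19_11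
    (by clear * - hdeg2; omega) (by clear * - hdeg3; omega) (by clear * - hdeg5; omega) (by clear * - hdeg7; omega) (by clear * - hdeg11; omega) (by clear * - hdeg19; omega)
  rcases hex with h | h | h | h | h
  · exact ⟨2, by simp, i19_2.2 h, hq' 2 (by simp) (i19_2.2 h), by simp, by simp⟩
  · exact ⟨3, by simp, i19_3.2 h, hq' 3 (by simp) (i19_3.2 h), by simp, by simp⟩
  · exact ⟨5, by simp, i19_5.2 h, hq' 5 (by simp) (i19_5.2 h), by simp, by simp⟩
  · refine ⟨7, by simp, i19_7.2 h, hq' 7 (by simp) (i19_7.2 h), fun _ => ?_, by simp⟩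
    have := k7 h
    clear * - this
    omega
  · refine ⟨11, by simp, i19_11.2 h, hq' 11 (by simp) (i19_11.2 h), by simp, fun _ => ?_⟩
    have := k11 h
    clear * - this
    omega

/-- N/C for a subgroup of prime order. -/
lemma nc_prime {p : ℕ} [hp : Fact p.Prime] (S : Subgroup G) (hS : Nat.card S = p) :
    ∃ e, e ∣ p - 1 ∧ Nat.card (Subgroup.normalizer (S : Set G))
      = Nat.card (Subgroup.centralizer (S : Set G)) * e := by
  have hcyc : IsCyclic S := isCyclic_of_prime_card hS
  have key := Subgroup.card_dvd_of_injective _ (QuotientGroup.kerLift_injective S.normalizerMonoidHom)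
  rw [Subgroup.normalizerMonoidHom_ker, ← Subgroup.index, ← Subgroup.relIndex] at key
  rw [hcyc.card_mulAut, hS, Nat.totient_prime hp.1] at key
  refine ⟨_, key, ?_⟩
  have h1 := ((Subgroup.centralizer (S : Set G)).subgroupOf
    (Subgroup.normalizer (S : Set G))).card_mul_index
  rw [card_subgroupOf (Subgroup.centralizer_le_normalizer _)] at h1
  exact h1.symm

/-- prime divisors of a centralizer -/
lemma adj_of_dvd_centralizer {p q : ℕ} [hp : Fact p.Prime] (hq : q.Prime) (hpq : p ≠ q)
    (S : Subgroup G) (hS : p ∣ Nat.card S) (h : q ∣ Nat.card (Subgroup.centralizer (S : Set G))) :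
    primeGraphAdj G p q := by
  have : Fact q.Prime := ⟨hq⟩
  obtain ⟨x, hx, ox⟩ := exists_orderOf hS
  obtain ⟨y, hy, oy⟩ := exists_orderOf h
  exact adj_of_commute hp.1 hq hpq x y ox oy (Subgroup.mem_centralizer_iff.1 hy x hx)

lemma prime_of_dvd (hcard : Nat.card G = 2 ^ 4 * 3 * 5 ^ 2 * 7 * 11 ^ 3 * 19) {q : ℕ} (hq : q.Prime)
    (h : q ∣ Nat.card G) : q = 2 ∨ q = 3 ∨ q = 5 ∨ q = 7 ∨ q = 11 ∨ q = 19 := by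
  have : q ∈ (Nat.card G).primeFactors := Nat.mem_primeFactors.2 ⟨hq, h, Nat.card_pos.ne'⟩
  rw [primes_G hcard] at this
  simpa using this

lemma strip {n a b p : ℕ} (hp : p.Prime) (h : n ∣ p ^ a * b) (hn : ¬ p ∣ n) : n ∣ b :=
  Nat.Coprime.dvd_of_dvd_mul_left
    ((Nat.Coprime.pow_left a ((Nat.Prime.coprime_iff_not_dvd hp).2 hn)).symm) h

lemma dec1 : ∀ d ∈ Nat.divisors (121 * 16), d % 19 = 1 → d = 1 := by decide +kernel
lemma dec2 : ∀ d ∈ Nat.divisors (121 * 25), d % 19 = 1 → d = 1 := by decide +kernel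

end stage1

set_option linter.unusedSectionVars false
open MulAction

section stage1b
variable {G : Type*} [Group G] [Finite G]

lemma normalizer_le_of_unique {p : ℕ} [Fact p.Prime] {k n : ℕ} (Q S : Subgroup G)
    (hS : S ≤ Subgroup.centralizer (Q : Set G))
    (hc : Nat.card (Subgroup.centralizer (Q : Set G)) = p ^ k * n) (hn : ¬ p ∣ n)
    (cS : Nat.card S = p ^ k)
    (h1 : Nat.card (Sylow p (Subgroup.centralizer (Q : Set G))) = 1) :
    Subgroup.normalizer (Q : Set G) ≤ Subgroup.normalizer (S : Set G) := by
  intro g hg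
  have hT : S.map (MulAut.conj g).toMonoidHom = S := by
    refine subgroup_sylow_unique (p := p) (k := k) (n := n) (Subgroup.centralizer (Q : Set G)) _ _ ?_ hS hc hn
      ?_ cS h1
    · rintro _ ⟨s, hs, rfl⟩
      rw [Subgroup.mem_centralizer_iff]
      intro q hq
      have hq' := (Subgroup.mem_normalizer_iff''.1 hg q).1 hq
      have := Subgroup.mem_centralizer_iff.1 (hS hs) _ hq'
      change q * (g * s * g⁻¹) = g * s * g⁻¹ * q
      have h2 : g * (g⁻¹ * q * g * s) * g⁻¹ = g * (s * (g⁻¹ * q * g)) * g⁻¹ := by rw [this]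
      calc q * (g * s * g⁻¹) = g * (g⁻¹ * q * g * s) * g⁻¹ := by group
        _ = g * (s * (g⁻¹ * q * g)) * g⁻¹ := h2
        _ = _ := by group
    · rw [← cS]
      exact Nat.card_congr (S.equivMapOfInjective _ (MulAut.conj g).injective).symm.toEquiv
  rw [Subgroup.mem_normalizer_iff]
  intro h
  constructor
  · intro hh
    have : g * h * g⁻¹ ∈ S.map (MulAut.conj g).toMonoidHom := ⟨h, hh, rfl⟩
    rwa [hT] at this
  · intro hh
    rw [← hT] at hh
    obtain ⟨s, hs, e⟩ := hh
    have : g * s * g⁻¹ = g * h * g⁻¹ := e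
    rw [← mul_left_cancel (mul_right_cancel this)]
    exact hs

lemma stage1_r2 (hcard : Nat.card G = 2 ^ 4 * 3 * 5 ^ 2 * 7 * 11 ^ 3 * 19) (S : Sylow 19 G)
    (cS : Nat.card S = 19)
    (hNC : Subgroup.normalizer (S : Set G) ≤ Subgroup.centralizer (S : Set G)) :
    primeGraphAdj G 19 7 := by
  have hcomp := MonoidHom.ker_transferSylow_isComplement' S hNC
  set f := MonoidHom.transferSylow S hNC
  have hMc : Nat.card f.ker * 19 = Nat.card G := by
    rw [← hcomp.card_mul_card]; congr 1; exact cS.symm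
  have hkill : ∀ x : G, ¬ 19 ∣ orderOf x → x ∈ f.ker := by
    intro x hx
    rw [MonoidHom.mem_ker]
    have h2 : orderOf (f x) ∣ 19 := by
      have := orderOf_dvd_natCard (f x)
      rwa [cS] at this
    have h3 := orderOf_map_dvd f x
    rcases (Nat.dvd_prime (by norm_num)).1 h2 with h | h
    · exact orderOf_eq_one_iff.1 h
    · rw [h] at h3; exact absurd h3 hx
  obtain ⟨P⟩ := (inferInstance : Nonempty (Sylow 7 G))
  have hG7 : Nat.card G = 7 ^ 1 * (2 ^ 4 * 3 * 5 ^ 2 * 11 ^ 3 * 19) := by rw [hcard]; norm_num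
  have cP : Nat.card P = 7 := by simpa using sylow_card hG7 (by norm_num) P
  have hker : ∀ H : Subgroup G, ¬ 19 ∣ Nat.card H → H ≤ f.ker := by
    intro H hH x hx
    exact hkill x fun h => hH (h.trans (Subgroup.orderOf_dvd_natCard H hx))
  have hPle : (P : Subgroup G) ≤ f.ker := hker _ (by
    rw [show Nat.card (P : Subgroup G) = 7 from cP]; norm_num)
  have hF := Sylow.normalizer_sup_eq_top' P hPle
  have h19 : 19 ∣ Nat.card (Subgroup.normalizer (P : Set G)) := by
    by_contra hcon
    have := hker _ hcon
    have h2 : f.ker = ⊤ := by rw [← hF]; exact (sup_eq_right.2 this).symm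
    rw [h2, Subgroup.card_top] at hMc
    have : 0 < Nat.card G := Nat.card_pos
    omega
  obtain ⟨x, hx, ox⟩ := exists_orderOf h19
  have hc : Nat.card (Subgroup.zpowers x) = 19 := by rw [Nat.card_zpowers, ox]
  have hm := card_fixed_modEq (Subgroup.zpowers x) P (isPGroup_of_card (p := 19) _ (k := 1) hc)
      (by rw [Subgroup.zpowers_le]; exact hx)
  rw [show Nat.card (P : Subgroup G) = 7 from cP] at hm
  have hdv : Nat.card ((P : Subgroup G) ⊓ Subgroup.centralizer (Subgroup.zpowers x : Set G) : Subgroup G) ∣ 7 := by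
    have := Subgroup.card_dvd_of_le (inf_le_left : (P : Subgroup G) ⊓ Subgroup.centralizer (Subgroup.zpowers x : Set G) ≤ P)
    rwa [show Nat.card (P : Subgroup G) = 7 from cP] at this
  have h7 : 7 ∣ Nat.card ((P : Subgroup G) ⊓ Subgroup.centralizer (Subgroup.zpowers x : Set G) : Subgroup G) := by
    rcases (Nat.dvd_prime (by norm_num)).1 hdv with h | h
    · rw [h] at hm; exact absurd hm (by decide)
    · rw [h]
  exact adj_of_dvd_centralizer (p := 19) (by norm_num) (by norm_num) (Subgroup.zpowers x) (by rw [hc])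
    (h7.trans (Subgroup.card_dvd_of_le inf_le_right))

lemma stage1_r11 (hcard : Nat.card G = 2 ^ 4 * 3 * 5 ^ 2 * 7 * 11 ^ 3 * 19) (S : Sylow 19 G)
    (cS : Nat.card S = 19) (a e : ℕ) (hae : (a = 2 ∧ e = 3) ∨ (a = 3 ∧ e = 2))
    (hC : Nat.card (Subgroup.centralizer (S : Set G)) = 19 * 11 ^ a)
    (hN : Nat.card (Subgroup.normalizer (S : Set G)) = 19 * 11 ^ a * e)
    (h3 : ¬ primeGraphAdj G 11 3) (h7 : ¬ primeGraphAdj G 11 7)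
    (h25 : ¬ primeGraphAdj G 11 2 ∨ ¬ primeGraphAdj G 11 5) : False := by
  obtain ⟨Q, hQ, cQ⟩ : ∃ Q : Subgroup G, Q ≤ Subgroup.centralizer (S : Set G) ∧ Nat.card Q = 11 ^ a := by
    obtain ⟨T, hT⟩ := Sylow.exists_subgroup_card_pow_prime (G := Subgroup.centralizer (S : Set G)) 11
      (n := a) (by rw [hC]; exact dvd_mul_left _ _)
    refine ⟨T.map (Subgroup.centralizer (S : Set G)).subtype, Subgroup.map_subtype_le T, ?_⟩
    rw [← hT]
    exact Nat.card_congr (T.equivMapOfInjective _ (Subgroup.subtype_injective _)).symm.toEquiv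
  have ha : a = 2 ∨ a = 3 := by omega
  have hSQ : (S : Subgroup G) ≤ Subgroup.centralizer (Q : Set G) := by
    intro s hs
    rw [Subgroup.mem_centralizer_iff]
    intro q hq
    exact (Subgroup.mem_centralizer_iff.1 (hQ hq) s hs).symm
  have h11Q : 11 ∣ Nat.card Q := by rw [cQ]; rcases ha with rfl | rfl <;> norm_num
  have hpQ : IsPGroup 11 Q := isPGroup_of_card Q cQ
  -- the center of Q
  obtain ⟨z, hzQ, oz, hzc⟩ : ∃ z ∈ Q, orderOf z = 11 ∧ z ∈ Subgroup.centralizer (Q : Set G) := by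
    have : Nontrivial Q := by
      rw [← Finite.one_lt_card_iff_nontrivial, cQ]; rcases ha with rfl | rfl <;> norm_num
    have hnt := hpQ.center_nontrivial
    have hpc : IsPGroup 11 (Subgroup.center Q) := hpQ.to_subgroup _
    obtain ⟨k, hk0, hk⟩ := hpc.nontrivial_iff_card.1 hnt
    obtain ⟨z, hz, oz⟩ := exists_orderOf (p := 11) (H := Subgroup.center Q) (by rw [hk]; exact dvd_pow_self _ hk0.ne')
    refine ⟨z.1, z.2, by rw [← oz]; exact Subgroup.orderOf_coe z, ?_⟩
    rw [Subgroup.mem_centralizer_iff]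
    intro q hq
    exact congrArg Subtype.val (Subgroup.mem_center_iff.1 hz ⟨q, hq⟩)
  set C := Subgroup.centralizer (Q : Set G) with hCdef
  have hCG : Nat.card C ∣ Nat.card G := Subgroup.card_subgroup_dvd_card C
  have hadj : ∀ q, q.Prime → 11 ≠ q → ¬ primeGraphAdj G 11 q → ¬ q ∣ Nat.card C := by
    intro q hq hne h h'
    exact h (adj_of_dvd_centralizer hq hne Q h11Q h')
  have n3 := hadj 3 (by norm_num) (by norm_num) h3
  have n7 := hadj 7 (by norm_num) (by norm_num) h7
  have hd1 : Nat.card C ∣ 2 ^ 4 * (5 ^ 2 * (11 ^ 3 * 19)) := by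
    apply strip (p := 3) (a := 1) (by norm_num) _ n3
    apply strip (p := 7) (a := 1) (by norm_num) _ n7
    rw [hcard] at hCG
    convert hCG using 1 <;> norm_num
  -- number of Sylow 19 subgroups of C
  have h19C : 19 ∣ Nat.card C := by
    have := Subgroup.card_dvd_of_le hSQ
    rwa [show Nat.card (S : Subgroup G) = 19 from cS] at this
  obtain ⟨n, hn⟩ := h19C
  have hnd : n ∣ 2 ^ 4 * (5 ^ 2 * 11 ^ 3) := by
    rw [hn] at hd1
    have : 19 * n ∣ 19 * (2 ^ 4 * (5 ^ 2 * 11 ^ 3)) := by convert hd1 using 1 <;> norm_num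
    exact Nat.dvd_of_mul_dvd_mul_left (by norm_num) this
  have hn19 : ¬ 19 ∣ n := fun h => absurd (h.trans hnd) (by norm_num)
  have hn' : Nat.card C = 19 ^ 1 * n := by rw [hn, pow_one]
  have hone : Nat.card (Sylow 19 C) = 1 := by
    obtain ⟨S', hS'⟩ := sylow_of_card hn' hn19 ((S : Subgroup G).subgroupOf C)
      (by rw [card_subgroupOf hSQ, show Nat.card (S : Subgroup G) = 19 from cS, pow_one])
    have hcount := sylow_count S'
    have hmod : Nat.card (Sylow 19 C) % 19 = 1 := sylow_num_mod
    have h209 : 11 * 19 ∣ Nat.card (Subgroup.normalizer (S' : Set C)) := by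
      have e1 : (11 : ℕ) ∣ Nat.card (Subgroup.normalizer (S' : Set C)) := by
        have : orderOf (⟨z, hzc⟩ : C) = 11 := by rw [← oz]; exact (Subgroup.orderOf_mk ..)
        rw [← this]
        apply Subgroup.orderOf_dvd_natCard
        apply Subgroup.centralizer_le_normalizer
        rw [Subgroup.mem_centralizer_iff]
        intro s hs
        have hs' : s ∈ (S : Subgroup G).subgroupOf C := by rw [← hS']; exact hs
        apply Subtype.ext
        exact (Subgroup.mem_centralizer_iff.1 (hQ hzQ) s.1 hs')
      have e2 : (19 : ℕ) ∣ Nat.card (Subgroup.normalizer (S' : Set C)) := by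
        have : Nat.card (S' : Subgroup C) ∣ _ := Subgroup.card_dvd_of_le (Subgroup.le_normalizer (H := (S' : Subgroup C)))
        rw [show Nat.card (S' : Subgroup C) = 19 by simpa using sylow_card hn' hn19 S'] at this
        exact this
      exact Nat.Coprime.mul_dvd_of_dvd_of_dvd (by norm_num) e1 e2
    obtain ⟨t, ht⟩ := h209
    have hdd : Nat.card (Sylow 19 C) ∣ 2 ^ 4 * (5 ^ 2 * 11 ^ 2) := by
      have : Nat.card (Sylow 19 C) * 209 ∣ (2 ^ 4 * (5 ^ 2 * 11 ^ 2)) * 209 := by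
        refine Dvd.dvd.trans ?_ (show Nat.card C ∣ _ by convert hd1 using 1 <;> norm_num)
        exact ⟨t, by rw [← hcount, ht]; ring⟩
      exact Nat.dvd_of_mul_dvd_mul_right (by norm_num) this
    have hsd : Nat.card (Sylow 19 C) ∣ Nat.card C := ⟨_, hcount.symm⟩
    rcases h25 with h | h
    · have n2 := hadj 2 (by norm_num) (by norm_num) h
      have := strip (p := 2) (a := 4) (by norm_num) hdd (fun h => n2 (h.trans hsd))
      exact dec2 _ (Nat.mem_divisors.2 ⟨by convert this using 1 <;> norm_num, by norm_num⟩) hmod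
    · have n5 := hadj 5 (by norm_num) (by norm_num) h
      have := strip (p := 5) (a := 2) (b := 2 ^ 4 * 11 ^ 2) (by norm_num) (by convert hdd using 1 <;> norm_num) (fun h => n5 (h.trans hsd))
      exact dec1 _ (Nat.mem_divisors.2 ⟨by convert this using 1 <;> norm_num, by norm_num⟩) hmod
  have hle := normalizer_le_of_unique Q S hSQ hn' hn19 (by simpa using cS) hone
  have hdvd := Subgroup.card_dvd_of_le hle
  change _ ∣ Nat.card (Subgroup.normalizer (S : Set G)) at hdvd
  rw [hN] at hdvd
  rcases hae with ⟨rfl, rfl⟩ | ⟨rfl, rfl⟩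
  · have h1331 := Sylow.prime_pow_dvd_card_normalizer (G := G) (p := 11) (n := 2) (H := Q)
      (by rw [hcard]; norm_num) cQ
    exact absurd (h1331.trans hdvd) (by norm_num)
  · have hG11 : Nat.card G = 11 ^ 3 * (2 ^ 4 * 3 * 5 ^ 2 * 7 * 19) := by rw [hcard]; norm_num
    obtain ⟨P, hP⟩ := sylow_of_card hG11 (by norm_num) Q cQ
    have hc := sylow_count P
    have hm : Nat.card (Sylow 11 G) % 11 = 1 := sylow_num_mod
    have e1 : Nat.card (Subgroup.normalizer (P : Set G)) = Nat.card (Subgroup.normalizer (Q : Set G)) := by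
      rw [← hP]; rfl
    rw [← e1] at hdvd
    have h19 : 19 * 11 ^ 3 ∣ Nat.card (Subgroup.normalizer (P : Set G)) := by
      rw [e1]
      apply Nat.Coprime.mul_dvd_of_dvd_of_dvd (by norm_num)
      · have := Subgroup.card_dvd_of_le (hSQ.trans (Subgroup.centralizer_le_normalizer _))
        rwa [show Nat.card (S : Subgroup G) = 19 from cS] at this
      · rw [← cQ]; exact Subgroup.card_dvd_of_le Subgroup.le_normalizer
    obtain ⟨t, ht⟩ := h19
    rw [ht] at hdvd hc
    have ht2 := Nat.dvd_of_mul_dvd_mul_left (by norm_num) hdvd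
    rw [hcard] at hc
    rcases (Nat.dvd_prime (by norm_num)).1 ht2 with h | h <;> subst h <;> omega


lemma stage1 (hcard : Nat.card G = 2 ^ 4 * 3 * 5 ^ 2 * 7 * 11 ^ 3 * 19)
    (hdeg2 : primeGraphDeg G 2 = 3) (hdeg3 : primeGraphDeg G 3 = 2)
    (hdeg5 : primeGraphDeg G 5 = 3) (hdeg7 : primeGraphDeg G 7 = 1)
    (hdeg11 : primeGraphDeg G 11 = 2) (hdeg19 : primeGraphDeg G 19 = 1) :
    ¬ primeGraphAdj G 11 3 ∧ ¬ primeGraphAdj G 11 7 ∧ ¬ primeGraphAdj G 11 19 ∧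
      ¬ primeGraphAdj G 19 5 ∧ ¬ primeGraphAdj G 19 2 := by
  obtain ⟨r, hr, hadj, huniq, hr7, hr11⟩ := graph_cases hcard hdeg2 hdeg3 hdeg5 hdeg7 hdeg11 hdeg19
  have hG19 : Nat.card G = 19 ^ 1 * 11180400 := by rw [hcard]; norm_num
  obtain ⟨S, hrC⟩ : ∃ S : Sylow 19 G, r ∣ Nat.card (Subgroup.centralizer (S : Set G)) := by
    obtain ⟨-, -, hrp, -, -, g, hg⟩ := hadj
    have h1 : orderOf (g ^ r) = 19 := by
      rw [orderOf_pow_of_dvd hrp.ne_zero (by rw [hg]; exact dvd_mul_left _ _), hg]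
      exact Nat.mul_div_cancel _ hrp.pos
    have h2 : orderOf (g ^ 19) = r := by
      rw [orderOf_pow_of_dvd (by norm_num) (by rw [hg]; exact dvd_mul_right _ _), hg]
      exact Nat.mul_div_cancel_left _ (by norm_num)
    obtain ⟨S, hS⟩ := sylow_of_card hG19 (by norm_num) (Subgroup.zpowers (g ^ r))
      (by rw [Nat.card_zpowers, h1, pow_one])
    refine ⟨S, ?_⟩
    rw [← h2]
    apply Subgroup.orderOf_dvd_natCard
    rw [Subgroup.mem_centralizer_iff]
    intro x hx
    have hx' : x ∈ Subgroup.zpowers (g ^ r) := by rw [← hS]; exact hx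
    obtain ⟨k, rfl⟩ := Subgroup.mem_zpowers_iff.1 hx'
    exact (((Commute.refl g).pow_pow r 19).zpow_left k)
  have cS : Nat.card S = 19 := by simpa using sylow_card hG19 (by norm_num) S
  obtain ⟨e, he, hNe⟩ := nc_prime (p := 19) (S : Subgroup G) cS
  have hcount := sylow_count S
  have hmod : Nat.card (Sylow 19 G) % 19 = 1 := sylow_num_mod
  have h19C : 19 ∣ Nat.card (Subgroup.centralizer (S : Set G)) := by
    have : (S : Subgroup G) ≤ Subgroup.centralizer (S : Set G) := by
      have hcyc : IsCyclic S := isCyclic_of_prime_card cS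
      intro s hs
      rw [Subgroup.mem_centralizer_iff]
      intro t ht
      have := hcyc.isMulCommutative.is_comm.comm (⟨t, ht⟩ : S) ⟨s, hs⟩
      exact congrArg Subtype.val this
    have := Subgroup.card_dvd_of_le this
    rwa [show Nat.card (S : Subgroup G) = 19 from cS] at this
  obtain ⟨c, hc⟩ := h19C
  change Nat.card (Subgroup.normalizer (S : Set G)) = Nat.card (Subgroup.centralizer (S : Set G)) * e at hNe
  rw [hNe, hc, hG19] at hcount
  have hce : Nat.card (Sylow 19 G) * (c * e) = 11180400 := by
    have : 19 * (Nat.card (Sylow 19 G) * (c * e)) = 19 * 11180400 := by rw [pow_one] at hcount; rw [← hcount]; ring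
    exact Nat.eq_of_mul_eq_mul_left (by norm_num) this
  have hceM : (c * e) % 19 = 2 := by
    have := congrArg (· % 19) hce
    beta_reduce at this
    rw [Nat.mul_mod, hmod, one_mul, Nat.mod_mod] at this
    exact this
  have hced : c * e ∣ 11180400 := ⟨_, by rw [← hce]; ring⟩
  have hcd : c ∣ 11180400 := (dvd_mul_right _ _).trans hced
  have hed : e ∣ 11180400 := (dvd_mul_left _ _).trans hced
  have hr19 : r ≠ 19 := by omega
  have hcpow : c = r ^ c.primeFactorsList.length := by
    apply Nat.eq_prime_pow_of_unique_prime_dvd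
    · rintro rfl; simp at hceM
    · intro d hd hdc
      apply huniq
      refine adj_of_dvd_centralizer (p := 19) hd ?_ (S : Subgroup G) (by rw [show Nat.card (S : Subgroup G) = 19 from cS]) ?_
      · rintro rfl; exact absurd (hdc.trans hcd) (by norm_num)
      · change d ∣ Nat.card (Subgroup.centralizer (S : Set G))
        rw [hc]; exact hdc.trans (dvd_mul_left _ _)
  generalize c.primeFactorsList.length = a at hcpow
  have he6 : e = 1 ∨ e = 2 ∨ e = 3 ∨ e = 6 := by
    have h1 : e ∣ 6 := by
      have := Nat.dvd_gcd he hed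
      simpa using this
    have := Nat.le_of_dvd (by norm_num) h1
    interval_cases e <;> omega
  have ha0 : 1 ≤ a := by
    rcases Nat.eq_zero_or_pos a with h | h
    · exfalso
      rw [hc, hcpow, h] at hrC
      rcases hr with rfl | rfl | rfl | rfl | rfl <;> norm_num at hrC
    · exact h
  have hanz : r ^ a ∣ 11180400 := hcpow ▸ hcd
  rw [hcpow] at hceM
  rcases hr with rfl | rfl | rfl | rfl | rfl
  · -- r = 2
    exfalso
    have ha : a ≤ 4 := by
      by_contra h
      exact absurd ((pow_dvd_pow 2 (show 5 ≤ a by omega)).trans hanz) (by norm_num)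
    have : c = 2 ∧ e = 1 := by
      interval_cases a <;> rcases he6 with rfl | rfl | rfl | rfl <;> simp at hceM <;> simp [hcpow]
    obtain ⟨-, rfl⟩ := this
    rw [mul_one] at hNe
    have hNC := eq_of_card_ge (Subgroup.centralizer_le_normalizer (S : Set G)) hNe.le
    exact absurd (huniq 7 (stage1_r2 hcard S cS hNC.ge)) (by norm_num)
  · exfalso
    have ha : a ≤ 1 := by
      by_contra h
      exact absurd ((pow_dvd_pow 3 (show 2 ≤ a by omega)).trans hanz) (by norm_num)
    interval_cases a
    rcases he6 with rfl | rfl | rfl | rfl <;> simp at hceM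
  · exfalso
    have ha : a ≤ 2 := by
      by_contra h
      exact absurd ((pow_dvd_pow 5 (show 3 ≤ a by omega)).trans hanz) (by norm_num)
    interval_cases a <;> rcases he6 with rfl | rfl | rfl | rfl <;> simp at hceM
  · obtain ⟨h1, h2, h3⟩ := hr7 rfl
    exact ⟨h1, h2, h3, fun h => absurd (huniq 5 h) (by norm_num),
      fun h => absurd (huniq 2 h) (by norm_num)⟩
  · exfalso
    obtain ⟨h1, h2, h3⟩ := hr11 rfl
    have ha : a ≤ 3 := by
      by_contra h
      exact absurd ((pow_dvd_pow 11 (show 4 ≤ a by omega)).trans hanz) (by norm_num)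
    refine stage1_r11 hcard S cS a e ?_ (by rw [hc, hcpow]) (by rw [hNe, hc, hcpow]) h1 h2 h3
    interval_cases a <;> rcases he6 with rfl | rfl | rfl | rfl <;> simp at hceM ⊢

end stage1b

set_option linter.unusedSectionVars false
open MulAction Pointwise

section stage2
variable {G : Type*} [Group G] [Finite G]

/-- The information about `G` extracted from the degree pattern. -/
structure Hyp (G : Type*) [Group G] : Prop where
  card : Nat.card G = 11 ^ 3 * 159600
  n3 : ¬ primeGraphAdj G 11 3
  n7 : ¬ primeGraphAdj G 11 7
  n19 : ¬ primeGraphAdj G 11 19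
  n195 : ¬ primeGraphAdj G 19 5
  n192 : ¬ primeGraphAdj G 19 2

instance fact2' : Fact (Nat.Prime 2) := ⟨by norm_num⟩
instance fact3' : Fact (Nat.Prime 3) := ⟨by norm_num⟩

lemma mem_cj (g x : G) (H : Subgroup G) : x ∈ MulAut.conj g • H ↔ g⁻¹ * x * g ∈ H := by
  rw [Subgroup.mem_pointwise_smul_iff_inv_smul_mem, ← map_inv, MulAut.smul_def, MulAut.conj_apply, inv_inv]

lemma cj_card (g : G) (H : Subgroup G) : Nat.card (MulAut.conj g • H : Subgroup G) = Nat.card H :=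
  Nat.card_congr (Subgroup.equivSMul (MulAut.conj g) H).symm.toEquiv

lemma cj_eq_iff (g : G) (H : Subgroup G) :
    MulAut.conj g • H = H ↔ g ∈ Subgroup.normalizer (H : Set G) := by
  rw [Subgroup.mem_normalizer_iff'']
  constructor
  · intro h x
    rw [← mem_cj]
    show x ∈ H ↔ _
    rw [h]
  · intro h; ext x
    rw [mem_cj]; exact (h x).symm

lemma cj_sylow {p : ℕ} (g : G) (P : Sylow p G) :
    ((g • P : Sylow p G) : Subgroup G) = MulAut.conj g • (P : Subgroup G) := rfl

lemma mem_zc {H : Subgroup G} {x : G} :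
    x ∈ H ⊓ Subgroup.centralizer (H : Set G) ↔ x ∈ H ∧ ∀ y ∈ H, y * x = x * y := by
  rw [Subgroup.mem_inf, Subgroup.mem_centralizer_iff]; rfl

/-- The center of a subgroup, as a subgroup of the ambient group. -/
def Zc (H : Subgroup G) : Subgroup G := H ⊓ Subgroup.centralizer (H : Set G)

lemma Zc_le (H : Subgroup G) : Zc H ≤ H := inf_le_left

lemma mem_Zc {H : Subgroup G} {x : G} : x ∈ Zc H ↔ x ∈ H ∧ ∀ y ∈ H, y * x = x * y := mem_zc

lemma Zc_cj (g : G) (H : Subgroup G) : Zc (MulAut.conj g • H) = MulAut.conj g • Zc H := by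
  ext x
  rw [mem_cj, mem_Zc, mem_Zc, mem_cj]
  refine and_congr_right fun _ => ⟨fun h y hy => ?_, fun h y hy => ?_⟩
  · have := h (g * y * g⁻¹) (by rw [mem_cj]; simpa [mul_assoc] using hy)
    have h2 : g⁻¹ * (g * y * g⁻¹ * x) * g = g⁻¹ * (x * (g * y * g⁻¹)) * g := by rw [this]
    simpa [mul_assoc] using h2
  · rw [mem_cj] at hy
    have := h _ hy
    have h2 : g * (g⁻¹ * y * g * (g⁻¹ * x * g)) * g⁻¹ = g * (g⁻¹ * x * g * (g⁻¹ * y * g)) * g⁻¹ := by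
      rw [this]
    simpa [mul_assoc] using h2

lemma Zc_normalizer (H : Subgroup G) :
    Subgroup.normalizer (H : Set G) ≤ Subgroup.normalizer (Zc H : Set G) := by
  intro g hg
  rw [← cj_eq_iff] at hg ⊢
  rw [← Zc_cj, hg]

lemma Zc_dvd (H : Subgroup G) {k : ℕ} (hk : k ≠ 0) (cH : Nat.card H = 11 ^ k) : 11 ∣ Nat.card (Zc H) := by
  have h := card_fixed_modEq (q := 11) H H (isPGroup_of_card H cH) (Subgroup.le_normalizer)
  have : Nat.card H ≡ 0 [MOD 11] := by
    rw [cH]; exact (Nat.modEq_zero_iff_dvd).2 (dvd_pow_self _ hk)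
  exact (Nat.modEq_zero_iff_dvd).1 (h.symm.trans this)

lemma sub11 {H : Subgroup G} {k : ℕ} (cH : Nat.card H = 11 ^ k) (K : Subgroup G) (h : K ≤ H) :
    ∃ j ≤ k, Nat.card K = 11 ^ j := by
  have : Nat.card K ∣ 11 ^ k := cH ▸ Subgroup.card_dvd_of_le h
  exact (Nat.dvd_prime_pow (by norm_num)).1 this

lemma comm121 {D : Subgroup G} (cD : Nat.card D = 121) {a b : G} (ha : a ∈ D) (hb : b ∈ D) :
    a * b = b * a := by
  have := IsPGroup.commutative_of_card_eq_prime_sq (p := 11) (G := D) (by rw [cD]; norm_num) ⟨a, ha⟩ ⟨b, hb⟩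
  simpa using congrArg Subtype.val this

lemma le_cent121 {D : Subgroup G} (cD : Nat.card D = 121) : D ≤ Subgroup.centralizer (D : Set G) := by
  intro a ha
  rw [Subgroup.mem_centralizer_iff]
  intro b hb
  exact comm121 cD hb ha

lemma normal121 {D Q : Subgroup G} (cD : Nat.card D = 121) (cQ : Nat.card Q = 1331) (h : D ≤ Q) :
    Q ≤ Subgroup.normalizer (D : Set G) := by
  have hi : (D.subgroupOf Q).index = 11 := by
    have h1 := (D.subgroupOf Q).card_mul_index
    rw [card_subgroupOf h, cD, cQ] at h1
    omega
  have : (D.subgroupOf Q).Normal := by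
    apply Subgroup.normal_of_index_eq_minFac_card
    rw [hi, cQ]; norm_num
  exact (Subgroup.normal_subgroupOf_iff_le_normalizer h).1 this

section hyp

lemma Hyp.sylow (hG : Hyp G) (P : Sylow 11 G) : Nat.card (P : Subgroup G) = 1331 := by
  have := sylow_card (p := 11) hG.card (by norm_num) P
  exact this.trans (by norm_num)

lemma Hyp.adj_fix (hG : Hyp G) {q k : ℕ} [Fact q.Prime] (hq : q ≠ 11) (E : Subgroup G) (cE : Nat.card E = 11 ^ k)
    (h : q ∣ Nat.card (Subgroup.normalizer (E : Set G))) (hk : 11 ^ k % q ≠ 1) :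
    primeGraphAdj G 11 q := by
  obtain ⟨y, hy, hoy⟩ := exists_orderOf h
  have h1 := card_fixed_modEq (q := q) (Subgroup.zpowers y) E
    (isPGroup_of_card (k := 1) _ (by rw [Nat.card_zpowers, hoy, pow_one]))
    (by rwa [Subgroup.zpowers_le])
  obtain ⟨j, -, hj⟩ := sub11 cE _ (inf_le_left : E ⊓ Subgroup.centralizer (Subgroup.zpowers y : Set G) ≤ E)
  have hj0 : j ≠ 0 := by
    rintro rfl
    rw [hj, cE, pow_zero] at h1
    apply hk
    rw [h1]; exact Nat.mod_eq_of_lt (Fact.out : q.Prime).one_lt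
  obtain ⟨x, hx, hox⟩ := exists_orderOf (p := 11) (H := E ⊓ Subgroup.centralizer (Subgroup.zpowers y : Set G))
    (by rw [hj]; exact dvd_pow_self _ hj0)
  refine adj_of_commute (by norm_num) Fact.out hq.symm x y hox hoy ?_
  have := (Subgroup.mem_centralizer_iff.1 hx.2) y (Subgroup.mem_zpowers y)
  exact this.symm

lemma Hyp.cent (hG : Hyp G) (R : Subgroup G) (hR : 11 ∣ Nat.card R) :
    Nat.card (Subgroup.centralizer (R : Set G)) ∣ 11 ^ 3 * 400 := by
  obtain ⟨x, hx, hox⟩ := exists_orderOf hR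
  have key : ∀ q : ℕ, q.Prime → q ≠ 11 → ¬ primeGraphAdj G 11 q →
      ¬ q ∣ Nat.card (Subgroup.centralizer (R : Set G)) := by
    intro q hq hq11 hn hd
    haveI := Fact.mk hq
    obtain ⟨y, hy, hoy⟩ := exists_orderOf hd
    exact hn (adj_of_commute (by norm_num) hq hq11.symm x y hox hoy
      ((Subgroup.mem_centralizer_iff.1 hy) x hx))
  have h0 : Nat.card (Subgroup.centralizer (R : Set G)) ∣ 3 ^ 1 * (7 ^ 1 * (19 ^ 1 * (11 ^ 3 * 400))) := by
    have := Subgroup.card_subgroup_dvd_card (Subgroup.centralizer (R : Set G))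
    rw [hG.card] at this
    convert this using 1 <;> norm_num
  exact strip (by norm_num) (strip (by norm_num) (strip (by norm_num) h0
    (key 3 (by norm_num) (by norm_num) hG.n3)) (key 7 (by norm_num) (by norm_num) hG.n7))
    (key 19 (by norm_num) (by norm_num) hG.n19)

lemma Hyp.Zinj (hG : Hyp G) {Q Q' : Sylow 11 G} (D Z : Subgroup G) (hD : D ≤ Q) (hD' : D ≤ Q')
    (cD : Nat.card D = 121) (cZ : 11 ∣ Nat.card Z) 
    (hZ : (Q : Subgroup G) ≤ Subgroup.centralizer (Z : Set G))
    (hZ' : (Q' : Subgroup G) ≤ Subgroup.centralizer (Z : Set G)) : Q = Q' := by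
  apply Sylow.ext
  refine lemX' (Subgroup.normalizer (D : Set G) ⊓ Subgroup.centralizer (Z : Set G)) D _ _ hD hD' ?_ ?_
    inf_le_left ?_ ?_ ?_
  · exact le_inf (normal121 cD (hG.sylow Q) hD) hZ
  · exact le_inf (normal121 cD (hG.sylow Q') hD') hZ'
  · rw [hG.sylow, cD]
  · rw [hG.sylow, cD]
  · rw [cD]
    refine (Subgroup.card_dvd_of_le inf_le_right).trans ((hG.cent Z cZ).trans ?_)
    norm_num

lemma Hyp.norm_card (hG : Hyp G) (P : Sylow 11 G) : ∃ m, Nat.card (Subgroup.normalizer (P : Set G)) = 1331 * m ∧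
    Nat.card (Sylow 11 G) * m = 159600 ∧ m ∣ 53200 := by
  have h := sylow_count P
  obtain ⟨m, hm⟩ : 1331 ∣ Nat.card (Subgroup.normalizer (P : Set G)) := by
    rw [← hG.sylow P]; exact Subgroup.card_dvd_of_le (Subgroup.le_normalizer)
  have h1 : Nat.card (Sylow 11 G) * m = 159600 := by
    rw [hm, hG.card] at h
    have : 1331 * (Nat.card (Sylow 11 G) * m) = 1331 * 159600 := by rw [← mul_left_comm, h]; norm_num
    omega
  refine ⟨m, hm, h1, ?_⟩
  have h3 : ¬ 3 ∣ m := fun h3 => hG.n3 (hG.adj_fix (k := 3) (by norm_num) (P : Subgroup G)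
    ((hG.sylow P).trans (by norm_num)) (by
      rw [show Nat.card (Subgroup.normalizer ((P : Subgroup G) : Set G)) = 1331 * m from hm]
      exact h3.mul_left _) (by norm_num))
  refine strip (p := 3) (a := 1) (by norm_num) ?_ h3
  exact (Dvd.intro_left _ h1).trans (by norm_num)

end hyp
end stage2

set_option linter.unusedSectionVars false
open MulAction Pointwise

section stage2
variable {G : Type*} [Group G] [Finite G]

lemma exists_121 (R P : Subgroup G) (hR : R ≤ P) (cR : Nat.card R = 11) (cP : Nat.card P = 1331) :
    ∃ K : Subgroup G, R ≤ K ∧ K ≤ P ∧ Nat.card K = 121 := by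
  obtain ⟨K, cK, hK⟩ := Sylow.exists_subgroup_card_pow_succ (p := 11) (G := P) (n := 1)
    (by rw [cP]; norm_num) (H := R.subgroupOf P) (by rw [card_subgroupOf hR, cR]; norm_num)
  refine ⟨K.map P.subtype, ?_, ?_, ?_⟩
  · have := Subgroup.map_mono (f := P.subtype) hK
    rwa [Subgroup.subgroupOf_map_subtype, inf_eq_left.2 hR] at this
  · exact Subgroup.map_subtype_le K
  · rw [Subgroup.card_map_of_injective P.subtype_injective, cK]; norm_num

lemma Hyp.eq_of_inter (hG : Hyp G) (T P : Sylow 11 G) (K : Subgroup G)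
    (hno : ∀ P P' : Sylow 11 G, P ≠ P' → Nat.card ((P : Subgroup G) ⊓ P' : Subgroup G) ∣ 11)
    (hT : K ≤ T) (hP : K ≤ P) (cK : Nat.card K = 121) : T = P := by
  by_contra h
  have h1 := hno T P h
  have h2 := Subgroup.card_dvd_of_le (le_inf hT hP)
  rw [cK] at h2
  exact absurd (h2.trans h1) (by norm_num)

lemma Hyp.exists_inter (hG : Hyp G) :
    ∃ P P' : Sylow 11 G, P ≠ P' ∧ Nat.card ((P : Subgroup G) ⊓ P' : Subgroup G) = 121 := by
  by_contra hcon
  push Not at hcon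
  have hno : ∀ P P' : Sylow 11 G, P ≠ P' → Nat.card ((P : Subgroup G) ⊓ P' : Subgroup G) ∣ 11 := by
    intro P P' hne
    obtain ⟨j, hj, hc⟩ := sub11 (k := 3) ((hG.sylow P).trans (by norm_num)) ((P : Subgroup G) ⊓ P') inf_le_left
    have h2 := hcon P P' hne
    have h3 : j ≠ 3 := by
      rintro rfl
      have e1 := eq_of_card_ge (inf_le_left : (P : Subgroup G) ⊓ P' ≤ P) (by rw [hG.sylow, hc]; norm_num)
      have e2 := eq_of_card_ge (inf_le_right : (P : Subgroup G) ⊓ P' ≤ P') (by rw [hG.sylow, hc]; norm_num)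
      exact hne (Sylow.ext (e1.symm.trans e2))
    rw [hc] at h2 ⊢
    interval_cases j
    · norm_num
    · norm_num
    · norm_num at h2
    · omega
  obtain ⟨P⟩ := (inferInstance : Nonempty (Sylow 11 G))
  obtain ⟨m, hm, hnm, hm5⟩ := hG.norm_card P
  have hmod := sylow_modEq_of_inter P 121 (fun P' hP' => by
    rw [show Nat.card P = 121 * 11 from (hG.sylow P).trans (by norm_num)]
    exact mul_dvd_mul_left _ (hno P P' hP'.symm))
  have hm1 : m = 1 := by
    have key : ∀ m ∈ Nat.divisors 53200, (159600 / m) % 121 = 1 → m = 1 := by decide +kernel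
    refine key m (Nat.mem_divisors.2 ⟨hm5, by norm_num⟩) ?_
    have hmpos : 0 < m := Nat.pos_of_dvd_of_pos hm5 (by norm_num)
    rw [← hnm, Nat.mul_div_cancel _ hmpos]
    exact hmod
  subst hm1
  have : ∃ P' : Sylow 11 G, P' ≠ P ∧ Nat.card ((P : Subgroup G) ⊓ P' : Subgroup G) = 11 := by
    by_contra h
    push Not at h
    have h2 := sylow_modEq_of_inter P 1331 (fun P' hP' => by
      rw [show Nat.card P = 1331 from (hG.sylow P)]
      have h3 := hno P P' hP'.symm
      rcases (Nat.dvd_prime (by norm_num)).1 h3 with h4 | h4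
      · rw [h4]
      · exact absurd h4 (h P' hP'))
    rw [mul_one] at hnm
    rw [hnm] at h2
    exact absurd h2 (by decide)
  obtain ⟨P', hne, cR⟩ := this
  set R := (P : Subgroup G) ⊓ P' with hR
  obtain ⟨K, hRK, hKP, cK⟩ := exists_121 R P inf_le_left cR (hG.sylow P)
  obtain ⟨K', hRK', hKP', cK'⟩ := exists_121 R P' inf_le_right cR (hG.sylow P')
  have hC := hG.cent R (by rw [cR])
  have hKC : K ≤ Subgroup.centralizer (R : Set G) :=
    (le_cent121 cK).trans (Subgroup.centralizer_le hRK)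
  have hKC' : K' ≤ Subgroup.centralizer (R : Set G) :=
    (le_cent121 cK').trans (Subgroup.centralizer_le hRK')
  by_cases h3 : 11 ^ 3 ∣ Nat.card (Subgroup.centralizer (R : Set G))
  · obtain ⟨n, hn⟩ := h3
    have hn4 : n ∣ 400 := by
      rw [hn] at hC; exact Nat.dvd_of_mul_dvd_mul_left (by norm_num) hC
    have hn11 : ¬ 11 ∣ n := fun h => absurd (h.trans hn4) (by norm_num)
    set C := Subgroup.centralizer (R : Set G) with hCdef
    have toG : ∀ S : Sylow 11 C, ∃ T : Sylow 11 G, (T : Subgroup G) = (S : Subgroup C).map C.subtype := by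
      intro S
      refine sylow_of_card hG.card (by norm_num) _ ?_
      rw [Subgroup.card_map_of_injective C.subtype_injective]
      exact sylow_card hn hn11 S
    have h1 : Nat.card (Sylow 11 C) = 1 := by
      obtain ⟨S⟩ := (inferInstance : Nonempty (Sylow 11 C))
      have hmod := sylow_modEq_of_inter S 121 (fun S' hS' => by
        rw [show Nat.card S = 121 * 11 from (sylow_card hn hn11 S).trans (by norm_num)]
        refine mul_dvd_mul_left _ ?_
        obtain ⟨T, hT⟩ := toG S
        obtain ⟨T', hT'⟩ := toG S'
        have hTT : T ≠ T' := by
          intro h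
          rw [← h, hT] at hT'
          exact hS' (Sylow.ext (Subgroup.map_injective C.subtype_injective hT'.symm))
        have := hno T T' hTT
        rwa [hT, hT', ← Subgroup.map_inf _ _ _ C.subtype_injective,
          Subgroup.card_map_of_injective C.subtype_injective] at this)
      have hd := (sylow_num_dvd hn hn11).trans hn4
      rcases num11_400 hn4 (sylow_num_dvd hn hn11) sylow_num_mod with h | h
      · exact h
      · rw [h] at hmod; exact absurd hmod (by decide)
    have hle : ∀ K : Subgroup G, K ≤ C → Nat.card K = 121 → ∀ S : Sylow 11 C, K ≤ (S : Subgroup C).map C.subtype := by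
      intro K hK cK S
      have : IsPGroup 11 (K.subgroupOf C) := isPGroup_of_card (k := 2) _ (by rw [card_subgroupOf hK, cK]; norm_num)
      obtain ⟨S', hS'⟩ := this.exists_le_sylow
      have hSS : S' = S := by
        have := (Nat.card_eq_one_iff_unique.1 h1).1
        exact Subsingleton.elim _ _
      rw [← hSS]
      have := Subgroup.map_mono (f := C.subtype) hS'
      rwa [Subgroup.subgroupOf_map_subtype, inf_eq_left.2 hK] at this
    obtain ⟨S⟩ := (inferInstance : Nonempty (Sylow 11 C))
    obtain ⟨T, hT⟩ := toG S
    have e1 := hG.eq_of_inter T P K hno (hT ▸ hle K hKC cK S) hKP cK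
    have e2 := hG.eq_of_inter T P' K' hno (hT ▸ hle K' hKC' cK' S) hKP' cK'
    exact hne (e2.symm.trans e1)
  · have hKK : K = K' := by
      refine lemX' (Subgroup.centralizer (R : Set G)) R K K' hRK hRK' hKC hKC'
        (Subgroup.centralizer_le_normalizer _) (by rw [cK, cR]) (by rw [cK', cR]) ?_
      rw [cR]
      obtain ⟨a, b, ha, hb, hab⟩ := exists_dvd_and_dvd_of_dvd_mul hC
      obtain ⟨j, hj, rfl⟩ := (Nat.dvd_prime_pow (by norm_num)).1 ha
      have hj3 : j ≠ 3 := by rintro rfl; exact h3 (hab ▸ Dvd.intro _ rfl)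
      rw [hab]
      have : 11 ^ j * b ∣ 11 ^ 2 * 400 := mul_dvd_mul (pow_dvd_pow _ (by omega)) hb
      exact this.trans (by norm_num)
    subst hKK
    exact hne (hG.eq_of_inter P P' K hno hKP hKP' cK).symm

end stage2

set_option linter.unusedSectionVars false
open MulAction Pointwise

section stage2
variable {G : Type*} [Group G] [Finite G]

/-- `D` is the intersection of `P` with another Sylow subgroup, of order `121`. -/
def Good (P : Sylow 11 G) (D : Subgroup G) : Prop :=
  D ≤ P ∧ Nat.card D = 121 ∧ ∃ P' : Sylow 11 G, P' ≠ P ∧ D ≤ P'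

lemma Hyp.inter_eq (hG : Hyp G) {Q Q' : Sylow 11 G} {D : Subgroup G} (hne : Q ≠ Q') (h : D ≤ Q) (h' : D ≤ Q')
    (cD : Nat.card D = 121) : (Q : Subgroup G) ⊓ Q' = D := by
  symm
  apply eq_of_card_ge (le_inf h h')
  obtain ⟨j, hj, hc⟩ := sub11 (k := 3) ((hG.sylow Q).trans (by norm_num)) ((Q : Subgroup G) ⊓ Q') inf_le_left
  have h3 : j ≠ 3 := by
    rintro rfl
    have e1 := eq_of_card_ge (inf_le_left : (Q : Subgroup G) ⊓ Q' ≤ Q) (by rw [hG.sylow, hc]; norm_num)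
    have e2 := eq_of_card_ge (inf_le_right : (Q : Subgroup G) ⊓ Q' ≤ Q') (by rw [hG.sylow, hc]; norm_num)
    exact hne (Sylow.ext (e1.symm.trans e2))
  rw [hc, cD]
  calc 11 ^ j ≤ 11 ^ 2 := Nat.pow_le_pow_right (by norm_num) (by omega)
    _ = 121 := by norm_num

lemma Good.move {P Q : Sylow 11 G} {D : Subgroup G} (h : Good P D) (hQ : D ≤ Q) : Good Q D := by
  obtain ⟨h1, h2, P', h3, h4⟩ := h
  by_cases hPQ : P = Q
  · subst hPQ; exact ⟨h1, h2, P', h3, h4⟩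
  · exact ⟨hQ, h2, P, hPQ, h1⟩

lemma Good.cj {P : Sylow 11 G} {D : Subgroup G} (h : Good P D) (g : G) :
    Good (g • P) (MulAut.conj g • D) := by
  obtain ⟨h1, h2, P', h3, h4⟩ := h
  refine ⟨?_, by rw [cj_card, h2], g • P', ?_, ?_⟩
  · rw [cj_sylow]; exact Subgroup.pointwise_smul_le_pointwise_smul_iff.2 h1
  · intro h; exact h3 (MulAction.injective g h)
  · rw [cj_sylow]; exact Subgroup.pointwise_smul_le_pointwise_smul_iff.2 h4

lemma Hyp.Zc_inj (hG : Hyp G) {Q Q' : Sylow 11 G} {D : Subgroup G} (h : D ≤ Q) (h' : D ≤ Q')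
    (cD : Nat.card D = 121) (hZ : Zc (Q : Subgroup G) = Zc (Q' : Subgroup G)) : Q = Q' := by
  have key : ∀ Q : Sylow 11 G, (Q : Subgroup G) ≤ Subgroup.centralizer (Zc (Q : Subgroup G) : Set G) := by
    intro Q x hx
    rw [Subgroup.mem_centralizer_iff]
    intro y hy
    exact ((mem_Zc.1 hy).2 x hx).symm
  refine hG.Zinj D (Zc (Q : Subgroup G)) h h' cD (Zc_dvd (k := 3) _ (by norm_num) ((hG.sylow Q).trans (by norm_num))) (key Q) ?_
  rw [hZ]; exact key Q'

/-- if an 11-group of order 1331 centralizes a subgroup of order 121 it is abelian. -/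
lemma abelian_of_cent {P D : Subgroup G} (cP : Nat.card P = 1331) (hD : D ≤ P) (cD : Nat.card D = 121)
    (h : P ≤ Subgroup.centralizer (D : Set G)) : ∀ x ∈ P, ∀ y ∈ P, x * y = y * x := by
  have step : ∀ x ∈ P, x ∉ D → P ≤ Subgroup.centralizer {x} := by
    intro x hx hxD
    obtain ⟨j, hj, hc⟩ := sub11 (k := 3) (cP.trans (by norm_num)) (P ⊓ Subgroup.centralizer {x}) inf_le_left
    have hDle : D ≤ P ⊓ Subgroup.centralizer {x} := by
      refine le_inf hD ?_
      intro d hd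
      rw [Subgroup.mem_centralizer_singleton_iff]
      exact (Subgroup.mem_centralizer_iff.1 (h hx) d hd)
    have hlt : D < P ⊓ Subgroup.centralizer {x} := by
      refine lt_of_le_of_ne hDle ?_
      intro he
      apply hxD; rw [he]
      exact ⟨hx, by simp [Subgroup.mem_centralizer_singleton_iff]⟩
    have hcard : ¬ Nat.card (P ⊓ Subgroup.centralizer {x} : Subgroup G) ≤ 121 := by
      intro hle
      exact hlt.ne (eq_of_card_ge hDle (by rw [cD]; exact hle))
    have hj3 : j = 3 := by
      interval_cases j <;> simp_all
    subst hj3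
    have := eq_of_card_ge (inf_le_left : P ⊓ Subgroup.centralizer {x} ≤ P) (by rw [hc, cP]; norm_num)
    rw [← this]; exact inf_le_right
  intro x hx y hy
  by_cases hxD : x ∈ D
  · exact Subgroup.mem_centralizer_iff.1 (h hy) x hxD
  · have := step x hx hxD hy
    rw [Subgroup.mem_centralizer_singleton_iff] at this
    exact this.symm

lemma Hyp.good_cent (hG : Hyp G) {P : Sylow 11 G} {D : Subgroup G} (h : Good P D) :
    (P : Subgroup G) ⊓ Subgroup.centralizer (D : Set G) = D := by
  obtain ⟨h1, h2, P', h3, h4⟩ := h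
  symm
  apply eq_of_card_ge (le_inf h1 (le_cent121 h2))
  obtain ⟨j, hj, hc⟩ := sub11 (k := 3) ((hG.sylow P).trans (by norm_num)) ((P : Subgroup G) ⊓ Subgroup.centralizer (D : Set G)) inf_le_left
  have hj3 : j ≠ 3 := by
    rintro rfl
    have e1 := eq_of_card_ge (inf_le_left : (P : Subgroup G) ⊓ Subgroup.centralizer (D : Set G) ≤ P) (by rw [hG.sylow, hc]; norm_num)
    have hPC : (P : Subgroup G) ≤ Subgroup.centralizer (D : Set G) := by rw [← e1]; exact inf_le_right
    have hab := abelian_of_cent (hG.sylow P) h1 h2 hPC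
    obtain ⟨g, rfl⟩ := MulAction.exists_smul_eq G P P'
    have hab' : ((g • P : Sylow 11 G) : Subgroup G) ≤ Subgroup.centralizer (D : Set G) := by
      intro x hx
      rw [Subgroup.mem_centralizer_iff]
      intro d hd
      have hd' := h4 hd
      rw [cj_sylow, mem_cj] at hd' hx
      have := hab _ hd' _ hx
      have h2 : g * (g⁻¹ * d * g * (g⁻¹ * x * g)) * g⁻¹ = g * (g⁻¹ * x * g * (g⁻¹ * d * g)) * g⁻¹ := by
        rw [this]
      simpa [mul_assoc] using h2
    exact h3 (hG.Zinj D D h4 h1 h2 (by rw [h2]; norm_num) hab' hPC)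
  rw [hc, h2]
  calc 11 ^ j ≤ 11 ^ 2 := Nat.pow_le_pow_right (by norm_num) (by omega)
    _ = 121 := by norm_num

lemma Hyp.good_Zc (hG : Hyp G) {P : Sylow 11 G} {D : Subgroup G} (h : Good P D) :
    Zc (P : Subgroup G) ≤ D ∧ Nat.card (Zc (P : Subgroup G)) = 11 := by
  have hle : Zc (P : Subgroup G) ≤ D := by
    rw [← hG.good_cent h]
    exact le_inf (Zc_le _) (inf_le_right.trans (Subgroup.centralizer_le h.1))
  refine ⟨hle, ?_⟩
  have hd := Zc_dvd (k := 3) (P : Subgroup G) (by norm_num) ((hG.sylow P).trans (by norm_num))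
  obtain ⟨j, hj, hc⟩ := sub11 (k := 2) (h.2.1.trans (by norm_num)) _ hle
  have h2 : j ≠ 2 := by
    rintro rfl
    have e := eq_of_card_ge hle (by rw [hc, h.2.1]; norm_num)
    have hPC : (P : Subgroup G) ≤ (P : Subgroup G) ⊓ Subgroup.centralizer (D : Set G) := by
      refine le_inf le_rfl ?_
      intro x hx
      rw [Subgroup.mem_centralizer_iff]
      intro y hy
      have hy : y ∈ D := hy
      rw [← e] at hy
      exact ((mem_Zc.1 hy).2 x hx).symm
    have := Subgroup.card_le_of_le hPC
    rw [hG.good_cent h, hG.sylow, h.2.1] at this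
    omega
  rw [hc] at hd ⊢
  interval_cases j
  · norm_num at hd
  · norm_num
  · omega

lemma Hyp.card_over (hG : Hyp G) {P : Sylow 11 G} {D : Subgroup G} (h : Good P D) :
    Nat.card {Q : Sylow 11 G | Q ≠ P ∧ D ≤ Q} = 11 ∧ Nat.card {Q : Sylow 11 G | D ≤ Q} = 12 ∧
      ∀ a ∈ D, a ≠ 1 → ∃ Q : Sylow 11 G, D ≤ Q ∧ a ∈ Zc (Q : Subgroup G) := by
  have hcount := count_subgroups (ι := {Q : Sylow 11 G | D ≤ Q}) D ⊥ (fun Q => Zc (Q.1 : Subgroup G)) 11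
    (fun Q => (hG.good_Zc (h.move Q.2)).1) (fun _ => bot_le) (fun Q => (hG.good_Zc (h.move Q.2)).2)
    bot_le (by
      intro i j hij
      rw [prime_inter (p := 11) _ _ (hG.good_Zc (h.move i.2)).2 (hG.good_Zc (h.move j.2)).2]
      intro he
      exact hij (Subtype.ext (hG.Zc_inj i.2 j.2 h.2.1 he)))
  have e1 : Nat.card {Q : Sylow 11 G | D ≤ Q} = Nat.card {Q : Sylow 11 G | Q ≠ P ∧ D ≤ Q} + 1 := by
    have : {Q : Sylow 11 G | D ≤ Q} = insert P {Q : Sylow 11 G | Q ≠ P ∧ D ≤ Q} := by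
      ext Q
      simp only [Set.mem_insert_iff, Set.mem_ofPred_eq]
      constructor
      · intro hQ; by_cases hQP : Q = P
        · exact Or.inl hQP
        · exact Or.inr ⟨hQP, hQ⟩
      · rintro (rfl | hQ)
        · exact h.1
        · exact hQ.2
    rw [this]
    simp only [Nat.card_coe_set_eq]
    rw [Set.ncard_insert_of_notMem (by simp)]
  have hdvd : 11 ∣ Nat.card {Q : Sylow 11 G | Q ≠ P ∧ D ≤ Q} := by
    apply dvd_card_of_orbits (H := (P : Subgroup G)) 11
    · rintro Q ⟨hQ1, hQ2⟩ ⟨g, hg⟩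
      refine ⟨?_, ?_⟩
      · intro he
        apply hQ1
        change g • Q = P at he
        have hgP : g • P = P := Sylow.smul_eq_iff_mem_normalizer.2 (Subgroup.le_normalizer hg)
        exact MulAction.injective g (he.trans hgP.symm)
      · change D ≤ ((g • Q : Sylow 11 G) : Subgroup G)
        rw [cj_sylow, ← (cj_eq_iff g D).2 (normal121 h.2.1 (hG.sylow P) h.1 hg)]
        exact Subgroup.pointwise_smul_le_pointwise_smul_iff.2 hQ2
    · rintro Q ⟨hQ1, hQ2⟩
      have h1 := card_orbit_sylow P Q
      rw [hG.inter_eq hQ1.symm h.1 hQ2 h.2.1, h.2.1, show Nat.card P = 1331 from hG.sylow P] at h1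
      exact ⟨1, by omega⟩
  have hpos : 0 < Nat.card {Q : Sylow 11 G | Q ≠ P ∧ D ≤ Q} := by
    obtain ⟨P', h3, h4⟩ := h.2.2
    haveI : Nonempty {Q : Sylow 11 G | Q ≠ P ∧ D ≤ Q} := ⟨⟨P', h3, h4⟩⟩
    exact Nat.card_pos
  obtain ⟨hc1, hc2⟩ := hcount
  rw [Subgroup.card_bot, h.2.1] at hc1 hc2
  have h11 : Nat.card {Q : Sylow 11 G | Q ≠ P ∧ D ≤ Q} = 11 := by omega
  refine ⟨h11, by omega, ?_⟩
  intro a ha ha1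
  obtain ⟨Q, hQ⟩ := hc2 (by omega) a ha (by rwa [Subgroup.mem_bot])
  exact ⟨Q.1, Q.2, hQ⟩

lemma Hyp.exp11 (hG : Hyp G) {P : Sylow 11 G} {D : Subgroup G} (h : Good P D) {a : G} (ha : a ∈ D) :
    a ^ 11 = 1 := by
  by_cases ha1 : a = 1
  · simp [ha1]
  obtain ⟨Q, hQ, haQ⟩ := (hG.card_over h).2.2 a ha ha1
  have := (hG.good_Zc (h.move hQ)).2
  have h2 := Subgroup.orderOf_dvd_natCard _ haQ
  rw [this] at h2
  exact orderOf_dvd_iff_pow_eq_one.1 h2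

lemma Hyp.conj_over (hG : Hyp G) {Q Q' : Sylow 11 G} {D : Subgroup G} (h : D ≤ Q) (h' : D ≤ Q')
    (cD : Nat.card D = 121) : ∃ g ∈ Subgroup.normalizer (D : Set G), g • Q = Q' := by
  set N := Subgroup.normalizer (D : Set G) with hN
  have h1 := normal121 cD (hG.sylow Q) h
  have h2 := normal121 cD (hG.sylow Q') h'
  obtain ⟨g, hg⟩ := MulAction.exists_smul_eq N (Q.subtype h1) (Q'.subtype h2)
  refine ⟨g, g.2, ?_⟩
  have hg' := hg
  apply Sylow.ext
  have e := congrArg (fun S : Sylow 11 N => (S : Subgroup N).map N.subtype) hg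
  simp only [Sylow.coe_subtype] at e
  rw [Subgroup.subgroupOf_map_subtype (Q' : Subgroup G) N, inf_eq_left.2 h2] at e
  rw [← e]
  ext x
  rw [cj_sylow, mem_cj]
  constructor
  · intro hx
    refine ⟨⟨x, ?_⟩, ?_, rfl⟩
    · have := N.mul_mem (N.mul_mem g.2 (h1 hx)) (N.inv_mem g.2)
      simpa [mul_assoc] using this
    · show _ ∈ ((g • Q.subtype h1 : Sylow 11 N) : Subgroup N)
      rw [cj_sylow, mem_cj]
      exact hx
  · rintro ⟨y, hy, rfl⟩
    have hy' : y ∈ ((g • Q.subtype h1 : Sylow 11 N) : Subgroup N) := hy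
    rw [cj_sylow, mem_cj] at hy'
    exact hy'

end stage2

set_option linter.unusedSectionVars false
open MulAction Pointwise

section stage2
variable {G : Type*} [Group G] [Finite G]

lemma comm_mem_Zc {P : Subgroup G} (cP : Nat.card P = 1331) (cZ : Nat.card (Zc P) = 11) {x y : G}
    (hx : x ∈ P) (hy : y ∈ P) : x * y * x⁻¹ * y⁻¹ ∈ Zc P := by
  have hn : ((Zc P).subgroupOf P).Normal :=
    Subgroup.normal_subgroupOf_of_le_normalizer ((Subgroup.le_normalizer).trans (Zc_normalizer P))
  have hq : Nat.card (P ⧸ (Zc P).subgroupOf P) = 121 := by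
    have h1 := Subgroup.card_eq_card_quotient_mul_card_subgroup ((Zc P).subgroupOf P)
    rw [cP, card_subgroupOf (Zc_le P), cZ] at h1
    omega
  have hc := IsPGroup.commutative_of_card_eq_prime_sq (p := 11) (G := P ⧸ (Zc P).subgroupOf P)
    (by rw [hq]; norm_num) (QuotientGroup.mk ⟨x, hx⟩) (QuotientGroup.mk ⟨y, hy⟩)
  have h2 : (QuotientGroup.mk ((⟨x, hx⟩ : P) * ⟨y, hy⟩ * ⟨x, hx⟩⁻¹ * ⟨y, hy⟩⁻¹) : P ⧸ (Zc P).subgroupOf P) = 1 := by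
    rw [QuotientGroup.mk_mul, QuotientGroup.mk_mul, QuotientGroup.mk_mul, hc]
    simp only [QuotientGroup.mk_inv]
    group
  rw [QuotientGroup.eq_one_iff] at h2
  exact h2

lemma gen121 {D Z H : Subgroup G} (cD : Nat.card D = 121) (cZ : Nat.card Z = 11) (hH : H ≤ D)
    {e1 e2 : G} (h1 : e1 ∈ Z) (h1' : e1 ≠ 1) (h1H : e1 ∈ H) (h2 : e2 ∉ Z) (h2H : e2 ∈ H) : H = D := by
  have hz : Subgroup.zpowers e1 = Z := by
    apply eq_of_card_ge (by rwa [Subgroup.zpowers_le])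
    rw [Nat.card_zpowers, cZ]
    have h3 := Subgroup.orderOf_dvd_natCard _ h1
    rw [cZ] at h3
    rcases (Nat.dvd_prime (by norm_num)).1 h3 with h | h
    · exact absurd (orderOf_eq_one_iff.1 h) h1'
    · exact h.ge
  have hZH : Z ≤ H := by rw [← hz, Subgroup.zpowers_le]; exact h1H
  have hne : Z ≠ H := by rintro rfl; exact h2 h2H
  have hc : ¬ Nat.card H ≤ 11 := fun h => hne (eq_of_card_ge hZH (by rwa [cZ]))
  obtain ⟨j, hj, hcj⟩ := sub11 (k := 2) (cD.trans (by norm_num)) H hH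
  apply eq_of_card_ge hH
  rw [cD, hcj]
  interval_cases j <;> simp_all

lemma Hyp.transv (hG : Hyp G) {P Q : Sylow 11 G} {D : Subgroup G} (h : Good P D) (hQ : D ≤ Q) (hne : Q ≠ P)
    {e u : G} (he : e ∈ Zc (Q : Subgroup G)) (he1 : e ≠ 1) (hu : u ∈ P) (huD : u ∉ D) :
    u * e * u⁻¹ * e⁻¹ ∈ Zc (P : Subgroup G) ∧ u * e * u⁻¹ * e⁻¹ ≠ 1 := by
  obtain ⟨hz1, hz2⟩ := hG.good_Zc h
  obtain ⟨hz1', hz2'⟩ := hG.good_Zc (h.move hQ)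
  have heP : e ∈ (P : Subgroup G) := h.1 (hz1' he)
  refine ⟨comm_mem_Zc (hG.sylow P) hz2 hu heP, ?_⟩
  intro hz
  apply huD
  have hcomm : u * e = e * u := by
    have : u * e * u⁻¹ = e := by rwa [mul_inv_eq_one] at hz
    rwa [mul_inv_eq_iff_eq_mul] at this
  have heZ : e ∉ Zc (P : Subgroup G) := by
    intro hh
    have hb : Zc (P : Subgroup G) ⊓ Zc (Q : Subgroup G) = ⊥ :=
      prime_inter (p := 11) _ _ hz2 hz2' (fun hh => hne (hG.Zc_inj hQ h.1 h.2.1 hh.symm))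
    have : e ∈ Zc (P : Subgroup G) ⊓ Zc (Q : Subgroup G) := ⟨hh, he⟩
    rw [hb] at this
    exact he1 this
  obtain ⟨z, hz, hoz⟩ := exists_orderOf (p := 11) (H := Zc (P : Subgroup G)) (by rw [hz2])
  have hz1n : z ≠ 1 := by rintro rfl; simp at hoz
  have hgen := gen121 (H := D ⊓ Subgroup.centralizer {u}) h.2.1 hz2 inf_le_left hz hz1n
    ⟨hz1 hz, by
      exact Subgroup.mem_centralizer_singleton_iff.2 ((mem_Zc.1 hz).2 u hu).symm⟩ heZ
    ⟨hz1' he, Subgroup.mem_centralizer_singleton_iff.2 hcomm.symm⟩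
  rw [← hG.good_cent h]
  refine ⟨hu, Subgroup.mem_centralizer_iff.2 ?_⟩
  intro d hd
  have hd : d ∈ D := hd
  rw [← hgen] at hd
  exact Subgroup.mem_centralizer_singleton_iff.1 hd.2

lemma conj_pow_lem {l e f : G} (h : l * e * l⁻¹ = f * e) (hf : l * f = f * l) (j : ℕ) :
    l ^ j * e * (l ^ j)⁻¹ = f ^ j * e := by
  have hc : ∀ j, l * f ^ j * l⁻¹ = f ^ j := fun j => by
    have : Commute l (f ^ j) := (show Commute l f from hf).pow_right j
    rw [this.eq]; simp
  induction j with
  | zero => simp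
  | succ j ih =>
    calc l ^ (j+1) * e * (l ^ (j+1))⁻¹ = l * (l ^ j * e * (l ^ j)⁻¹) * l⁻¹ := by rw [pow_succ']; group
      _ = (l * f ^ j * l⁻¹) * (l * e * l⁻¹) := by rw [ih]; group
      _ = _ := by rw [hc, h, pow_succ]; group

lemma Hyp.exists_notMem (hG : Hyp G) {P : Sylow 11 G} {D : Subgroup G} (h : Good P D) : ∃ u ∈ P, u ∉ D := by
  by_contra hcon
  push Not at hcon
  have hle : (P : Subgroup G) ≤ D := hcon
  have := Subgroup.card_le_of_le hle
  rw [hG.sylow, h.2.1] at this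
  omega

lemma Hyp.exists_inv (hG : Hyp G) {P : Sylow 11 G} {D : Subgroup G} (h : Good P D) :
    ∃ c ∈ Subgroup.normalizer (P : Set G), ∀ d ∈ D, c * d * c⁻¹ = d⁻¹ := by
  obtain ⟨Q, hne, hQ⟩ := h.2.2
  have h' := h.move hQ
  obtain ⟨hz1, hz2⟩ := hG.good_Zc h
  obtain ⟨hz1', hz2'⟩ := hG.good_Zc h'
  obtain ⟨e2, he2, hoe2⟩ := exists_orderOf (p := 11) (H := Zc (Q : Subgroup G)) (by rw [hz2'])
  have he2n : e2 ≠ 1 := by rintro rfl; simp at hoe2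
  obtain ⟨u, huP, huD⟩ := hG.exists_notMem h
  obtain ⟨l, hlQ, hlD⟩ := hG.exists_notMem h'
  obtain ⟨he1, he1n⟩ := hG.transv h hQ hne he2 he2n huP huD
  set e1 := u * e2 * u⁻¹ * e2⁻¹ with he1def
  obtain ⟨hf, hfn⟩ := hG.transv h' h.1 hne.symm he1 he1n hlQ hlD
  set f := l * e1 * l⁻¹ * e1⁻¹ with hfdef
  have hfz : Subgroup.zpowers f = Zc (Q : Subgroup G) := by
    apply eq_of_card_ge (by rwa [Subgroup.zpowers_le])
    rw [Nat.card_zpowers, hz2']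
    have h3 := Subgroup.orderOf_dvd_natCard _ hf
    rw [hz2'] at h3
    rcases (Nat.dvd_prime (by norm_num)).1 h3 with h | h
    · exact absurd (orderOf_eq_one_iff.1 h) hfn
    · exact h.ge
  obtain ⟨j, hj⟩ : ∃ j : ℕ, f ^ j = e2⁻¹ := by
    have : e2⁻¹ ∈ Subgroup.zpowers f := by rw [hfz]; exact inv_mem he2
    rw [← mem_powers_iff_mem_zpowers] at this
    exact this
  have hl : l ^ j * e1 * (l ^ j)⁻¹ = e2⁻¹ * e1 := by
    rw [← hj]
    apply conj_pow_lem
    · rw [hfdef]; group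
    · exact (mem_Zc.1 hf).2 l hlQ
  set v := l ^ j with hv
  have hvQ : v ∈ (Q : Subgroup G) := pow_mem hlQ j
  have a1 : u * e2 * u⁻¹ = e1 * e2 := by rw [he1def]; group
  have a2 : u * e1 * u⁻¹ = e1 := by
    rw [(mem_Zc.1 he1).2 u huP]; group
  have a3 : v * e2 * v⁻¹ = e2 := by
    rw [(mem_Zc.1 he2).2 v hvQ]; group
  have e12 : e1 * e2 = e2 * e1 := comm121 h.2.1 (hz1 he1) (hz1' he2)
  set w := u * v * u with hw
  have w2 : w * e2 * w⁻¹ = e1 := by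
    calc w * e2 * w⁻¹ = u * (v * (u * e2 * u⁻¹) * v⁻¹) * u⁻¹ := by rw [hw]; group
      _ = u * ((v * e1 * v⁻¹) * (v * e2 * v⁻¹)) * u⁻¹ := by rw [a1]; group
      _ = u * e1 * u⁻¹ := by rw [hl, a3, mul_assoc e2⁻¹, e12]; group
      _ = e1 := a2
  have w1 : w * e1 * w⁻¹ = e2⁻¹ := by
    calc w * e1 * w⁻¹ = u * (v * (u * e1 * u⁻¹) * v⁻¹) * u⁻¹ := by rw [hw]; group
      _ = u * (e2⁻¹ * e1) * u⁻¹ := by rw [a2, hl]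
      _ = (u * e2 * u⁻¹)⁻¹ * (u * e1 * u⁻¹) := by group
      _ = e2⁻¹ := by rw [a1, a2, mul_inv_rev]; group
  set c := w * w with hc
  have c2 : c * e2 * c⁻¹ = e2⁻¹ := by
    calc c * e2 * c⁻¹ = w * (w * e2 * w⁻¹) * w⁻¹ := by rw [hc]; group
      _ = e2⁻¹ := by rw [w2, w1]
  have c1 : c * e1 * c⁻¹ = e1⁻¹ := by
    calc c * e1 * c⁻¹ = w * (w * e1 * w⁻¹) * w⁻¹ := by rw [hc]; group
      _ = (w * e2 * w⁻¹)⁻¹ := by rw [w1]; group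
      _ = e1⁻¹ := by rw [w2]
  let H : Subgroup G :=
    { carrier := {d | d ∈ D ∧ c * d * c⁻¹ = d⁻¹}
      mul_mem' := by
        rintro a b ⟨ha, ha'⟩ ⟨hb, hb'⟩
        refine ⟨mul_mem ha hb, ?_⟩
        calc c * (a * b) * c⁻¹ = (c * a * c⁻¹) * (c * b * c⁻¹) := by group
          _ = (b * a)⁻¹ := by rw [ha', hb']; group
          _ = (a * b)⁻¹ := by rw [comm121 h.2.1 ha hb]
      one_mem' := ⟨one_mem D, by group⟩
      inv_mem' := by
        rintro a ⟨ha, ha'⟩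
        refine ⟨inv_mem ha, ?_⟩
        calc c * a⁻¹ * c⁻¹ = (c * a * c⁻¹)⁻¹ := by group
          _ = _ := by rw [ha'] }
  have heZ : e2 ∉ Zc (P : Subgroup G) := by
    intro hh
    have hb : Zc (P : Subgroup G) ⊓ Zc (Q : Subgroup G) = ⊥ :=
      prime_inter (p := 11) _ _ hz2 hz2' (fun hh => hne (hG.Zc_inj hQ h.1 h.2.1 hh.symm))
    have : e2 ∈ Zc (P : Subgroup G) ⊓ Zc (Q : Subgroup G) := ⟨hh, he2⟩
    rw [hb] at this
    exact he2n this
  have hHD : H = D := gen121 (H := H) h.2.1 hz2 (fun x hx => hx.1) he1 he1n ⟨hz1 he1, c1⟩ heZ ⟨hz1' he2, c2⟩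
  have hinv : ∀ d ∈ D, c * d * c⁻¹ = d⁻¹ := by
    intro d hd
    rw [← hHD] at hd
    exact hd.2
  have hcj : ∀ E : Subgroup G, E ≤ D → MulAut.conj c • E = E := by
    intro E hE
    apply eq_of_card_ge _ (by rw [cj_card])
    rintro _ ⟨x, hx, rfl⟩
    show c * x * c⁻¹ ∈ E
    rw [hinv x (hE hx)]
    exact inv_mem hx
  refine ⟨c, ?_, hinv⟩
  have hcP : c • P = P := by
    refine hG.Zc_inj (D := D) ?_ h.1 h.2.1 ?_
    · rw [cj_sylow, ← hcj D le_rfl]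
      exact Subgroup.pointwise_smul_le_pointwise_smul_iff.2 h.1
    · rw [cj_sylow, Zc_cj, hcj _ hz1]
  exact Sylow.smul_eq_iff_mem_normalizer.1 hcP

lemma inv_even {c d : G} {n : ℕ} (hd : c * d * c⁻¹ = d⁻¹) (hn : Odd n) : c ^ n * d * (c ^ n)⁻¹ = d⁻¹ := by
  have key : ∀ k : ℕ, c ^ (2 * k) * d * (c ^ (2 * k))⁻¹ = d := by
    intro k
    induction k with
    | zero => simp
    | succ k ih =>
      calc c ^ (2 * (k+1)) * d * (c ^ (2 * (k+1)))⁻¹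
          = c * (c * (c ^ (2 * k) * d * (c ^ (2 * k))⁻¹) * c⁻¹) * c⁻¹ := by
            rw [show 2 * (k+1) = 2 * k + 1 + 1 by ring, pow_succ', pow_succ']; group
        _ = c * d⁻¹ * c⁻¹ := by rw [ih, hd]
        _ = (c * d * c⁻¹)⁻¹ := by group
        _ = d := by rw [hd, inv_inv]
  obtain ⟨k, rfl⟩ := hn
  calc c ^ (2 * k + 1) * d * (c ^ (2 * k + 1))⁻¹ = c * (c ^ (2 * k) * d * (c ^ (2 * k))⁻¹) * c⁻¹ := by
        rw [pow_succ']; group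
    _ = _ := by rw [key, hd]

lemma Hyp.m100 (hG : Hyp G) {P : Sylow 11 G} {D : Subgroup G} (h : Good P D) :
    Nat.card (Subgroup.normalizer (P : Set G)) = 1331 * 100 ∧ Nat.card (Sylow 11 G) = 1596 := by
  obtain ⟨m, hm, hnm, hm5⟩ := hG.norm_card P
  obtain ⟨hz1, hz2⟩ := hG.good_Zc h
  have hle := Zc_normalizer (P : Subgroup G)
  have hle' : m ∣ Nat.card (Subgroup.normalizer (Zc (P : Subgroup G) : Set G)) := by
    refine (Dvd.intro_left _ hm.symm).trans (Subgroup.card_dvd_of_le hle)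
  have h7 : ¬ 7 ∣ m := fun h7 => hG.n7 (hG.adj_fix (k := 1) (by norm_num) (Zc (P : Subgroup G))
    (by rw [hz2]; norm_num) (h7.trans hle') (by norm_num))
  have h19 : ¬ 19 ∣ m := fun h7 => hG.n19 (hG.adj_fix (k := 1) (by norm_num) (Zc (P : Subgroup G))
    (by rw [hz2]; norm_num) (h7.trans hle') (by norm_num))
  have hm4 : m ∣ 400 := by
    refine strip (p := 19) (a := 1) (by norm_num) (strip (p := 7) (a := 1) (by norm_num) ?_ h7) h19
    exact hm5.trans (by norm_num)
  have hmod : m % 11 = 1 := by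
    have h1 := sylow_num_mod (p := 11) (G := G)
    have h2 : (Nat.card (Sylow 11 G) * m) % 11 = 1 := by rw [hnm]
    rw [Nat.mul_mod, h1, one_mul, Nat.mod_mod] at h2
    exact h2
  have h100 : m = 100 := by
    rcases num11_400 dvd_rfl hm4 hmod with h1 | h1
    · exfalso
      subst h1
      obtain ⟨c, hc, hinv⟩ := hG.exists_inv h
      obtain ⟨e, he, hoe⟩ := exists_orderOf (p := 11) (H := D) (by rw [h.2.1]; norm_num)
      have hord := Subgroup.orderOf_dvd_natCard _ hc
      rw [hm] at hord
      have hpow : c ^ 1331 = 1 := orderOf_dvd_iff_pow_eq_one.1 (by simpa using hord)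
      have := inv_even (n := 1331) (hinv e he) (by decide)
      rw [hpow] at this
      have h2 : e ^ 2 = 1 := by
        have h3 : e = e⁻¹ := by simpa using this
        rw [pow_two]; nth_rw 1 [h3]; simp
      have := orderOf_dvd_iff_pow_eq_one.2 h2
      rw [hoe] at this
      norm_num at this
    · exact h1
  subst h100
  exact ⟨hm, by omega⟩

end stage2

set_option linter.unusedSectionVars false
open MulAction Pointwise

section stage2
variable {G : Type*} [Group G] [Finite G]

lemma Hyp.good_inter (hG : Hyp G) {P : Sylow 11 G} {D E : Subgroup G} (h : Good P D) (h' : Good P E)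
    (hne : D ≠ E) : D ⊓ E = Zc (P : Subgroup G) := by
  obtain ⟨hz1, hz2⟩ := hG.good_Zc h
  obtain ⟨hz1', -⟩ := hG.good_Zc h'
  symm
  apply eq_of_card_ge (le_inf hz1 hz1')
  obtain ⟨j, hj, hc⟩ := sub11 (k := 2) (h.2.1.trans (by norm_num)) (D ⊓ E) inf_le_left
  have h2 : j ≠ 2 := by
    rintro rfl
    have e1 := eq_of_card_ge (inf_le_left : D ⊓ E ≤ D) (by rw [h.2.1, hc]; norm_num)
    have e2 := eq_of_card_ge (inf_le_right : D ⊓ E ≤ E) (by rw [h'.2.1, hc]; norm_num)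
    exact hne (e1.symm.trans e2)
  rw [hc, hz2]
  calc 11 ^ j ≤ 11 ^ 1 := Nat.pow_le_pow_right (by norm_num) (by omega)
    _ = 11 := by norm_num

lemma Hyp.two_good (hG : Hyp G) {P : Sylow 11 G} {D : Subgroup G} (h : Good P D) :
    ∃ D1 D2 : Subgroup G, D1 ≠ D2 ∧ ∀ E, Good P E ↔ E = D1 ∨ E = D2 := by
  have hn := (hG.m100 h).2
  obtain ⟨hz1, hz2⟩ := hG.good_Zc h
  set F : Set (Subgroup G) := {E | Good P E} with hF
  have hle : Nat.card F * (121 - 11) + 11 ≤ 1331 := by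
    have := (count_subgroups (ι := F) (P : Subgroup G) (Zc (P : Subgroup G)) (fun E => E.1) 121
      (fun E => E.2.1) (fun E => (hG.good_Zc E.2).1) (fun E => E.2.2.1) (Zc_le _) (by
        intro i j hij
        exact (hG.good_inter i.2 j.2 (fun h => hij (Subtype.ext h))).le)).1
    rw [hz2, hG.sylow] at this
    exact this
  set S1 := {P' : Sylow 11 G | P' ≠ P ∧
      121 * Nat.card ((P : Subgroup G) ⊓ P' : Subgroup G) ∣ Nat.card P} with hS1
  have hd : 121 ∣ Nat.card S1 := sylow_inter_dvd P 121
  set S2 := {P' : Sylow 11 G | P' ≠ P ∧ ∃ E, Good P E ∧ E ≤ P'} with hS2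
  have c2 : Nat.card S2 = Nat.card F * 11 := by
    have e : Nat.card (Σ E : F, {Q : Sylow 11 G | Q ≠ P ∧ E.1 ≤ Q}) = Nat.card S2 := by
      refine Nat.card_eq_of_bijective (fun x => ⟨x.2.1, x.2.2.1, x.1.1, x.1.2, x.2.2.2⟩) ⟨?_, ?_⟩
      · rintro ⟨⟨E, hE⟩, ⟨Q, hQ⟩⟩ ⟨⟨E', hE'⟩, ⟨Q', hQ'⟩⟩ hh
        obtain rfl : Q = Q' := congrArg Subtype.val hh
        obtain rfl : E = E' := by
          rw [← hG.inter_eq hQ.1.symm hE.1 hQ.2 hE.2.1, ← hG.inter_eq hQ'.1.symm hE'.1 hQ'.2 hE'.2.1]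
        rfl
      · rintro ⟨Q, hQ1, E, hE, hEQ⟩
        exact ⟨⟨⟨E, hE⟩, ⟨Q, hQ1, hEQ⟩⟩, rfl⟩
    haveI := Fintype.ofFinite F
    rw [← e, Nat.card_sigma, Finset.sum_congr rfl (fun E _ => (hG.card_over E.2).1)]
    simp [Nat.card_eq_fintype_card]
  have hsum : Nat.card S1 + Nat.card S2 + 1 = 1596 := by
    rw [← hn]
    simp only [Nat.card_coe_set_eq]
    have hdis : Disjoint S1 S2 := by
      rw [Set.disjoint_left]
      rintro Q ⟨-, h1⟩ ⟨h2, E, hE, hEQ⟩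
      rw [hG.inter_eq h2.symm hE.1 hEQ hE.2.1, hE.2.1, show Nat.card P = 1331 from hG.sylow P] at h1
      norm_num at h1
    have hu : insert P (S1 ∪ S2) = Set.univ := by
      ext Q
      simp only [Set.mem_insert_iff, Set.mem_union, Set.mem_univ, iff_true]
      by_cases hQP : Q = P
      · exact Or.inl hQP
      right
      obtain ⟨j, hj, hc⟩ := sub11 (k := 3) ((hG.sylow P).trans (by norm_num)) ((P : Subgroup G) ⊓ Q) inf_le_left
      have h3 : j ≠ 3 := by
        rintro rfl
        have e1 := eq_of_card_ge (inf_le_left : (P : Subgroup G) ⊓ Q ≤ P) (by rw [hG.sylow, hc]; norm_num)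
        have e2 := eq_of_card_ge (inf_le_right : (P : Subgroup G) ⊓ Q ≤ Q) (by rw [hG.sylow, hc]; norm_num)
        exact hQP (Sylow.ext (e2.symm.trans e1))
      by_cases h2 : j = 2
      · right
        subst h2
        exact ⟨hQP, (P : Subgroup G) ⊓ Q, ⟨inf_le_left, by rw [hc]; norm_num, Q, hQP, inf_le_right⟩, inf_le_right⟩
      · left
        refine ⟨hQP, ?_⟩
        rw [hc, show Nat.card P = 121 * 11 ^ 1 from (hG.sylow P).trans (by norm_num)]
        exact mul_dvd_mul_left _ (pow_dvd_pow _ (by omega))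
    rw [← Set.ncard_union_eq hdis, ← Set.ncard_insert_of_notMem (a := P), hu, Set.ncard_univ]
    rintro (hh | hh) <;> exact hh.1 rfl
  have hF2 : Nat.card F = 2 := by
    clear * - hle hd c2 hsum
    omega
  rw [Nat.card_coe_set_eq, Set.ncard_eq_two] at hF2
  obtain ⟨D1, D2, hne, he⟩ := hF2
  refine ⟨D1, D2, hne, fun E => ?_⟩
  have : E ∈ F ↔ E ∈ ({D1, D2} : Set (Subgroup G)) := by rw [he]
  rw [Set.mem_insert_iff, Set.mem_singleton_iff] at this
  exact this

lemma Hyp.inv_triv (hG : Hyp G) {P : Sylow 11 G} {D : Subgroup G} (h : Good P D) {c x : G}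
    (hc : c ∈ Subgroup.normalizer (P : Set G)) (hinv : ∀ d ∈ D, c * d * c⁻¹ = d⁻¹) (hx : x ∈ P) :
    c * x * c⁻¹ * x⁻¹ ∈ D := by
  rw [← hG.good_cent h]
  have hxc : c * x * c⁻¹ ∈ (P : Subgroup G) := (Subgroup.mem_normalizer_iff.1 hc x).1 hx
  refine ⟨(P : Subgroup G).mul_mem hxc ((P : Subgroup G).inv_mem hx), Subgroup.mem_centralizer_iff.2 ?_⟩
  intro d hd
  have hd : d ∈ D := hd
  have hxN := normal121 h.2.1 (hG.sylow P) h.1 hx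
  -- d1 = x⁻¹ d x
  have hd1 : x⁻¹ * d * x ∈ D := (Subgroup.mem_normalizer_iff''.1 hxN d).1 hd
  have h1 := hinv _ hd1
  have h2 := hinv _ hd
  have h3 : c⁻¹ * d * c = d⁻¹ := by
    have : c⁻¹ * (c * d * c⁻¹) * c = c⁻¹ * d⁻¹ * c := by rw [h2]
    have h4 : d = c⁻¹ * d⁻¹ * c := by rw [← this]; group
    calc c⁻¹ * d * c = (c⁻¹ * d⁻¹ * c)⁻¹ := by group
      _ = d⁻¹ := by rw [← h4]
  have h5 : (c * x * c⁻¹ * x⁻¹) * d * (c * x * c⁻¹ * x⁻¹)⁻¹ = d := by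
    have h6 : c⁻¹ * (x⁻¹ * d * x) * c = (x⁻¹ * d * x)⁻¹ := by
      have : c⁻¹ * (c * (x⁻¹ * d * x) * c⁻¹) * c = c⁻¹ * (x⁻¹ * d * x)⁻¹ * c := by rw [h1]
      have h4 : (x⁻¹ * d * x) = c⁻¹ * (x⁻¹ * d * x)⁻¹ * c := by rw [← this]; group
      calc c⁻¹ * (x⁻¹ * d * x) * c = (c⁻¹ * (x⁻¹ * d * x)⁻¹ * c)⁻¹ := by group
        _ = _ := by rw [← h4]
    calc (c * x * c⁻¹ * x⁻¹) * d * (c * x * c⁻¹ * x⁻¹)⁻¹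
        = c * x * (c⁻¹ * (x⁻¹ * d * x) * c) * x⁻¹ * c⁻¹ := by group
      _ = (c * d * c⁻¹)⁻¹ := by rw [h6]; group
      _ = d := by rw [h2, inv_inv]
  calc d * (c * x * c⁻¹ * x⁻¹) = ((c * x * c⁻¹ * x⁻¹) * d * (c * x * c⁻¹ * x⁻¹)⁻¹) * (c * x * c⁻¹ * x⁻¹) := by rw [h5]
    _ = _ := by group

lemma Hyp.no_swap (hG : Hyp G) {P : Sylow 11 G} {D1 D2 : Subgroup G} (hne : D1 ≠ D2)
    (hgood : ∀ E, Good P E ↔ E = D1 ∨ E = D2) {w : G} (hw : w ∈ Subgroup.normalizer (P : Set G))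
    (hsw : MulAut.conj w • D1 = D2) : False := by
  have h1 : Good P D1 := (hgood _).2 (Or.inl rfl)
  have h2 : Good P D2 := (hgood _).2 (Or.inr rfl)
  have perm : ∀ g ∈ Subgroup.normalizer (P : Set G), ∀ E, Good P E → Good P (MulAut.conj g • E) := by
    intro g hg E hE
    have := hE.cj g
    rwa [Sylow.smul_eq_iff_mem_normalizer.2 hg] at this
  set N := Subgroup.normalizer (P : Set G) with hN
  set K := N ⊓ Subgroup.normalizer (D1 : Set G) with hK
  have hw2 : MulAut.conj w • D2 = D1 := by
    rcases (hgood _).1 (perm w hw D2 h2) with h | h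
    · exact h
    · exfalso; apply hne
      rw [← hsw] at h
      have := (MulAction.injective (MulAut.conj w)) h
      rw [hsw] at this; exact this.symm
  have cK : Nat.card K = 2 ^ 1 * 33275 := by
    have hidx : (K.subgroupOf N).index = 2 := by
      rw [Subgroup.index_eq_two_iff]
      refine ⟨⟨w, hw⟩, ?_⟩
      rintro ⟨b, hb⟩
      simp only [Subgroup.mem_subgroupOf, hK, Subgroup.mem_inf, Subgroup.coe_mul, ← cj_eq_iff]
      rw [map_mul, mul_smul, hsw]
      rcases (hgood _).1 (perm b hb D1 h1) with h | h
      · right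
        refine ⟨⟨hb, h⟩, ?_⟩
        rintro ⟨-, h'⟩
        exact hne ((MulAction.injective (MulAut.conj b)) (h.trans h'.symm))
      · left
        refine ⟨⟨mul_mem hb hw, ?_⟩, ?_⟩
        · rcases (hgood _).1 (perm b hb D2 h2) with h' | h'
          · exact h'
          · exact absurd ((MulAction.injective (MulAut.conj b)) (h.trans h'.symm)) hne
        · rintro ⟨-, h'⟩
          exact hne (h'.symm.trans h)
    have := (K.subgroupOf N).card_mul_index
    rw [hidx, card_subgroupOf (show K ≤ N from inf_le_left), (hG.m100 h1).1] at this
    omega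
  obtain ⟨c, hcN, hinv⟩ := hG.exists_inv h1
  have inv_norm : ∀ (c : G) (D : Subgroup G), (∀ d ∈ D, c * d * c⁻¹ = d⁻¹) → MulAut.conj c • D = D := by
    intro c D hinv
    apply eq_of_card_ge _ (by rw [cj_card])
    rintro _ ⟨x, hx, rfl⟩
    show c * x * c⁻¹ ∈ D
    rw [hinv x hx]
    exact inv_mem hx
  set c0 := c ^ 33275 with hc0
  have hinv0 : ∀ d ∈ D1, c0 * d * c0⁻¹ = d⁻¹ := fun d hd => inv_even (hinv d hd) (by decide)
  have hcK : c ∈ K := ⟨hcN, (cj_eq_iff _ _).1 (inv_norm c D1 hinv)⟩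
  have hc0K : c0 ∈ K := pow_mem hcK _
  have hc0sq : c0 ^ 2 = 1 := by
    rw [hc0, ← pow_mul]
    have := Subgroup.orderOf_dvd_natCard _ hcK
    rw [cK] at this
    exact orderOf_dvd_iff_pow_eq_one.1 (by convert this using 1; norm_num)
  have hnot1 : ∀ (x : G) (D : Subgroup G), Nat.card D = 121 → (∀ d ∈ D, x * d * x⁻¹ = d⁻¹) → x ≠ 1 := by
    rintro x D cD hx rfl
    obtain ⟨e, he, hoe⟩ := exists_orderOf (p := 11) (H := D) (by rw [cD]; norm_num)
    have h3 : e = e⁻¹ := by simpa using hx e he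
    have h4 : e ^ 2 = 1 := by rw [pow_two]; nth_rw 1 [h3]; simp
    have := orderOf_dvd_iff_pow_eq_one.2 h4
    rw [hoe] at this
    norm_num at this
  set c' := w * c0 * w⁻¹ with hc'
  have hinv' : ∀ d ∈ D2, c' * d * c'⁻¹ = d⁻¹ := by
    intro d hd
    rw [← hsw, mem_cj] at hd
    have := hinv0 _ hd
    calc c' * d * c'⁻¹ = w * (c0 * (w⁻¹ * d * w) * c0⁻¹) * w⁻¹ := by rw [hc']; group
      _ = d⁻¹ := by rw [this]; group
  have hc'N : c' ∈ N := mul_mem (mul_mem hw hc0K.1) (inv_mem hw)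
  have hc'K : c' ∈ K := by
    refine ⟨hc'N, (cj_eq_iff _ _).1 ?_⟩
    rcases (hgood _).1 (perm c' hc'N D1 h1) with h | h
    · exact h
    · exact absurd ((MulAction.injective (MulAut.conj c')) (h.trans (inv_norm c' D2 hinv').symm)) hne
  have hc'sq : c' ^ 2 = 1 := by
    rw [hc', conj_pow, hc0sq]; group
  have hord : ∀ x : G, x ≠ 1 → x ^ 2 = 1 → orderOf x = 2 := fun x h1 h2 => orderOf_eq_prime h2 h1
  have o0 := hord c0 (hnot1 c0 D1 h1.2.1 hinv0) hc0sq
  have o1 := hord c' (hnot1 c' D2 h2.2.1 hinv') hc'sq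
  obtain ⟨S, hS⟩ := sylow_of_card (p := 2) cK (by norm_num) (Subgroup.zpowers (⟨c0, hc0K⟩ : K))
    (by rw [Nat.card_zpowers, pow_one, ← o0]; exact (Subgroup.orderOf_coe _).symm)
  obtain ⟨S', hS'⟩ := sylow_of_card (p := 2) cK (by norm_num) (Subgroup.zpowers (⟨c', hc'K⟩ : K))
    (by rw [Nat.card_zpowers, pow_one, ← o1]; exact (Subgroup.orderOf_coe _).symm)
  obtain ⟨k, hk⟩ := MulAction.exists_smul_eq K S S'
  have hmem : k * ⟨c0, hc0K⟩ * k⁻¹ ∈ Subgroup.zpowers (⟨c', hc'K⟩ : K) := by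
    rw [← hS', ← hk, cj_sylow, mem_cj, hS]
    convert Subgroup.mem_zpowers (⟨c0, hc0K⟩ : K) using 1
    group
  obtain ⟨n, hn⟩ := hmem
  have hn' : c' ^ n = k.1 * c0 * k.1⁻¹ := by
    simpa using congrArg Subtype.val hn
  have hconj : k.1 * c0 * k.1⁻¹ = c' := by
    rcases Int.even_or_odd' n with ⟨t, rfl | rfl⟩
    · exfalso
      rw [zpow_mul] at hn'
      rw [show c' ^ (2 : ℤ) = 1 by exact_mod_cast hc'sq, one_zpow] at hn'
      apply hnot1 c0 D1 h1.2.1 hinv0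
      have : c0 = k.1⁻¹ * (k.1 * c0 * k.1⁻¹) * k.1 := by group
      rw [this, ← hn']; group
    · rw [← hn', zpow_add, zpow_mul, show c' ^ (2 : ℤ) = 1 by exact_mod_cast hc'sq, one_zpow]
      simp
  have hle : D1 ≤ D2 := by
    intro d hd
    have hkN := k.2.2
    have hd1 : k.1⁻¹ * d * k.1 ∈ D1 := (Subgroup.mem_normalizer_iff''.1 hkN d).1 hd
    have hcd : c' * d * c'⁻¹ = d⁻¹ := by
      calc c' * d * c'⁻¹ = k.1 * (c0 * (k.1⁻¹ * d * k.1) * c0⁻¹) * k.1⁻¹ := by rw [← hconj]; group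
        _ = d⁻¹ := by rw [hinv0 _ hd1]; group
    have h3 := hG.inv_triv h2 hc'N hinv' (h1.1 hd)
    rw [hcd] at h3
    have h11 := hG.exp11 h1 hd
    have : d = (d⁻¹ * d⁻¹) ^ 5 * d ^ 11 := by group
    rw [this, h11, mul_one]
    exact pow_mem h3 5
  exact hne (eq_of_card_ge hle (by rw [h1.2.1, h2.2.1]))

/-- The flag geometry extracted from the Sylow 11-subgroups. -/
structure Geo (G : Type*) [Group G] where
  pt : Sylow 11 G → Subgroup G
  ln : Sylow 11 G → Subgroup G
  pt_smul : ∀ (g : G) (Q : Sylow 11 G), pt (g • Q) = MulAut.conj g • pt Q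
  ln_smul : ∀ (g : G) (Q : Sylow 11 G), ln (g • Q) = MulAut.conj g • ln Q
  good_pt : ∀ Q, Good Q (pt Q)
  good_ln : ∀ Q, Good Q (ln Q)
  ne : ∀ Q, pt Q ≠ ln Q

def Geo.dual (Γ : Geo G) : Geo G := ⟨Γ.ln, Γ.pt, Γ.ln_smul, Γ.pt_smul, Γ.good_ln, Γ.good_pt, fun Q => (Γ.ne Q).symm⟩

lemma Hyp.exists_geo (hG : Hyp G) : Nonempty (Geo G) := by
  classical
  obtain ⟨P, P', hne, hP⟩ := hG.exists_inter
  have h0 : Good P ((P : Subgroup G) ⊓ P') := ⟨inf_le_left, hP, P', hne.symm, inf_le_right⟩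
  obtain ⟨D1, D2, hD, hgood⟩ := hG.two_good h0
  have perm : ∀ g ∈ Subgroup.normalizer (P : Set G), ∀ E, Good P E → Good P (MulAut.conj g • E) := by
    intro g hg E hE
    have := hE.cj g
    rwa [Sylow.smul_eq_iff_mem_normalizer.2 hg] at this
  have fix : ∀ E, (E = D1 ∨ E = D2) → ∀ g ∈ Subgroup.normalizer (P : Set G), MulAut.conj g • E = E := by
    intro E hE g hg
    have hE' := (hgood _).1 (perm g hg E ((hgood _).2 hE))
    rcases hE with rfl | rfl <;> rcases hE' with h | h
    · exact h
    · exact (hG.no_swap hD hgood hg h).elim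
    · exact (hG.no_swap hD.symm (fun E => (hgood E).trans or_comm) hg h).elim
    · exact h
  choose g hg using fun Q => MulAction.exists_smul_eq G P Q
  have wd : ∀ E, (E = D1 ∨ E = D2) → ∀ (x : G) (Q : Sylow 11 G),
      MulAut.conj (g (x • Q)) • E = MulAut.conj x • (MulAut.conj (g Q) • E) := by
    intro E hE x Q
    have h1 : (x * g Q)⁻¹ * g (x • Q) ∈ Subgroup.normalizer (P : Set G) := by
      rw [← Sylow.smul_eq_iff_mem_normalizer, mul_smul, hg, inv_smul_eq_iff, mul_smul, hg]
    have h2 := fix E hE _ h1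
    rw [map_mul, mul_smul, map_inv, inv_smul_eq_iff, map_mul, mul_smul] at h2
    exact h2
  have gd : ∀ E, (E = D1 ∨ E = D2) → ∀ Q, Good Q (MulAut.conj (g Q) • E) := by
    intro E hE Q
    have := ((hgood E).2 hE).cj (g Q)
    rwa [hg] at this
  exact ⟨{ pt := fun Q => MulAut.conj (g Q) • D1
           ln := fun Q => MulAut.conj (g Q) • D2
           pt_smul := wd D1 (Or.inl rfl)
           ln_smul := wd D2 (Or.inr rfl)
           good_pt := gd D1 (Or.inl rfl)
           good_ln := gd D2 (Or.inr rfl)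
           ne := fun Q h => hD ((MulAction.injective (MulAut.conj (g Q))) h) }⟩

end stage2

set_option linter.unusedSectionVars false
open MulAction Pointwise

section stage3
variable {G : Type*} [Group G] [Finite G]

lemma Hyp.flag_ext (hG : Hyp G) (Γ : Geo G) {Q Q' : Sylow 11 G} (h1 : Γ.pt Q = Γ.pt Q') (h2 : Γ.ln Q = Γ.ln Q') :
    Q = Q' := by
  have hp := Γ.good_pt Q
  have hp' := Γ.good_pt Q'
  refine hG.Zc_inj hp.1 (h1 ▸ hp'.1) hp.2.1 ?_
  rw [← hG.good_inter hp (Γ.good_ln Q) (Γ.ne Q), ← hG.good_inter hp' (Γ.good_ln Q') (Γ.ne Q'), h1, h2]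

lemma Hyp.Zc_eq (hG : Hyp G) (Γ : Geo G) (Q : Sylow 11 G) : Γ.pt Q ⊓ Γ.ln Q = Zc (Q : Subgroup G) :=
  hG.good_inter (Γ.good_pt Q) (Γ.good_ln Q) (Γ.ne Q)

lemma Hyp.pt_of_le (hG : Hyp G) (Γ : Geo G) {Q Q' : Sylow 11 G} (h : Γ.pt Q ≤ Q') : Γ.pt Q' = Γ.pt Q := by
  obtain ⟨g, hg, rfl⟩ := hG.conj_over (Γ.good_pt Q).1 h (Γ.good_pt Q).2.1
  rw [Γ.pt_smul, cj_eq_iff]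
  exact hg

lemma Hyp.card_pt (hG : Hyp G) (Γ : Geo G) (Q : Sylow 11 G) :
    Nat.card {Q' : Sylow 11 G | Γ.pt Q' = Γ.pt Q} = 12 := by
  rw [← (hG.card_over (Γ.good_pt Q)).2.1]
  congr 2
  ext Q'
  exact ⟨fun h => (show Γ.pt Q' = Γ.pt Q from h) ▸ (Γ.good_pt Q').1, fun h => hG.pt_of_le Γ h⟩

lemma Hyp.inter_pt (hG : Hyp G) (Γ : Geo G) {Q Q' : Sylow 11 G} (hne : Q ≠ Q') (h : Γ.pt Q = Γ.pt Q') :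
    (Q : Subgroup G) ⊓ Q' = Γ.pt Q :=
  hG.inter_eq hne (Γ.good_pt Q).1 (h ▸ (Γ.good_pt Q').1) (Γ.good_pt Q).2.1

lemma Hyp.inter_ln (hG : Hyp G) (Γ : Geo G) {Q Q' : Sylow 11 G} (hne : Q ≠ Q') (h : Γ.ln Q = Γ.ln Q') :
    (Q : Subgroup G) ⊓ Q' = Γ.ln Q := hG.inter_pt Γ.dual hne h

lemma Hyp.mem_of_smul (hG : Hyp G) {Q R : Sylow 11 G} {a : G} (haR : a ∈ R) (h : a • Q = Q) : a ∈ Q := by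
  rw [Sylow.smul_eq_iff_mem_normalizer] at h
  have h1 : IsPGroup 11 (Subgroup.zpowers a) :=
    (isPGroup_of_card (k := 3) (R : Subgroup G) ((hG.sylow R).trans (by norm_num))).to_le
      (by rw [Subgroup.zpowers_le]; exact haR)
  have h2 := h1.inf_normalizer_sylow Q
  have h3 : a ∈ Subgroup.zpowers a ⊓ Subgroup.normalizer (Q : Set G) :=
    ⟨Subgroup.mem_zpowers a, h⟩
  rw [h2] at h3
  exact h3.2

lemma smul_self_of_mem {Q : Sylow 11 G} {a : G} (h : a ∈ Q) : a • Q = Q :=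
  Sylow.smul_eq_iff_mem_normalizer.2 (Subgroup.le_normalizer h)

lemma Geo.fix_pt (Γ : Geo G) {Q : Sylow 11 G} {a : G} (h : a ∈ Q) : MulAut.conj a • Γ.pt Q = Γ.pt Q := by
  rw [← Γ.pt_smul, smul_self_of_mem h]

lemma Geo.fix_ln (Γ : Geo G) {Q : Sylow 11 G} {a : G} (h : a ∈ Q) : MulAut.conj a • Γ.ln Q = Γ.ln Q := by
  rw [← Γ.ln_smul, smul_self_of_mem h]

lemma Hyp.stab (hG : Hyp G) (Γ : Geo G) {Q Q' : Sylow 11 G} (hne : Q ≠ Q') (h : Γ.ln Q = Γ.ln Q') :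
    Γ.pt Q ⊓ Subgroup.normalizer (Γ.pt Q' : Set G) = Zc (Q : Subgroup G) := by
  rw [← hG.Zc_eq Γ]
  ext a
  constructor
  · rintro ⟨h1, h2⟩
    refine ⟨h1, ?_⟩
    have hQ : a ∈ Q := (Γ.good_pt Q).1 h1
    have h3 : a • Q' = Q' := by
      apply hG.flag_ext Γ
      · rw [Γ.pt_smul]; exact (cj_eq_iff _ _).2 h2
      · rw [Γ.ln_smul, ← h, Γ.fix_ln hQ]
    have h4 : a ∈ (Q : Subgroup G) ⊓ Q' := ⟨hQ, hG.mem_of_smul hQ h3⟩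
    rw [hG.inter_ln Γ hne h] at h4
    exact h4
  · rintro ⟨h1, h2⟩
    refine ⟨h1, ?_⟩
    have h3 : a ∈ Q' := (Γ.good_ln Q').1 (h ▸ h2)
    exact (cj_eq_iff _ _).1 (Γ.fix_pt h3)

lemma Hyp.no_digon (hG : Hyp G) (Γ : Geo G) {Q11 Q21 Q12 Q22 : Sylow 11 G}
    (hp1 : Γ.pt Q11 = Γ.pt Q12) (hp2 : Γ.pt Q21 = Γ.pt Q22) (hne : Γ.pt Q11 ≠ Γ.pt Q21)
    (hl1 : Γ.ln Q11 = Γ.ln Q21) (hl2 : Γ.ln Q12 = Γ.ln Q22) : Q11 = Q12 ∧ Q21 = Q22 := by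
  have e1 := hG.stab Γ (fun h => hne (by rw [h])) hl1
  have e2 := hG.stab Γ (Q := Q12) (Q' := Q22) (fun h => hne (by rw [hp1, hp2, h])) hl2
  rw [hp1, hp2, e2] at e1
  have h1 : Q11 = Q12 := hG.Zc_inj (Γ.good_pt Q11).1 (hp1 ▸ (Γ.good_pt Q12).1) (Γ.good_pt Q11).2.1 e1.symm
  refine ⟨h1, hG.flag_ext Γ hp2 ?_⟩
  rw [← hl1, ← hl2, h1]

lemma Hyp.card_points (hG : Hyp G) (Γ : Geo G) : Nat.card (Set.range Γ.pt) = 133 := by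
  obtain ⟨P⟩ := (inferInstance : Nonempty (Sylow 11 G))
  have hn := (hG.m100 (Γ.good_pt P)).2
  have e : Nat.card (Sylow 11 G) = Nat.card (Σ p : Set.range Γ.pt, {Q : Sylow 11 G | Γ.pt Q = p.1}) := by
    symm
    refine Nat.card_eq_of_bijective (fun x => x.2.1) ⟨?_, ?_⟩
    · rintro ⟨⟨p, hp⟩, ⟨Q, hQ⟩⟩ ⟨⟨p', hp'⟩, ⟨Q', hQ'⟩⟩ hh
      obtain rfl : Q = Q' := hh
      obtain rfl : p = p' := (show Γ.pt Q = p from hQ).symm.trans hQ'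
      rfl
    · intro Q
      exact ⟨⟨⟨Γ.pt Q, Q, rfl⟩, ⟨Q, rfl⟩⟩, rfl⟩
  haveI := Fintype.ofFinite (Set.range Γ.pt)
  have h12 : ∀ p : Set.range Γ.pt, Nat.card {Q : Sylow 11 G | Γ.pt Q = p.1} = 12 := by
    rintro ⟨_, Q, rfl⟩
    exact hG.card_pt Γ Q
  rw [hn, Nat.card_sigma, Finset.sum_congr rfl (fun E _ => h12 E)] at e
  rw [Nat.card_eq_fintype_card]
  rw [Finset.sum_const, Finset.card_univ, smul_eq_mul] at e
  omega

lemma Hyp.join (hG : Hyp G) (Γ : Geo G) {P P' : Sylow 11 G} (hne : Γ.pt P ≠ Γ.pt P') :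
    ∃ Q Q' : Sylow 11 G, Γ.pt Q = Γ.pt P ∧ Γ.pt Q' = Γ.pt P' ∧ Γ.ln Q = Γ.ln Q' := by
  classical
  let S := Σ Q : {Q : Sylow 11 G | Γ.pt Q = Γ.pt P}, {Q' : Sylow 11 G | Q' ≠ Q.1 ∧ Γ.ln Q.1 ≤ Q'}
  let T := {p : Set.range Γ.pt | p ≠ ⟨Γ.pt P, P, rfl⟩}
  have cS : Nat.card S = 132 := by
    haveI := Fintype.ofFinite {Q : Sylow 11 G | Γ.pt Q = Γ.pt P}
    rw [Nat.card_sigma, Finset.sum_congr rfl (fun E _ => (hG.card_over (Γ.good_ln E.1)).1)]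
    have := hG.card_pt Γ P
    rw [Nat.card_eq_fintype_card] at this
    simp only [Finset.sum_const, Finset.card_univ, this]
    norm_num
  have cT : Nat.card T = 132 := by
    have h1 := hG.card_points Γ
    have h2 : T = ({⟨Γ.pt P, P, rfl⟩} : Set (Set.range Γ.pt))ᶜ := by
      ext x; rfl
    have h3 := Set.ncard_add_ncard_compl ({⟨Γ.pt P, P, rfl⟩} : Set (Set.range Γ.pt))
    rw [h1, Set.ncard_singleton, ← h2, ← Nat.card_coe_set_eq] at h3
    omega
  have hln : ∀ x : S, Γ.ln x.2.1 = Γ.ln x.1.1 := fun x => hG.pt_of_le Γ.dual x.2.2.2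
  have hpt : ∀ x : S, Γ.pt x.1.1 = Γ.pt P := fun x => x.1.2
  have hpn : ∀ x : S, Γ.pt x.2.1 ≠ Γ.pt P := by
    intro x h
    exact x.2.2.1 (hG.flag_ext Γ (h.trans (hpt x).symm) (hln x))
  let f : S → T := fun x => ⟨⟨Γ.pt x.2.1, x.2.1, rfl⟩, fun h => hpn x (congrArg Subtype.val h)⟩
  have hf : Function.Injective f := by
    intro x y hxy
    have h1 : Γ.pt x.2.1 = Γ.pt y.2.1 := congrArg (fun z : T => z.1.1) hxy
    have h2 := hG.no_digon Γ (Q11 := x.1.1) (Q12 := y.1.1) (Q21 := x.2.1) (Q22 := y.2.1)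
      ((hpt x).trans (hpt y).symm) h1 (by rw [hpt x]; exact (hpn x).symm) (hln x).symm (hln y).symm
    obtain ⟨⟨Q, hQ⟩, ⟨R, hR⟩⟩ := x
    obtain ⟨⟨Q', hQ'⟩, ⟨R', hR'⟩⟩ := y
    obtain ⟨h3, h4⟩ := h2
    simp only at h3 h4
    subst h3 h4
    rfl
  have hsurj : Function.Surjective f :=
    ((Nat.bijective_iff_injective_and_card f).2 ⟨hf, by rw [cS, cT]⟩).2
  obtain ⟨x, hx⟩ := hsurj ⟨⟨Γ.pt P', P', rfl⟩, fun h => hne (congrArg Subtype.val h).symm⟩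
  exact ⟨x.1.1, x.2.1, hpt x, congrArg (fun z : T => z.1.1) hx, (hln x).symm⟩

lemma Hyp.meet (hG : Hyp G) (Γ : Geo G) {P P' : Sylow 11 G} (hne : Γ.ln P ≠ Γ.ln P') :
    ∃ Q Q' : Sylow 11 G, Γ.ln Q = Γ.ln P ∧ Γ.ln Q' = Γ.ln P' ∧ Γ.pt Q = Γ.pt Q' :=
  hG.join Γ.dual hne

end stage3

set_option linter.unusedSectionVars false
open MulAction Pointwise

section stage3
variable {G : Type*} [Group G] [Finite G]

/-- Incidence between points and lines (both are subgroups of order 121). -/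
def Inc (Γ : Geo G) (p m : Subgroup G) : Prop := ∃ Q, Γ.pt Q = p ∧ Γ.ln Q = m

lemma Inc.smul {Γ : Geo G} {p m : Subgroup G} (h : Inc Γ p m) (g : G) :
    Inc Γ (MulAut.conj g • p) (MulAut.conj g • m) := by
  obtain ⟨Q, rfl, rfl⟩ := h
  exact ⟨g • Q, Γ.pt_smul g Q, Γ.ln_smul g Q⟩

lemma inc_smul_iff {Γ : Geo G} {p m : Subgroup G} (g : G) :
    Inc Γ (MulAut.conj g • p) (MulAut.conj g • m) ↔ Inc Γ p m := by
  refine ⟨fun h => ?_, fun h => h.smul g⟩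
  have := h.smul g⁻¹
  rwa [map_inv, inv_smul_smul, inv_smul_smul] at this

lemma Hyp.digon (hG : Hyp G) (Γ : Geo G) {p p' m m' : Subgroup G} (hne : p ≠ p') (h1 : Inc Γ p m)
    (h2 : Inc Γ p' m) (h3 : Inc Γ p m') (h4 : Inc Γ p' m') : m = m' := by
  obtain ⟨Q11, e1, e2⟩ := h1
  obtain ⟨Q21, e3, e4⟩ := h2
  obtain ⟨Q12, e5, e6⟩ := h3
  obtain ⟨Q22, e7, e8⟩ := h4
  have := (hG.no_digon Γ (e1.trans e5.symm) (e3.trans e7.symm) (by rw [e1, e3]; exact hne)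
    (e2.trans e4.symm) (e6.trans e8.symm)).1
  rw [← e2, this, e6]

lemma Hyp.join' (hG : Hyp G) (Γ : Geo G) {p p' : Subgroup G} (hp : p ∈ Set.range Γ.pt) (hp' : p' ∈ Set.range Γ.pt) :
    ∃ m, Inc Γ p m ∧ Inc Γ p' m := by
  obtain ⟨P, rfl⟩ := hp
  obtain ⟨P', rfl⟩ := hp'
  by_cases h : Γ.pt P = Γ.pt P'
  · exact ⟨Γ.ln P, ⟨P, rfl, rfl⟩, ⟨P, h, rfl⟩⟩
  · obtain ⟨Q, Q', h1, h2, h3⟩ := hG.join Γ h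
    exact ⟨Γ.ln Q, ⟨Q, h1, rfl⟩, ⟨Q', h2, h3.symm⟩⟩

lemma Hyp.fix_mem (hG : Hyp G) (Γ : Geo G) {R T : Sylow 11 G} {a : G} (h : Γ.pt T = Γ.pt R) (hne : Γ.ln T ≠ Γ.ln R)
    (ha : a ∈ Γ.ln R) (hfix : MulAut.conj a • Γ.ln T = Γ.ln T) : a ∈ Zc (R : Subgroup G) := by
  have haR : a ∈ R := (Γ.good_ln R).1 ha
  have h1 : a • T = T := by
    apply hG.flag_ext Γ
    · rw [Γ.pt_smul, h, Γ.fix_pt haR]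
    · rw [Γ.ln_smul, hfix]
  have h2 : a ∈ (R : Subgroup G) ⊓ T := ⟨haR, hG.mem_of_smul haR h1⟩
  rw [hG.inter_pt Γ (fun e => hne (by rw [e])) h.symm] at h2
  rw [← hG.Zc_eq Γ]
  exact ⟨h2, ha⟩

lemma Hyp.Zc_disj (hG : Hyp G) (Γ : Geo G) {R R' : Sylow 11 G} (hl : Γ.ln R = Γ.ln R') {a : G} (ha : a ≠ 1)
    (h : a ∈ Zc (R : Subgroup G)) (h' : a ∈ Zc (R' : Subgroup G)) : R = R' := by
  by_contra hne
  have hb : Zc (R : Subgroup G) ⊓ Zc (R' : Subgroup G) = ⊥ :=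
    prime_inter (p := 11) _ _ (hG.good_Zc (Γ.good_ln R)).2 (hG.good_Zc (Γ.good_ln R')).2
      (fun hh => hne (hG.Zc_inj (Γ.good_ln R).1 (hl ▸ (Γ.good_ln R').1) (Γ.good_ln R).2.1 hh))
  have : a ∈ Zc (R : Subgroup G) ⊓ Zc (R' : Subgroup G) := ⟨h, h'⟩
  rw [hb] at this
  exact ha this

lemma Hyp.free (hG : Hyp G) (Γ : Geo G) (Q0 : Sylow 11 G) {p : Subgroup G} (hp : p ∈ Set.range Γ.pt)
    (haff : ¬ Inc Γ p (Γ.ln Q0)) {a : G} (ha : a ∈ Γ.ln Q0) (hfix : MulAut.conj a • p = p) : a = 1 := by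
  have key : ∀ R : Sylow 11 G, Γ.ln R = Γ.ln Q0 → a ∈ Zc (R : Subgroup G) := by
    intro R hR
    obtain ⟨m, hm1, hm2⟩ := hG.join' Γ hp ⟨R, rfl⟩
    have hmne : m ≠ Γ.ln Q0 := by rintro rfl; exact haff hm1
    have hne : p ≠ Γ.pt R := by rintro rfl; exact haff ⟨R, rfl, hR⟩
    obtain ⟨T, hT1, rfl⟩ := hm2
    have haR : a ∈ R := (Γ.good_ln R).1 (hR ▸ ha)
    refine hG.fix_mem Γ hT1 (hR ▸ hmne) (hR ▸ ha) ?_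
    refine hG.digon Γ hne ?_ ?_ hm1 ⟨T, hT1, rfl⟩
    · have := hm1.smul a; rwa [hfix] at this
    · have := (show Inc Γ (Γ.pt R) (Γ.ln T) from ⟨T, hT1, rfl⟩).smul a
      rwa [Γ.fix_pt haR] at this
  obtain ⟨R', hR', hle⟩ := (Γ.good_ln Q0).2.2
  have hl : Γ.ln R' = Γ.ln Q0 := hG.pt_of_le Γ.dual hle
  by_contra h1
  exact hR' (hG.Zc_disj Γ hl h1 (key R' hl) (key Q0 rfl))

lemma Hyp.trans (hG : Hyp G) (Γ : Geo G) (Q0 : Sylow 11 G) {p q : Subgroup G} (hp : p ∈ Set.range Γ.pt)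
    (haff : ¬ Inc Γ p (Γ.ln Q0)) (hq : q ∈ Set.range Γ.pt) (hqa : ¬ Inc Γ q (Γ.ln Q0)) :
    ∃ a ∈ Γ.ln Q0, MulAut.conj a • p = q := by
  let X := {p : Set.range Γ.pt | Inc Γ p.1 (Γ.ln Q0)}
  have cX : Nat.card X = 12 := by
    rw [← hG.card_pt Γ.dual Q0]
    symm
    refine Nat.card_eq_of_bijective (fun Q => (⟨⟨Γ.pt Q.1, Q.1, rfl⟩, ⟨Q.1, rfl, Q.2⟩⟩ : X)) ⟨?_, ?_⟩
    · rintro ⟨Q, hQ⟩ ⟨Q', hQ'⟩ h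
      have h1 : Γ.pt Q = Γ.pt Q' := congrArg (fun z : X => z.1.1) h
      exact Subtype.ext (hG.flag_ext Γ h1 ((show Γ.ln Q = Γ.ln Q0 from hQ).trans hQ'.symm))
    · rintro ⟨⟨p, h⟩, hX⟩
      obtain ⟨Q, hQp, hQ⟩ := hX
      exact ⟨⟨Q, hQ⟩, Subtype.ext (Subtype.ext hQp)⟩
  have cXc : Nat.card (Xᶜ : Set (Set.range Γ.pt)) = 121 := by
    have h3 := Set.ncard_add_ncard_compl X
    rw [hG.card_points Γ, ← Nat.card_coe_set_eq, cX, ← Nat.card_coe_set_eq] at h3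
    omega
  have fixl : ∀ a ∈ Γ.ln Q0, MulAut.conj a • Γ.ln Q0 = Γ.ln Q0 := fun a ha => Γ.fix_ln ((Γ.good_ln Q0).1 ha)
  let f : Γ.ln Q0 → (Xᶜ : Set (Set.range Γ.pt)) := fun a =>
    ⟨⟨MulAut.conj a.1 • p, by
      obtain ⟨P, rfl⟩ := hp
      exact ⟨a.1 • P, Γ.pt_smul _ _⟩⟩, by
      intro h
      apply haff
      have h' : Inc Γ (MulAut.conj a.1 • p) (Γ.ln Q0) := h
      obtain ⟨Q, h1, h2⟩ := h'
      exact (inc_smul_iff a.1).1 ⟨Q, h1, h2.trans (fixl _ a.2).symm⟩⟩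
  have hf : Function.Injective f := by
    intro a b hab
    have h1 : MulAut.conj a.1 • p = MulAut.conj b.1 • p := congrArg (fun z : (Xᶜ : Set (Set.range Γ.pt)) => z.1.1) hab
    have h2 : MulAut.conj (b.1⁻¹ * a.1) • p = p := by
      rw [map_mul, mul_smul, h1, map_inv, inv_smul_smul]
    have := hG.free Γ Q0 hp haff (mul_mem (inv_mem b.2) a.2) h2
    exact Subtype.ext (inv_mul_eq_one.1 this).symm
  have hsurj : Function.Surjective f :=
    ((Nat.bijective_iff_injective_and_card f).2 ⟨hf, by rw [cXc, (Γ.good_ln Q0).2.1]⟩).2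
  obtain ⟨a, ha⟩ := hsurj ⟨⟨q, hq⟩, hqa⟩
  exact ⟨a.1, a.2, congrArg (fun z : (Xᶜ : Set (Set.range Γ.pt)) => z.1.1) ha⟩

lemma Hyp.exists_aff (hG : Hyp G) (Γ : Geo G) (Q0 : Sylow 11 G) :
    ∃ p ∈ Set.range Γ.pt, ¬ Inc Γ p (Γ.ln Q0) := by
  obtain ⟨R', hR', hle⟩ := (Γ.good_pt Q0).2.2
  have hp : Γ.pt R' = Γ.pt Q0 := hG.pt_of_le Γ hle
  obtain ⟨S, hS, hle⟩ := (Γ.good_ln R').2.2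
  have hl : Γ.ln S = Γ.ln R' := hG.pt_of_le Γ.dual hle
  refine ⟨Γ.pt S, ⟨S, rfl⟩, fun h => ?_⟩
  have hne : Γ.pt S ≠ Γ.pt R' := fun e => hS (hG.flag_ext Γ e hl)
  have := hG.digon Γ hne ⟨S, rfl, hl⟩ ⟨R', rfl, rfl⟩ h ⟨Q0, hp.symm, rfl⟩
  exact hR' (hG.flag_ext Γ hp this)

lemma Hyp.mline (hG : Hyp G) (Γ : Geo G) (Q0 : Sylow 11 G) {m : Subgroup G} (hm : m ∈ Set.range Γ.ln)
    (hne : m ≠ Γ.ln Q0) :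
    ∃ R, Γ.ln R = Γ.ln Q0 ∧ Inc Γ (Γ.pt R) m ∧ (∃ q ∈ Set.range Γ.pt, ¬ Inc Γ q (Γ.ln Q0) ∧ Inc Γ q m) ∧
      (∀ R', Γ.ln R' = Γ.ln Q0 → Inc Γ (Γ.pt R') m → R' = R) ∧
      ∀ q, ¬ Inc Γ q (Γ.ln Q0) → Inc Γ q m → ∀ a ∈ Γ.ln Q0,
        (Inc Γ (MulAut.conj a • q) m ↔ a ∈ Zc (R : Subgroup G)) := by
  obtain ⟨M, rfl⟩ := hm
  obtain ⟨T, R, hT, hR, hTR⟩ := hG.meet Γ hne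
  have hRm : Inc Γ (Γ.pt R) (Γ.ln M) := ⟨T, hTR, hT⟩
  have huniq : ∀ R', Γ.ln R' = Γ.ln Q0 → Inc Γ (Γ.pt R') (Γ.ln M) → R' = R := by
    intro R' hR' hi
    by_contra hn
    have : Γ.pt R' ≠ Γ.pt R := fun e => hn (hG.flag_ext Γ e (hR'.trans hR.symm))
    exact hne (hG.digon Γ this hi hRm ⟨R', rfl, hR'⟩ ⟨R, rfl, hR⟩)
  refine ⟨R, hR, hRm, ?_, huniq, ?_⟩
  · obtain ⟨U, hU, hle⟩ := (Γ.good_ln T).2.2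
    have hl : Γ.ln U = Γ.ln T := hG.pt_of_le Γ.dual hle
    refine ⟨Γ.pt U, ⟨U, rfl⟩, ?_, ⟨U, rfl, hl.trans hT⟩⟩
    rintro ⟨V, hV1, hV2⟩
    have h1 := huniq V hV2 ⟨U, hV1.symm, hl.trans hT⟩
    exact hU (hG.flag_ext Γ (by rw [hTR, ← h1, hV1]) hl)
  · intro q hqa hq a ha
    have haR : a ∈ R := (Γ.good_ln R).1 (hR ▸ ha)
    constructor
    · intro h
      have hTl : Γ.ln T ≠ Γ.ln R := by rw [hT, hR]; exact hne
      refine hG.fix_mem Γ hTR hTl (hR ▸ ha) ?_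
      have hne' : MulAut.conj a • q ≠ Γ.pt R := by
        intro e
        rw [← Γ.fix_pt haR] at e
        have := MulAction.injective (MulAut.conj a) e
        exact hqa ⟨R, this.symm, hR⟩
      rw [hT]
      refine hG.digon Γ hne' (hq.smul a) ?_ h hRm
      have := hRm.smul a
      rwa [Γ.fix_pt haR] at this
    · intro haZ
      rw [← hG.Zc_eq Γ] at haZ
      have haT : a ∈ T := (Γ.good_pt T).1 (hTR ▸ haZ.1)
      have h1 := Γ.fix_ln haT
      rw [hT] at h1
      rw [← h1]
      exact hq.smul a

end stage3

set_option linter.unusedSectionVars false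
open MulAction Pointwise

section linalg

/-- Vectors of length three over the field with eleven elements. -/
abbrev V3 := Fin 3 → ZMod 11

def cr (u v : V3) : V3 := ![u 1 * v 2 - u 2 * v 1, u 2 * v 0 - u 0 * v 2, u 0 * v 1 - u 1 * v 0]

def dp (u v : V3) : ZMod 11 := u 0 * v 0 + u 1 * v 1 + u 2 * v 2

def dt (u v w : V3) : ZMod 11 := dp (cr u v) w

lemma v3_ne {v : V3} (h : v ≠ 0) : ∃ i, v i ≠ 0 := Function.ne_iff.1 h

lemma par_of {v w : V3} (hv : v ≠ 0) (hw : w ≠ 0)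
    (h : cr v w = 0) : ∃ c : ZMod 11, c ≠ 0 ∧ w = c • v := by
  have h0 := congrFun h 0
  have h1 := congrFun h 1
  have h2 := congrFun h 2
  simp [cr] at h0 h1 h2
  obtain ⟨i, hi⟩ := v3_ne hv
  have key : w = (w i / v i) • v := by
    funext j
    simp only [Pi.smul_apply, smul_eq_mul]
    field_simp
    fin_cases i <;> fin_cases j <;> simp <;> grind
  refine ⟨w i / v i, fun h => hw ?_, key⟩
  rw [key, h, zero_smul]

lemma cr_zero_trans {n v w : V3} (hn : n ≠ 0) (hv : cr n v = 0) (hw : cr n w = 0) :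
    cr v w = 0 := by
  by_cases h1 : v = 0
  · subst h1; simp [cr]
  by_cases h2 : w = 0
  · subst h2; simp [cr]
  obtain ⟨c, _, rfl⟩ := par_of hn h1 hv
  obtain ⟨d, _, rfl⟩ := par_of hn h2 hw
  funext j
  fin_cases j <;> simp [cr] <;> ring

lemma cr_cr {n m w : V3} (h1 : dp n w = 0) (h2 : dp m w = 0) : cr (cr n m) w = 0 := by
  simp only [dp] at h1 h2
  funext j
  fin_cases j <;> simp [cr] <;> grind

lemma dt_smul (a b c : ZMod 11) (u v w : V3) : dt (a • u) (b • v) (c • w) = a * b * c * dt u v w := by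
  simp [dt, dp, cr]; ring

lemma dt_mulVec (M : Matrix (Fin 3) (Fin 3) (ZMod 11)) (u v w : V3) :
    dt (M.mulVec u) (M.mulVec v) (M.mulVec w) = M.det * dt u v w := by
  simp [dt, dp, cr, Matrix.det_fin_three, Matrix.mulVec, dotProduct, Fin.sum_univ_three]; ring

lemma dt_cyc (u v w : V3) : dt u v w = dt v w u := by
  simp [dt, dp, cr]; ring

/-- `s v` is proportional to `v`. -/
def Fx (s : V3 → V3) (v : V3) : Prop := ∃ c : ZMod 11, c ≠ 0 ∧ s v = c • v

lemma meet_fx {s : V3 → V3} (hs : ∀ v, v ≠ 0 → s v ≠ 0)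
    (hd : ∀ u v w, u ≠ 0 → v ≠ 0 → w ≠ 0 → dt u v w = 0 → dt (s u) (s v) (s w) = 0)
    {p q r t v : V3} (fp : Fx s p) (fq : Fx s q) (fr : Fx s r) (ft : Fx s t)
    (H : p ≠ 0 ∧ q ≠ 0 ∧ r ≠ 0 ∧ t ≠ 0 ∧ v ≠ 0 ∧ dt p q v = 0 ∧ dt r t v = 0 ∧ cr (cr p q) (cr r t) ≠ 0) :
    Fx s v := by
  obtain ⟨p0, q0, r0, t0, v0, h1, h2, h3⟩ := H
  obtain ⟨a, a0, ha⟩ := fp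
  obtain ⟨b, b0, hb⟩ := fq
  obtain ⟨c, c0, hc⟩ := fr
  obtain ⟨d, d0, hd'⟩ := ft
  have e1 := hd p q v p0 q0 v0 h1
  have e2 := hd r t v r0 t0 v0 h2
  rw [ha, hb, ← one_smul (ZMod 11) (s v), dt_smul] at e1
  rw [hc, hd', ← one_smul (ZMod 11) (s v), dt_smul] at e2
  have e3 : dt p q (s v) = 0 := by
    rcases mul_eq_zero.1 e1 with h | h
    · simp [a0, b0] at h
    · exact h
  have e4 : dt r t (s v) = 0 := by
    rcases mul_eq_zero.1 e2 with h | h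
    · simp [c0, d0] at h
    · exact h
  exact par_of v0 (hs v v0) (cr_zero_trans h3 (cr_cr h1 h2) (cr_cr e3 e4))

lemma frame_fx {s : V3 → V3} (hs : ∀ v, v ≠ 0 → s v ≠ 0)
    (hd : ∀ u v w, u ≠ 0 → v ≠ 0 → w ≠ 0 → dt u v w = 0 → dt (s u) (s v) (s w) = 0)
    (h1 : Fx s ![1, 0, 0]) (h2 : Fx s ![0, 1, 0]) (h3 : Fx s ![0, 0, 1]) (hu : Fx s ![1, 1, 1])
    (hsm : ∀ (c : ZMod 11) (v : V3), c ≠ 0 → v ≠ 0 → Fx s v → Fx s (c • v)) (v : V3) (hv : v ≠ 0) : Fx s v := by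
  have h110 : Fx s ![1, 1, 0] := meet_fx hs hd h1 h2 h3 hu (by decide +kernel)
  have h101 : Fx s ![1, 0, 1] := meet_fx hs hd h1 h3 h2 hu (by decide +kernel)
  have h011 : Fx s ![0, 1, 1] := meet_fx hs hd h2 h3 h1 hu (by decide +kernel)
  have hm : Fx s ![1, -1, 0] := meet_fx hs hd h1 h2 h101 h011 (by decide +kernel)
  have hx : ∀ k : ℕ, Fx s ![(k : ZMod 11), 0, 1] := by
    intro k
    induction k with
    | zero => simpa using h3
    | succ k ih =>
      push_cast
      generalize (k : ZMod 11) = n at ih ⊢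
      have h' : Fx s ![n, 1, 1] := meet_fx hs hd ih h2 h011 h1 (by clear * -; revert n; decide +kernel)
      exact meet_fx hs hd h' hm h1 h3 (by clear * -; revert n; decide +kernel)
  have hy : ∀ k : ℕ, Fx s ![0, (k : ZMod 11), 1] := by
    intro k
    induction k with
    | zero => simpa using h3
    | succ k ih =>
      push_cast
      generalize (k : ZMod 11) = n at ih ⊢
      have h' : Fx s ![1, n, 1] := meet_fx hs hd ih h1 h101 h2 (by clear * -; revert n; decide +kernel)
      exact meet_fx hs hd h' hm h2 h3 (by clear * -; revert n; decide +kernel)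
  have hxy : ∀ x y : ZMod 11, Fx s ![x, y, 1] := by
    intro x y
    have e1 := hx x.val
    have e2 := hy y.val
    rw [ZMod.natCast_zmod_val] at e1 e2
    exact meet_fx hs hd e1 h2 e2 h1 (by clear * -; revert x y; decide +kernel)
  have hy0 : ∀ y : ZMod 11, Fx s ![1, y, 0] := by
    intro y
    exact meet_fx hs hd h3 (hxy 1 y) h1 h2 (by clear * -; revert y; decide +kernel)
  by_cases c2 : v 2 = 0
  · by_cases c0 : v 0 = 0
    · have c1 : v 1 ≠ 0 := by
        intro c1; apply hv; funext j; fin_cases j <;> simp [c0, c1, c2]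
      have : v = v 1 • ![0, 1, 0] := by funext j; fin_cases j <;> simp [c0, c2]
      rw [this]
      exact hsm _ _ c1 (by decide) h2
    · have : v = v 0 • ![1, v 1 / v 0, 0] := by
        funext j; fin_cases j <;> simp [c2]
        field_simp
      rw [this]
      exact hsm _ _ c0 (fun h => by simpa using congrFun h 0) (hy0 _)
  · have : v = v 2 • ![v 0 / v 2, v 1 / v 2, 1] := by
      funext j; fin_cases j <;> simp <;> field_simp
    rw [this]
    exact hsm _ _ c2 (fun h => by simpa using congrFun h 2) (hxy _ _)

lemma dp_zero (u : V3) : dp 0 u = 0 := by simp [dp]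

lemma cr_of_dt {u v : V3} (h : ∀ w, w ≠ 0 → dt u v w = 0) : cr u v = 0 := by
  have h0 := h ![1, 0, 0] (by decide)
  have h1 := h ![0, 1, 0] (by decide)
  have h2 := h ![0, 0, 1] (by decide)
  simp [dt, dp] at h0 h1 h2
  funext j; fin_cases j <;> assumption

lemma sl_scale (M : Matrix (Fin 3) (Fin 3) (ZMod 11)) (h : M.det ≠ 0) :
    ∃ c : ZMod 11, c ≠ 0 ∧ (c • M).det = 1 := by
  have : ∀ d : ZMod 11, d ≠ 0 → ∃ c : ZMod 11, c ≠ 0 ∧ c ^ 3 * d = 1 := by decide +kernel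
  obtain ⟨c, c0, hc⟩ := this _ h
  exact ⟨c, c0, by rw [Matrix.det_smul]; simpa using hc⟩

theorem fundamental {s : V3 → V3} (hs : ∀ v, v ≠ 0 → s v ≠ 0)
    (hsc : ∀ (c : ZMod 11) (v : V3), c ≠ 0 → v ≠ 0 → s (c • v) = s v)
    (hd : ∀ u v w, u ≠ 0 → v ≠ 0 → w ≠ 0 → (dt u v w = 0 ↔ dt (s u) (s v) (s w) = 0)) :
    ∃ A : Matrix.SpecialLinearGroup (Fin 3) (ZMod 11), ∀ v, v ≠ 0 →
      ∃ c : ZMod 11, c ≠ 0 ∧ s v = c • (A.1.mulVec v) := by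
  let e0 : V3 := ![1, 0, 0]
  let e1 : V3 := ![0, 1, 0]
  let e2 : V3 := ![0, 0, 1]
  let u : V3 := ![1, 1, 1]
  have n0 : e0 ≠ 0 := by decide
  have n1 : e1 ≠ 0 := by decide
  have n2 : e2 ≠ 0 := by decide
  have nu : u ≠ 0 := by decide
  have d0 : dt (s e0) (s e1) (s e2) ≠ 0 := fun h => absurd ((hd _ _ _ n0 n1 n2).2 h) (by decide)
  have b0 : dt (s u) (s e1) (s e2) ≠ 0 := fun h => absurd ((hd _ _ _ nu n1 n2).2 h) (by decide)
  have b1 : dt (s e0) (s u) (s e2) ≠ 0 := fun h => absurd ((hd _ _ _ n0 nu n2).2 h) (by decide)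
  have b2 : dt (s e0) (s e1) (s u) ≠ 0 := fun h => absurd ((hd _ _ _ n0 n1 nu).2 h) (by decide)
  let b : V3 := ![dt (s u) (s e1) (s e2), dt (s e0) (s u) (s e2), dt (s e0) (s e1) (s u)]
  let M : Matrix (Fin 3) (Fin 3) (ZMod 11) := Matrix.of fun i j => ![s e0 i, s e1 i, s e2 i] j * b j
  have M0 : M.mulVec e0 = b 0 • s e0 := by
    funext i; simp [M, e0, Matrix.mulVec, dotProduct, Fin.sum_univ_three]; ring
  have M1 : M.mulVec e1 = b 1 • s e1 := by
    funext i; simp [M, e1, Matrix.mulVec, dotProduct, Fin.sum_univ_three]; ring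
  have M2 : M.mulVec e2 = b 2 • s e2 := by
    funext i; simp [M, e2, Matrix.mulVec, dotProduct, Fin.sum_univ_three]; ring
  have Mu : M.mulVec u = dt (s e0) (s e1) (s e2) • s u := by
    have gen : ∀ x y z w : V3, ∀ i, x i * dt w y z + y i * dt x w z + z i * dt x y w = dt x y z * w i := by
      intro x y z w i
      fin_cases i <;> simp [dt, dp, cr] <;> ring
    funext i
    have := gen (s e0) (s e1) (s e2) (s u) i
    simp [M, b, Matrix.mulVec, dotProduct, Fin.sum_univ_three]
    simp [u] at this ⊢
    exact this
  have hM : M.det ≠ 0 := by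
    intro h
    have := dt_mulVec M e0 e1 e2
    rw [h, zero_mul, M0, M1, M2, dt_smul] at this
    have hb : b 0 * b 1 * b 2 ≠ 0 := mul_ne_zero (mul_ne_zero b0 b1) b2
    exact (mul_ne_zero hb d0) this
  have hu : IsUnit M.det := hM.isUnit
  let s' : V3 → V3 := fun v => M⁻¹.mulVec (s v)
  have inv1 : ∀ v, M⁻¹.mulVec (M.mulVec v) = v := fun v => by
    rw [Matrix.mulVec_mulVec, Matrix.nonsing_inv_mul _ hu, Matrix.one_mulVec]
  have inv2 : ∀ v, M.mulVec (M⁻¹.mulVec v) = v := fun v => by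
    rw [Matrix.mulVec_mulVec, Matrix.mul_nonsing_inv _ hu, Matrix.one_mulVec]
  have hs' : ∀ v, v ≠ 0 → s' v ≠ 0 := by
    intro v hv h
    apply hs v hv
    rw [← inv2 (s v), show M⁻¹.mulVec (s v) = 0 from h, Matrix.mulVec_zero]
  have hd' : ∀ u v w, u ≠ 0 → v ≠ 0 → w ≠ 0 → dt u v w = 0 → dt (s' u) (s' v) (s' w) = 0 := by
    intro u v w hu hv hw h
    show dt (M⁻¹.mulVec _) (M⁻¹.mulVec _) (M⁻¹.mulVec _) = 0
    rw [dt_mulVec, (hd u v w hu hv hw).1 h, mul_zero]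
  have fx : ∀ (v : V3) (c d : ZMod 11), c ≠ 0 → M.mulVec v = c • s v → Fx s' v := by
    intro v c d hc h
    refine ⟨c⁻¹, inv_ne_zero hc, ?_⟩
    have : s v = c⁻¹ • M.mulVec v := by rw [h, smul_smul, inv_mul_cancel₀ hc, one_smul]
    show M⁻¹.mulVec (s v) = _
    rw [this, Matrix.mulVec_smul, inv1]
  have hsm : ∀ (c : ZMod 11) (v : V3), c ≠ 0 → v ≠ 0 → Fx s' v → Fx s' (c • v) := by
    intro c v hc hv ⟨a, ha, hav⟩
    refine ⟨a * c⁻¹, mul_ne_zero ha (inv_ne_zero hc), ?_⟩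
    have : s' (c • v) = s' v := congrArg M⁻¹.mulVec (hsc c v hc hv)
    rw [this, hav, smul_smul, mul_assoc, inv_mul_cancel₀ hc, mul_one]
  have all := frame_fx hs' hd' (fx _ _ 0 b0 M0) (fx _ _ 0 b1 M1) (fx _ _ 0 b2 M2) (fx _ _ 0 d0 Mu) hsm
  obtain ⟨c, c0, hc⟩ := sl_scale M hM
  refine ⟨⟨c • M, hc⟩, fun v hv => ?_⟩
  obtain ⟨a, a0, ha⟩ := all v hv
  refine ⟨a * c⁻¹, mul_ne_zero a0 (inv_ne_zero c0), ?_⟩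
  have : s v = M.mulVec (s' v) := (inv2 _).symm
  rw [this, ha, Matrix.mulVec_smul, Matrix.smul_mulVec, smul_smul, mul_assoc, inv_mul_cancel₀ c0, mul_one]

end linalg

set_option linter.unusedSectionVars false
open MulAction Pointwise

section stage4
variable {G : Type*} [Group G] [Finite G]

lemma pow_zval_add {e : G} (h : e ^ 11 = 1) (x y : ZMod 11) : e ^ (x + y).val = e ^ x.val * e ^ y.val := by
  rw [ZMod.val_add, ← pow_add, pow_eq_pow_mod (x.val + y.val) h]

lemma exists_ne_one_of_card {H : Subgroup G} (h : Nat.card H = 11) : ∃ g ∈ H, g ≠ 1 := by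
  have : H ≠ ⊥ := by rintro rfl; simp at h
  exact (Subgroup.ne_bot_iff_exists_ne_one.1 this).elim fun a ha => ⟨a.1, a.2, fun e => ha (Subtype.ext e)⟩

/-- A coordinatisation of the group of order 121. -/
structure Tr (L : Subgroup G) where
  t : ZMod 11 → ZMod 11 → G
  add : ∀ x y x' y', t (x + x') (y + y') = t x y * t x' y'
  mem : ∀ x y, t x y ∈ L
  surj : ∀ a ∈ L, ∃ x y, t x y = a
  inj : ∀ x y, t x y = 1 → x = 0 ∧ y = 0

lemma Hyp.exists_tr (hG : Hyp G) (Γ : Geo G) (Q0 : Sylow 11 G) : Nonempty (Tr (Γ.ln Q0)) := by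
  obtain ⟨R, hR, hle⟩ := (Γ.good_ln Q0).2.2
  have hl : Γ.ln R = Γ.ln Q0 := hG.pt_of_le Γ.dual hle
  obtain ⟨e1, m1, n1⟩ := exists_ne_one_of_card (hG.good_Zc (Γ.good_ln Q0)).2
  obtain ⟨e2, m2, n2⟩ := exists_ne_one_of_card (hG.good_Zc (Γ.good_ln R)).2
  have c2 := (hG.good_Zc (Γ.good_ln R)).2
  have c1 := (hG.good_Zc (Γ.good_ln Q0)).2
  have l1 : e1 ∈ Γ.ln Q0 := (hG.good_Zc (Γ.good_ln Q0)).1 m1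
  have l2 : e2 ∈ Γ.ln Q0 := hl ▸ (hG.good_Zc (Γ.good_ln R)).1 m2
  have o1 : orderOf e1 = 11 := by
    have h := Subgroup.orderOf_dvd_natCard _ m1
    rw [c1] at h
    rcases (Nat.dvd_prime (by norm_num)).1 h with h | h
    · exact absurd (orderOf_eq_one_iff.1 h) n1
    · exact h
  have o2 : orderOf e2 = 11 := by
    have h := Subgroup.orderOf_dvd_natCard _ m2
    rw [c2] at h
    rcases (Nat.dvd_prime (by norm_num)).1 h with h | h
    · exact absurd (orderOf_eq_one_iff.1 h) n2
    · exact h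
  have p1 : e1 ^ 11 = 1 := o1 ▸ pow_orderOf_eq_one e1
  have p2 : e2 ^ 11 = 1 := o2 ▸ pow_orderOf_eq_one e2
  have hc : Commute e1 e2 := comm121 (Γ.good_ln Q0).2.1 l1 l2
  have hdisj : ∀ a, a ∈ Zc (Q0 : Subgroup G) → a ∈ Zc (R : Subgroup G) → a = 1 := by
    intro a h1 h2
    by_contra h
    exact hR (hG.Zc_disj Γ hl h h2 h1)
  have zero_of : ∀ (e : G) (x : ZMod 11), orderOf e = 11 → e ^ x.val = 1 → x = 0 := by
    intro e x ho h
    have h := orderOf_dvd_of_pow_eq_one h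
    rw [ho] at h
    have h0 := Nat.eq_zero_of_dvd_of_lt h (ZMod.val_lt x)
    exact (ZMod.val_eq_zero x).1 h0
  let t : ZMod 11 → ZMod 11 → G := fun x y => e1 ^ x.val * e2 ^ y.val
  have hadd : ∀ x y x' y', t (x + x') (y + y') = t x y * t x' y' := by
    intro x y x' y'
    simp only [t]
    rw [pow_zval_add p1, pow_zval_add p2, mul_assoc, mul_assoc]
    congr 1
    rw [← mul_assoc, ← mul_assoc, (hc.pow_pow x'.val y.val).eq]
  have hmem : ∀ x y, t x y ∈ Γ.ln Q0 := fun x y => mul_mem (pow_mem l1 _) (pow_mem l2 _)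
  have hinj : ∀ x y, t x y = 1 → x = 0 ∧ y = 0 := by
    intro x y h
    have h1 : e1 ^ x.val = 1 := by
      apply hdisj _ (pow_mem m1 _)
      rw [eq_inv_of_mul_eq_one_left h]
      exact inv_mem (pow_mem m2 _)
    have h2 : e2 ^ y.val = 1 := by
      have h' : e1 ^ x.val * e2 ^ y.val = 1 := h
      rwa [h1, one_mul] at h'
    exact ⟨zero_of _ _ o1 h1, zero_of _ _ o2 h2⟩
  refine ⟨⟨t, hadd, hmem, ?_, hinj⟩⟩
  let f : ZMod 11 × ZMod 11 → Γ.ln Q0 := fun z => ⟨t z.1 z.2, hmem _ _⟩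
  have hf : Function.Injective f := by
    rintro ⟨x, y⟩ ⟨x', y'⟩ h
    have h : t x y = t x' y' := congrArg Subtype.val h
    have h2 := hadd (x - x') (y - y') x' y'
    rw [sub_add_cancel, sub_add_cancel, h] at h2
    obtain ⟨h3, h4⟩ := hinj _ _ (right_eq_mul.1 h2)
    rw [sub_eq_zero.1 h3, sub_eq_zero.1 h4]
  have hs : Function.Surjective f :=
    ((Nat.bijective_iff_injective_and_card f).2 ⟨hf, by rw [(Γ.good_ln Q0).2.1]; simp⟩).2
  intro a ha
  obtain ⟨z, hz⟩ := hs ⟨a, ha⟩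
  exact ⟨z.1, z.2, congrArg Subtype.val hz⟩

variable {L : Subgroup G}

lemma Tr.zero (T : Tr L) : T.t 0 0 = 1 := by
  have h := T.add 0 0 0 0
  rw [add_zero] at h
  exact left_eq_mul.1 h

lemma Tr.mul_mem (T : Tr L) {H : Subgroup G} {x y : ZMod 11} (h : T.t x y ∈ H) (c : ZMod 11) :
    T.t (c * x) (c * y) ∈ H := by
  have key : ∀ k : ℕ, T.t (k * x) (k * y) ∈ H := by
    intro k
    induction k with
    | zero => simp [T.zero, one_mem]
    | succ k ih =>
      push_cast
      rw [add_mul, add_mul, one_mul, one_mul, T.add]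
      exact Subgroup.mul_mem _ ih h
  have := key c.val
  rwa [ZMod.natCast_zmod_val] at this

lemma Tr.lin (T : Tr L) (hL : Nat.card L = 121) {H : Subgroup G} (hH : Nat.card H = 11) (hle : H ≤ L) :
    ∃ μ ν : ZMod 11, (μ ≠ 0 ∨ ν ≠ 0) ∧ ∀ x y, T.t x y ∈ H ↔ μ * x + ν * y = 0 := by
  obtain ⟨g, hg, g1⟩ := exists_ne_one_of_card hH
  obtain ⟨x0, y0, rfl⟩ := T.surj g (hle hg)
  have hne : y0 ≠ 0 ∨ -x0 ≠ 0 := by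
    by_contra! h
    apply g1
    rw [h.1, neg_eq_zero.1 h.2, T.zero]
  refine ⟨y0, -x0, hne, fun x y => ⟨fun h => ?_, fun h => ?_⟩⟩
  · by_contra hD
    have : L ≤ H := by
      intro a ha
      obtain ⟨p, q, rfl⟩ := T.surj a ha
      obtain ⟨α, β, e1, e2⟩ : ∃ α β : ZMod 11, p = α * x0 + β * x ∧ q = α * y0 + β * y := by
        obtain ⟨D, hDe⟩ : ∃ D, D = y0 * x + -x0 * y := ⟨_, rfl⟩
        rw [← hDe] at hD
        refine ⟨(q * x - p * y) / D, (y0 * p - x0 * q) / D, ?_, ?_⟩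
        · field_simp; rw [hDe]; ring
        · field_simp; rw [hDe]; ring
      rw [e1, e2, T.add]
      exact Subgroup.mul_mem _ (T.mul_mem hg _) (T.mul_mem h _)
    have := Subgroup.card_le_of_le this
    omega
  · rcases hne with hy | hx
    · obtain ⟨c, e1, e2⟩ : ∃ c : ZMod 11, x = c * x0 ∧ y = c * y0 :=
        ⟨y / y0, by field_simp; linear_combination h, by field_simp⟩
      rw [e1, e2]
      exact T.mul_mem hg c
    · have hx := neg_ne_zero.1 hx
      obtain ⟨c, e1, e2⟩ : ∃ c : ZMod 11, x = c * x0 ∧ y = c * y0 :=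
        ⟨x / x0, by field_simp, by field_simp; linear_combination -h⟩
      rw [e1, e2]
      exact T.mul_mem hg c

end stage4

set_option linter.unusedSectionVars false
open MulAction Pointwise

section stage5
variable {G : Type*} [Group G] [Finite G]

/-- Homogeneous coordinates on the geometry. -/
structure Coord (Γ : Geo G) where
  Φ : V3 → Subgroup G
  mem : ∀ v, v ≠ 0 → Φ v ∈ Set.range Γ.pt
  surj : ∀ p ∈ Set.range Γ.pt, ∃ v, v ≠ 0 ∧ Φ v = p
  smul : ∀ (c : ZMod 11) (v : V3), c ≠ 0 → v ≠ 0 → Φ (c • v) = Φ v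
  line : ∀ m ∈ Set.range Γ.ln, ∃ n : V3, n ≠ 0 ∧ ∀ v, v ≠ 0 → (Inc Γ (Φ v) m ↔ dp n v = 0)

lemma Geo.pt_conj (Γ : Geo G) {p : Subgroup G} (hp : p ∈ Set.range Γ.pt) (g : G) :
    MulAut.conj g • p ∈ Set.range Γ.pt := by
  obtain ⟨P, rfl⟩ := hp
  exact ⟨g • P, Γ.pt_smul _ _⟩

lemma Geo.ln_conj (Γ : Geo G) {p : Subgroup G} (hp : p ∈ Set.range Γ.ln) (g : G) :
    MulAut.conj g • p ∈ Set.range Γ.ln := by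
  obtain ⟨P, rfl⟩ := hp
  exact ⟨g • P, Γ.ln_smul _ _⟩

lemma Hyp.aff_conj (Γ : Geo G) (Q0 : Sylow 11 G) {p : Subgroup G} {a : G} (ha : a ∈ Γ.ln Q0) :
    Inc Γ (MulAut.conj a • p) (Γ.ln Q0) ↔ Inc Γ p (Γ.ln Q0) := by
  have h1 := Γ.fix_ln ((Γ.good_ln Q0).1 ha)
  have h2 := inc_smul_iff (Γ := Γ) (p := p) (m := Γ.ln Q0) a
  rwa [h1] at h2

lemma Hyp.exists_coord (hG : Hyp G) (Γ : Geo G) : Nonempty (Coord Γ) := by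
  obtain ⟨Q0⟩ : Nonempty (Sylow 11 G) := inferInstance
  obtain ⟨T⟩ := hG.exists_tr Γ Q0
  obtain ⟨o, ho, hoa⟩ := hG.exists_aff Γ Q0
  have hcov : ∀ a ∈ Γ.ln Q0, a ≠ 1 → ∃ R, Γ.ln R = Γ.ln Q0 ∧ a ∈ Zc (R : Subgroup G) := by
    intro a ha h1
    obtain ⟨Q, hQ, haQ⟩ := (hG.card_over (Γ.good_ln Q0)).2.2 a ha h1
    exact ⟨Q, hG.pt_of_le Γ.dual hQ, haQ⟩
  have hcov' : ∀ a, ∃ R, a ∈ Γ.ln Q0 → a ≠ 1 → Γ.ln R = Γ.ln Q0 ∧ a ∈ Zc (R : Subgroup G) := by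
    intro a
    by_cases h : a ∈ Γ.ln Q0 ∧ a ≠ 1
    · obtain ⟨R, hR⟩ := hcov a h.1 h.2
      exact ⟨R, fun _ _ => hR⟩
    · exact ⟨Q0, fun h1 h2 => absurd ⟨h1, h2⟩ h⟩
  choose ρ hρ using hcov'
  classical
  let Φ : V3 → Subgroup G := fun v =>
    if v 2 = 0 then Γ.pt (ρ (T.t (v 0) (v 1))) else MulAut.conj (T.t (v 0 / v 2) (v 1 / v 2)) • o
  have Φ0 : ∀ v, v 2 = 0 → Φ v = Γ.pt (ρ (T.t (v 0) (v 1))) := fun v h => if_pos h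
  have Φ1 : ∀ v, v 2 ≠ 0 → Φ v = MulAut.conj (T.t (v 0 / v 2) (v 1 / v 2)) • o := fun v h => if_neg h
  have hne : ∀ v : V3, v ≠ 0 → v 2 = 0 → T.t (v 0) (v 1) ≠ 1 := by
    intro v hv h2 h
    obtain ⟨h0, h1⟩ := T.inj _ _ h
    apply hv
    funext j
    fin_cases j
    · exact h0
    · exact h1
    · exact h2
  have huniq : ∀ v : V3, v ≠ 0 → v 2 = 0 → ∀ R, Γ.ln R = Γ.ln Q0 → T.t (v 0) (v 1) ∈ Zc (R : Subgroup G) →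
      ρ (T.t (v 0) (v 1)) = R := by
    intro v hv h2 R hR hm
    obtain ⟨h3, h4⟩ := hρ _ (T.mem (v 0) (v 1)) (hne v hv h2)
    exact hG.Zc_disj Γ (h3.trans hR.symm) (hne v hv h2) h4 hm
  have hlin : ∀ R, Γ.ln R = Γ.ln Q0 → ∃ μ ν : ZMod 11, (μ ≠ 0 ∨ ν ≠ 0) ∧
      ∀ x y, T.t x y ∈ Zc (R : Subgroup G) ↔ μ * x + ν * y = 0 := fun R hR =>
    T.lin (Γ.good_ln Q0).2.1 (hG.good_Zc (Γ.good_ln R)).2 (hR ▸ (hG.good_Zc (Γ.good_ln R)).1)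
  refine ⟨⟨Φ, ?_, ?_, ?_, ?_⟩⟩
  · intro v hv
    by_cases h2 : v 2 = 0
    · rw [Φ0 v h2]; exact ⟨_, rfl⟩
    · rw [Φ1 v h2]; exact Γ.pt_conj ho _
  · intro p hp
    by_cases h : Inc Γ p (Γ.ln Q0)
    · obtain ⟨R, rfl, hR⟩ := h
      obtain ⟨g, hg, g1⟩ := exists_ne_one_of_card (hG.good_Zc (Γ.good_ln R)).2
      obtain ⟨x, y, rfl⟩ := T.surj g (hR ▸ (hG.good_Zc (Γ.good_ln R)).1 hg)
      have hv : (![x, y, 0] : V3) ≠ 0 := by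
        intro h
        apply g1
        have h0 : x = 0 := congrFun h 0
        have h1 : y = 0 := congrFun h 1
        rw [h0, h1, T.zero]
      refine ⟨![x, y, 0], hv, ?_⟩
      rw [Φ0 _ rfl, huniq _ hv rfl R hR hg]
    · obtain ⟨a, ha, hap⟩ := hG.trans Γ Q0 ho hoa hp h
      obtain ⟨x, y, rfl⟩ := T.surj a ha
      refine ⟨![x, y, 1], fun h => by simpa using congrFun h 2, ?_⟩
      rw [Φ1 _ (by simp)]
      simpa using hap
  · intro c v hc hv
    by_cases h2 : v 2 = 0
    · have h2' : (c • v) 2 = 0 := by simp [h2]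
      rw [Φ0 _ h2, Φ0 _ h2']
      congr 1
      obtain ⟨h3, h4⟩ := hρ _ (T.mem (v 0) (v 1)) (hne v hv h2)
      exact huniq (c • v) (smul_ne_zero hc hv) h2' _ h3 (T.mul_mem h4 c)
    · have h2' : (c • v) 2 ≠ 0 := by simp [h2, hc]
      rw [Φ1 _ h2, Φ1 _ h2']
      simp only [Pi.smul_apply, smul_eq_mul, mul_div_mul_left _ _ hc]
  · intro m hm
    by_cases hml : m = Γ.ln Q0
    · subst hml
      refine ⟨![0, 0, 1], by decide, fun v hv => ?_⟩
      have : dp ![0, 0, 1] v = v 2 := by simp [dp]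
      rw [this]
      by_cases h2 : v 2 = 0
      · rw [Φ0 _ h2]
        simp only [h2, iff_true]
        exact ⟨_, rfl, (hρ _ (T.mem (v 0) (v 1)) (hne v hv h2)).1⟩
      · rw [Φ1 _ h2, Hyp.aff_conj Γ Q0 (T.mem _ _)]
        simp [h2, hoa]
    · obtain ⟨R, hR, hRm, ⟨q, hq, hqa, hqm⟩, hun, hiff⟩ := hG.mline Γ Q0 hm hml
      obtain ⟨μ, ν, hμν, hmem⟩ := hlin R hR
      obtain ⟨a, ha, haq⟩ := hG.trans Γ Q0 ho hoa hq hqa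
      obtain ⟨x, y, rfl⟩ := T.surj a ha
      refine ⟨![μ, ν, -(μ * x + ν * y)], ?_, fun v hv => ?_⟩
      · intro h
        rcases hμν with h' | h'
        · exact h' (congrFun h 0)
        · exact h' (congrFun h 1)
      · by_cases h2 : v 2 = 0
        · rw [Φ0 _ h2]
          have e : dp ![μ, ν, -(μ * x + ν * y)] v = μ * v 0 + ν * v 1 := by simp [dp, h2]
          rw [e, ← hmem]
          obtain ⟨h3, h4⟩ := hρ _ (T.mem (v 0) (v 1)) (hne v hv h2)
          constructor
          · intro h
            rw [← hun _ h3 h]; exact h4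
          · intro h
            rw [huniq v hv h2 R hR h]; exact hRm
        · rw [Φ1 _ h2]
          have e1 : T.t (v 0 / v 2) (v 1 / v 2) = T.t (v 0 / v 2 - x) (v 1 / v 2 - y) * T.t x y := by
            rw [← T.add, sub_add_cancel, sub_add_cancel]
          rw [e1, map_mul, mul_smul, haq, hiff q hqa hqm _ (T.mem _ _), hmem]
          have e2 : dp ![μ, ν, -(μ * x + ν * y)] v = (μ * (v 0 / v 2 - x) + ν * (v 1 / v 2 - y)) * v 2 := by
            simp [dp]; field_simp; ring
          rw [e2, mul_eq_zero]
          simp [h2]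

/-- Three points lie on a common line. -/
def Col (Γ : Geo G) (p q r : Subgroup G) : Prop := ∃ m, Inc Γ p m ∧ Inc Γ q m ∧ Inc Γ r m

lemma col_smul_iff {Γ : Geo G} {p q r : Subgroup G} (g : G) :
    Col Γ (MulAut.conj g • p) (MulAut.conj g • q) (MulAut.conj g • r) ↔ Col Γ p q r := by
  have key : ∀ (g : G) {p q r : Subgroup G}, Col Γ p q r →
      Col Γ (MulAut.conj g • p) (MulAut.conj g • q) (MulAut.conj g • r) := by
    rintro g p q r ⟨m, h1, h2, h3⟩
    exact ⟨_, h1.smul g, h2.smul g, h3.smul g⟩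
  refine ⟨fun h => ?_, key g⟩
  have := key g⁻¹ h
  rwa [map_inv, inv_smul_smul, inv_smul_smul, inv_smul_smul] at this

lemma dt_of_dp {n u v w : V3} (hn : n ≠ 0) (h1 : dp n u = 0) (h2 : dp n v = 0) (h3 : dp n w = 0) :
    dt u v w = 0 := by
  obtain ⟨i, hi⟩ := v3_ne hn
  have : n i * dt u v w = 0 := by
    simp only [dp] at h1 h2 h3
    fin_cases i <;> simp [dt, dp, cr, -mul_eq_zero]
    · linear_combination (v 1 * w 2 - v 2 * w 1) * h1 + (w 1 * u 2 - w 2 * u 1) * h2 + (u 1 * v 2 - u 2 * v 1) * h3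
    · linear_combination (v 2 * w 0 - v 0 * w 2) * h1 + (w 2 * u 0 - w 0 * u 2) * h2 + (u 2 * v 0 - u 0 * v 2) * h3
    · linear_combination (v 0 * w 1 - v 1 * w 0) * h1 + (w 0 * u 1 - w 1 * u 0) * h2 + (u 0 * v 1 - u 1 * v 0) * h3
  rcases mul_eq_zero.1 this with h | h
  · exact absurd h hi
  · exact h

lemma Coord.eq_of (Γ : Geo G) (K : Coord Γ) {u v : V3} (hu : u ≠ 0) (hv : v ≠ 0) (h : cr u v = 0) : K.Φ u = K.Φ v := by
  obtain ⟨c, c0, rfl⟩ := par_of hu hv h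
  exact (K.smul c u c0 hu).symm

lemma Hyp.col_iff (hG : Hyp G) {Γ : Geo G} (K : Coord Γ) {u v w : V3} (hu : u ≠ 0) (hv : v ≠ 0) (hw : w ≠ 0) :
    Col Γ (K.Φ u) (K.Φ v) (K.Φ w) ↔ dt u v w = 0 := by
  constructor
  · rintro ⟨m, h1, h2, h3⟩
    obtain ⟨n, hn, hi⟩ := K.line m (by obtain ⟨Q, -, rfl⟩ := h1; exact ⟨Q, rfl⟩)
    exact dt_of_dp hn ((hi u hu).1 h1) ((hi v hv).1 h2) ((hi w hw).1 h3)
  · intro h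
    by_cases hp : cr u v = 0
    · obtain ⟨m, h1, h2⟩ := hG.join' Γ (K.mem u hu) (K.mem w hw)
      exact ⟨m, h1, K.eq_of Γ hu hv hp ▸ h1, h2⟩
    · obtain ⟨m, h1, h2⟩ := hG.join' Γ (K.mem u hu) (K.mem v hv)
      refine ⟨m, h1, h2, ?_⟩
      obtain ⟨n, hn, hi⟩ := K.line m (by obtain ⟨Q, -, rfl⟩ := h1; exact ⟨Q, rfl⟩)
      rw [hi w hw]
      have e1 := (hi u hu).1 h1
      have e2 := (hi v hv).1 h2
      have hc : cr (cr u v) n = 0 := cr_cr (by rw [← e1]; simp [dp]; ring) (by rw [← e2]; simp [dp]; ring)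
      obtain ⟨c, c0, rfl⟩ := par_of hp hn hc
      have : dp (c • cr u v) w = c * dt u v w := by simp [dt, dp]; ring
      rw [this, h, mul_zero]

lemma Hyp.par_of_eq (hG : Hyp G) {Γ : Geo G} (K : Coord Γ) {u v : V3} (hu : u ≠ 0) (hv : v ≠ 0)
    (h : K.Φ u = K.Φ v) : ∃ c : ZMod 11, c ≠ 0 ∧ v = c • u := by
  apply par_of hu hv
  apply cr_of_dt
  intro w hw
  rw [← hG.col_iff K hu hv hw, h]
  obtain ⟨m, h1, h2⟩ := hG.join' Γ (K.mem v hv) (K.mem w hw)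
  exact ⟨m, h1, h1, h2⟩

lemma Hyp.exists_A (hG : Hyp G) {Γ : Geo G} (K : Coord Γ) (g : G) :
    ∃ A : Matrix.SpecialLinearGroup (Fin 3) (ZMod 11), ∀ v, v ≠ 0 → K.Φ (A.1.mulVec v) = MulAut.conj g • K.Φ v := by
  have hl : ∀ p : Subgroup G, ∃ v : V3, v ≠ 0 ∧ (p ∈ Set.range Γ.pt → K.Φ v = p) := by
    intro p
    by_cases h : p ∈ Set.range Γ.pt
    · obtain ⟨v, hv, h'⟩ := K.surj p h
      exact ⟨v, hv, fun _ => h'⟩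
    · exact ⟨![1, 0, 0], by decide, fun h' => absurd h' h⟩
  choose lft lne leq using hl
  let s : V3 → V3 := fun v => lft (MulAut.conj g • K.Φ v)
  have hs : ∀ v, v ≠ 0 → K.Φ (s v) = MulAut.conj g • K.Φ v := fun v hv =>
    leq _ (Γ.pt_conj (K.mem v hv) g)
  obtain ⟨A, hA⟩ := fundamental (s := s) (fun v _ => lne _)
    (fun c v hc hv => by simp only [s]; rw [K.smul c v hc hv])
    (fun u v w hu hv hw => by
      rw [← hG.col_iff K hu hv hw, ← hG.col_iff K (lne _) (lne _) (lne _), hs u hu, hs v hv, hs w hw, col_smul_iff])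
  refine ⟨A, fun v hv => ?_⟩
  obtain ⟨c, c0, hc⟩ := hA v hv
  rw [← hs v hv, hc, K.smul c _ c0]
  intro h0
  rw [h0, smul_zero] at hc
  exact lne _ hc

abbrev S3 := Matrix.SpecialLinearGroup (Fin 3) (ZMod 11)

lemma sl_ne {A : S3} {v : V3} (hv : v ≠ 0) : A.1.mulVec v ≠ 0 := by
  intro h
  apply hv
  have h2 : (A⁻¹).1.mulVec (A.1.mulVec v) = v := by
    rw [Matrix.mulVec_mulVec, ← Matrix.SpecialLinearGroup.coe_mul, inv_mul_cancel]; simp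
  rw [← h2, h, Matrix.mulVec_zero]

lemma Hyp.A_one (hG : Hyp G) {Γ : Geo G} (K : Coord Γ) {A : S3}
    (h : ∀ v, v ≠ 0 → K.Φ (A.1.mulVec v) = K.Φ v) : A = 1 := by
  have key : ∀ v, v ≠ 0 → cr v (A.1.mulVec v) = 0 := by
    intro v hv
    obtain ⟨c, c0, hc⟩ := hG.par_of_eq K hv (sl_ne hv) (h v hv).symm
    rw [hc]
    funext j
    fin_cases j <;> simp [cr] <;> ring
  have k0 := key ![1, 0, 0] (by decide)
  have k1 := key ![0, 1, 0] (by decide)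
  have k2 := key ![0, 0, 1] (by decide)
  have k3 := key ![1, 1, 1] (by decide)
  have a1 := congrFun k0 1
  have a2 := congrFun k0 2
  have b0 := congrFun k1 0
  have b2 := congrFun k1 2
  have c0 := congrFun k2 0
  have c1 := congrFun k2 1
  have d0 := congrFun k3 0
  have d1 := congrFun k3 1
  simp [cr, Matrix.mulVec, dotProduct, Fin.sum_univ_three] at a1 a2 b0 b2 c0 c1 d0 d1
  have hdet := A.2
  rw [Matrix.det_fin_three] at hdet
  rw [c1] at d1
  simp [a1, a2, b0, b2, c0, c1] at d0 d1
  have e1 : A.1 1 1 = A.1 0 0 := by grind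
  have e2 : A.1 2 2 = A.1 0 0 := by grind
  simp [a1, a2, b0, b2, c0, c1, e1, e2] at hdet
  have cube : ∀ x : ZMod 11, x * x * x = 1 → x = 1 := by decide +kernel
  have := cube _ hdet
  ext i j
  fin_cases i <;> fin_cases j <;> simp [*]

lemma Hyp.exists_hom (hG : Hyp G) {Γ : Geo G} (K : Coord Γ) :
    ∃ f : G →* S3, ∀ g, f g = 1 → ∀ p ∈ Set.range Γ.pt, MulAut.conj g • p = p := by
  choose A hA using hG.exists_A K
  have uniq : ∀ (g : G) (B : S3), (∀ v, v ≠ 0 → K.Φ (B.1.mulVec v) = MulAut.conj g • K.Φ v) → B = A g := by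
    intro g B hB
    rw [← inv_mul_eq_one (a := B)]
    apply hG.A_one K
    intro v hv
    rw [Matrix.SpecialLinearGroup.coe_mul, ← Matrix.mulVec_mulVec]
    have hw := sl_ne (A := A g) hv
    have h1 := hB ((B⁻¹).1.mulVec ((A g).1.mulVec v)) (sl_ne hw)
    rw [Matrix.mulVec_mulVec, ← Matrix.SpecialLinearGroup.coe_mul, mul_inv_cancel, Matrix.SpecialLinearGroup.coe_one,
      Matrix.one_mulVec, hA g v hv] at h1
    exact (MulAction.injective _ h1).symm
  refine ⟨MonoidHom.mk' A fun g h => (uniq (g * h) (A g * A h) fun v hv => ?_).symm, fun g hg p hp => ?_⟩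
  · rw [Matrix.SpecialLinearGroup.coe_mul, ← Matrix.mulVec_mulVec, hA g _ (sl_ne hv), hA h v hv, map_mul, mul_smul]
  · obtain ⟨v, hv, rfl⟩ := K.surj p hp
    have hg' : A g = 1 := hg
    rw [← hA g v hv, hg', Matrix.SpecialLinearGroup.coe_one, Matrix.one_mulVec]

end stage5

set_option linter.unusedSectionVars false
open MulAction Pointwise
open scoped MatrixGroups

section stage6
variable {G : Type*} [Group G] [Finite G]

instance fact5' : Fact (Nat.Prime 5) := ⟨by norm_num⟩
instance fact19' : Fact (Nat.Prime 19) := ⟨by norm_num⟩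

lemma adj19 {r : ℕ} (hr : r.Prime) (h19 : 19 ≠ r) (E : Subgroup G) {x : G} (ox : orderOf x = 19)
    (hx : x ∈ Subgroup.normalizer (E : Set G)) {k : ℕ} (hE : Nat.card E = r ^ k) (hmod : ¬ Nat.card E ≡ 1 [MOD 19]) :
    primeGraphAdj G 19 r := by
  have cQ : Nat.card (Subgroup.zpowers x) = 19 := by rw [Nat.card_zpowers, ox]
  have h := card_fixed_modEq (q := 19) (Subgroup.zpowers x) E (IsPGroup.of_card (n := 1) (by rw [cQ, pow_one]))
    (by rwa [Subgroup.zpowers_le])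
  have hd : Nat.card (E ⊓ Subgroup.centralizer (Subgroup.zpowers x : Set G) : Subgroup G) ∣ r ^ k :=
    hE ▸ Subgroup.card_dvd_of_le inf_le_left
  obtain ⟨j, hj, hc⟩ := (Nat.dvd_prime_pow hr).1 hd
  have hj0 : j ≠ 0 := by
    rintro rfl
    rw [hc, pow_zero] at h
    exact hmod h
  refine adj_of_dvd_centralizer (p := 19) hr h19 (Subgroup.zpowers x) (by rw [cQ]) ?_
  have h2 : r ∣ Nat.card (E ⊓ Subgroup.centralizer (Subgroup.zpowers x : Set G) : Subgroup G) := by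
    rw [hc]; exact dvd_pow_self r hj0
  exact h2.trans (Subgroup.card_dvd_of_le inf_le_right)

lemma Hyp.ker_fix (hG : Hyp G) (Γ : Geo G) {k : G} (h : ∀ p ∈ Set.range Γ.pt, MulAut.conj k • p = p)
    (Q : Sylow 11 G) : k • Q = Q := by
  apply hG.flag_ext Γ
  · rw [Γ.pt_smul, h _ ⟨Q, rfl⟩]
  · rw [Γ.ln_smul]
    obtain ⟨R, hR, hle⟩ := (Γ.good_ln Q).2.2
    have hl : Γ.ln R = Γ.ln Q := hG.pt_of_le Γ.dual hle
    have hne : Γ.pt R ≠ Γ.pt Q := fun e => hR (hG.flag_ext Γ e hl)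
    have h1 : Inc Γ (Γ.pt R) (Γ.ln Q) := ⟨R, rfl, hl⟩
    have h2 : Inc Γ (Γ.pt Q) (Γ.ln Q) := ⟨Q, rfl, rfl⟩
    refine hG.digon Γ hne ?_ ?_ h1 h2
    · have := h1.smul k; rwa [h _ ⟨R, rfl⟩] at this
    · have := h2.smul k; rwa [h _ ⟨Q, rfl⟩] at this

lemma Hyp.ker_bot (hG : Hyp G) (Γ : Geo G) (K : Subgroup G) [K.Normal]
    (h : ∀ k ∈ K, ∀ p ∈ Set.range Γ.pt, MulAut.conj k • p = p) : K = ⊥ := by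
  obtain ⟨Q0⟩ : Nonempty (Sylow 11 G) := inferInstance
  have h11 : ¬ 11 ∣ Nat.card K := by
    intro hd
    obtain ⟨x, hx, ox⟩ := exists_orderOf hd
    obtain ⟨R, hR⟩ := (IsPGroup.of_card (p := 11) (G := Subgroup.zpowers x) (n := 1)
      (by rw [Nat.card_zpowers, ox, pow_one])).exists_le_sylow
    have hxR : x ∈ R := hR (Subgroup.mem_zpowers x)
    have hall : ∀ Q : Sylow 11 G, x ∈ Q := fun Q => hG.mem_of_smul hxR (hG.ker_fix Γ (h x hx) Q)
    obtain ⟨S, hS, hle⟩ := (Γ.good_ln Q0).2.2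
    have hl : Γ.ln S = Γ.ln Q0 := hG.pt_of_le Γ.dual hle
    have hxl : x ∈ Γ.ln Q0 := by
      rw [← hG.inter_ln Γ hS.symm hl.symm]
      exact ⟨hall Q0, hall S⟩
    obtain ⟨p, hp, hpa⟩ := hG.exists_aff Γ Q0
    have := hG.free Γ Q0 hp hpa hxl (h x hx p hp)
    rw [this, orderOf_one] at ox
    norm_num at ox
  have h100 : Nat.card K ∣ 100 := by
    have hle : K ≤ Subgroup.normalizer (Q0 : Set G) := fun k hk => Sylow.smul_eq_iff_mem_normalizer.1 (hG.ker_fix Γ (h k hk) Q0)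
    have hd := Subgroup.card_dvd_of_le hle
    rw [show Nat.card (Subgroup.normalizer (Q0 : Set G)) = 1331 * 100 from (hG.m100 (Γ.good_ln Q0)).1] at hd
    exact strip (a := 3) (p := 11) (by norm_num) (by simpa using hd) h11
  have h19 : ¬ 19 ∣ Nat.card K := fun hd => absurd (hd.trans h100) (by norm_num)
  have hG19 : 19 ∣ Nat.card G := by rw [hG.card]; norm_num
  have h5 : ¬ 5 ∣ Nat.card K := by
    intro h5
    obtain ⟨S⟩ : Nonempty (Sylow 5 K) := inferInstance
    have hF := Sylow.normalizer_sup_eq_top S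
    set E : Subgroup G := (S : Subgroup K).map K.subtype with hEdef
    have cE : Nat.card E = Nat.card S := (Nat.card_congr (S.1.equivMapOfInjective _ K.subtype_injective).toEquiv).symm
    have hN : 19 ∣ Nat.card (Subgroup.normalizer (E : Set G)) := by
      have h1 : K.index ∣ Nat.card (Subgroup.normalizer (E : Set G)) := by
        rw [← Subgroup.relIndex_top_right, ← hF, Subgroup.relIndex_sup_right]
        exact Subgroup.relIndex_dvd_card _ _
      have h2 := K.index_mul_card
      rw [← h2] at hG19
      rcases (Nat.Prime.dvd_mul (by norm_num)).1 hG19 with h3 | h3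
      · exact h3.trans h1
      · exact absurd h3 h19
    obtain ⟨x, hx, ox⟩ := exists_orderOf hN
    have d5 : 5 ∣ Nat.card S := S.dvd_card_of_dvd_card h5
    have d25 : Nat.card S ∣ 25 := by
      obtain ⟨n, hn⟩ := (IsPGroup.iff_card).1 S.isPGroup'
      have h4 : Nat.card S ∣ 100 := (Subgroup.card_subgroup_dvd_card (S : Subgroup K)).trans h100
      have e : Nat.card S = 5 ^ n := hn
      rw [e] at h4 ⊢
      exact (Nat.Coprime.dvd_of_dvd_mul_left (Nat.Coprime.pow_left n (by norm_num : Nat.Coprime 5 4)) h4)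
    have hcase : ∀ d ∈ Nat.divisors 25, 5 ∣ d → d = 5 ^ 1 ∨ d = 5 ^ 2 := by decide
    rcases hcase _ (Nat.mem_divisors.2 ⟨d25, by norm_num⟩) d5 with hh | hh
    · exact hG.n195 (adj19 (by norm_num) (by norm_num) E ox hx (cE.trans hh) (by rw [cE, hh]; decide))
    · exact hG.n195 (adj19 (by norm_num) (by norm_num) E ox hx (cE.trans hh) (by rw [cE, hh]; decide))
  have h4 : Nat.card K ∣ 4 := strip (a := 2) (p := 5) (by norm_num) (by simpa using h100) h5
  obtain ⟨x, ox⟩ := exists_prime_orderOf_dvd_card' (G := G) 19 hG19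
  have hx : x ∈ Subgroup.normalizer (K : Set G) := by rw [Subgroup.normalizer_eq_top]; trivial
  have hcase : ∀ d ∈ Nat.divisors 4, d = 1 ∨ d = 2 ^ 1 ∨ d = 2 ^ 2 := by decide
  rcases hcase _ (Nat.mem_divisors.2 ⟨h4, by norm_num⟩) with hh | hh | hh
  · exact Subgroup.card_eq_one.1 hh
  · exact absurd (adj19 (by norm_num) (by norm_num) K ox hx hh (by rw [hh]; decide)) hG.n192
  · exact absurd (adj19 (by norm_num) (by norm_num) K ox hx hh (by rw [hh]; decide)) hG.n192

lemma card_S3 : Nat.card S3 = 11 ^ 3 * 159600 := by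
  have h1 := Matrix.card_GL_field (𝔽 := ZMod 11) 3
  simp [Fin.prod_univ_three] at h1
  let f : GL (Fin 3) (ZMod 11) →* (ZMod 11)ˣ := Matrix.GeneralLinearGroup.det
  have hsurj : Function.Surjective f := by
    intro c
    refine ⟨Matrix.GeneralLinearGroup.mkOfDetNeZero (Matrix.diagonal ![(c : ZMod 11), 1, 1]) (by
      simp [Matrix.det_diagonal, Fin.prod_univ_three]), ?_⟩
    ext
    simp [f, Matrix.GeneralLinearGroup.mkOfDetNeZero, Matrix.det_diagonal, Fin.prod_univ_three]
  have hk := f.ker.card_mul_index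
  rw [Subgroup.index_ker, MonoidHom.range_eq_top.2 hsurj, Subgroup.card_top, Nat.card_units, Nat.card_eq_fintype_card (α := GL (Fin 3) (ZMod 11)), h1] at hk
  have e : Nat.card S3 = Nat.card f.ker := by
    refine Nat.card_eq_of_bijective (fun A : S3 => (⟨Matrix.SpecialLinearGroup.toGL A, ?_⟩ : f.ker)) ⟨?_, ?_⟩
    · rw [MonoidHom.mem_ker]; ext; simp [f]
    · intro A B hAB
      exact Matrix.SpecialLinearGroup.toGL_injective (congrArg Subtype.val hAB)
    · rintro ⟨A, hA⟩
      refine ⟨⟨A.1, ?_⟩, ?_⟩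
      · have := congrArg Units.val (MonoidHom.mem_ker.1 hA)
        simpa [f] using this
      · apply Subtype.ext; ext; rfl
  rw [e]
  have h10 : Nat.card (ZMod 11) - 1 = 10 := by rw [Nat.card_zmod 11]
  rw [h10, show 2124276000 = 11 ^ 3 * 159600 * 10 by norm_num] at hk
  exact Nat.eq_of_mul_eq_mul_right (by norm_num) hk

lemma center_S3 : Subgroup.center S3 = ⊥ := by
  rw [eq_bot_iff]
  intro A hA
  obtain ⟨r, hr, hrA⟩ := Matrix.SpecialLinearGroup.mem_center_iff.1 hA
  have cube : ∀ x : ZMod 11, x ^ 3 = 1 → x = 1 := by decide +kernel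
  have h1 : r = 1 := cube r (by simpa using hr)
  rw [Subgroup.mem_bot]
  apply Subtype.ext
  rw [← hrA, h1, map_one]
  rfl

lemma Hyp.final (hG : Hyp G) : Nonempty (G ≃* PSL(3, ZMod 11)) := by
  obtain ⟨Γ⟩ := hG.exists_geo
  obtain ⟨K⟩ := hG.exists_coord Γ
  obtain ⟨f, hf⟩ := hG.exists_hom K
  have hker : f.ker = ⊥ := hG.ker_bot Γ f.ker fun k hk => hf k (MonoidHom.mem_ker.1 hk)
  have hinj : Function.Injective f := (MonoidHom.ker_eq_bot_iff f).1 hker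
  have hbij : Function.Bijective f := (Nat.bijective_iff_injective_and_card f).2 ⟨hinj, by rw [hG.card, card_S3]⟩
  exact ⟨(MulEquiv.ofBijective f hbij).trans
    (QuotientGroup.quotientBot.symm.trans (QuotientGroup.quotientMulEquivOfEq center_S3.symm))⟩

end stage6

theorem L3_11_OD_characterizable (G : Type*) [Group G] [Finite G]
    (hcard : Nat.card G = 2 ^ 4 * 3 * 5 ^ 2 * 7 * 11 ^ 3 * 19)
    (hdeg2 : primeGraphDeg G 2 = 3)
    (hdeg3 : primeGraphDeg G 3 = 2)
    (hdeg5 : primeGraphDeg G 5 = 3)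
    (hdeg7 : primeGraphDeg G 7 = 1)
    (hdeg11 : primeGraphDeg G 11 = 2)
    (hdeg19 : primeGraphDeg G 19 = 1) :
    Nonempty (G ≃* PSL(3, ZMod 11)) := by
  obtain ⟨h1, h2, h3, h4, h5⟩ := stage1 hcard hdeg2 hdeg3 hdeg5 hdeg7 hdeg11 hdeg19
  exact Hyp.final ⟨by rw [hcard]; norm_num, h1, h2, h3, h4, h5⟩
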